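/- arXiv:1507.06095 — 5 statements merged into one kernel-verified Lean document; each statement's English description precedes it below -/
import Mathlib

section
/- Under the standing assumptions on a, b, F, suppose there exist t₁, t₂ ∈ (0,1) with t₁ < t₂ such that ∫_{t₁}^{t₂} b(t) dt > 0, min{k₀, k_∞}·A(1)·|b|_L < 1, and max{k₀, k_∞}·∫_{t₁}^{t₂} b(t) dt > A(1)/(A(t₁)(A(1) − A(t₂))). Then the equation (a(t)x')' + b(t)F(x) = 0 has, on [0,1], a solution x₁ ∈ Δ₁ and a solution x₂ ∈ Δ₂. -/
open Set Filter MeasureTheory Topology Real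

/-- `x` (with derivative `x'`) is a solution of `(a(t) x')' + c(t) F(x) = 0` on `I`:
`x` is `C¹` on `I`, `t ↦ a t * x' t` is `C¹` on `I`, and the equation holds on `I`. -/
def SolODE (a c F : ℝ → ℝ) (I : Set ℝ) (x x' : ℝ → ℝ) : Prop :=
  (∀ t ∈ I, HasDerivWithinAt x (x' t) I t) ∧ ContinuousOn x' I ∧
  ∃ w : ℝ → ℝ, (∀ t ∈ I, HasDerivWithinAt (fun s => a s * x' s) (w t) I t) ∧
    ContinuousOn w I ∧ ∀ t ∈ I, w t + c t * F (x t) = 0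

/-- `z` (with derivatives `z'`, `z''`) is a `C²` solution of `z'' + c(t) F(z) = 0` on `I`. -/
def SolODE2 (c F : ℝ → ℝ) (I : Set ℝ) (z z' z'' : ℝ → ℝ) : Prop :=
  (∀ t ∈ I, HasDerivWithinAt z (z' t) I t) ∧ (∀ t ∈ I, HasDerivWithinAt z' (z'' t) I t) ∧
  ContinuousOn z'' I ∧ ∀ t ∈ I, z'' t + c t * F (z t) = 0

/-- The linear equation `(a(t) y')' + β(t) y = 0` is disconjugate on `I`:
every nontrivial solution has at most one zero in `I`. -/
def Disconjugate (a β : ℝ → ℝ) (I : Set ℝ) : Prop :=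
  ∀ y y' : ℝ → ℝ, SolODE a β id I y y' → (∃ t ∈ I, y t ≠ 0) →
    ∀ t₁ ∈ I, ∀ t₂ ∈ I, y t₁ = 0 → y t₂ = 0 → t₁ = t₂

/-- The linear equation `v'' + β(t) v = 0` is disconjugate on `I`:
every nontrivial solution has at most one zero in `I`. -/
def Disconjugate2 (β : ℝ → ℝ) (I : Set ℝ) : Prop :=
  ∀ v v' v'' : ℝ → ℝ, SolODE2 β id I v v' v'' → (∃ t ∈ I, v t ≠ 0) →
    ∀ t₁ ∈ I, ∀ t₂ ∈ I, v t₁ = 0 → v t₂ = 0 → t₁ = t₂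

open Metric in
/-- A bounded, globally Lipschitz time-dependent vector field has a flow on `[0, 1]`. -/
theorem exists_flow_Icc_zero_one {E : Type*} [NormedAddCommGroup E] [NormedSpace ℝ E]
    [CompleteSpace E] {f : ℝ → E → E} {K L : NNReal}
    (hlip : ∀ t ∈ Icc (0:ℝ) 1, LipschitzWith K (f t))
    (hcont : ∀ z, ContinuousOn (fun t => f t z) (Icc 0 1))
    (hbd : ∀ t ∈ Icc (0:ℝ) 1, ∀ z, ‖f t z‖ ≤ L) (r : NNReal) :
    ∃ φ : E → ℝ → E, (∀ z ∈ closedBall (0:E) r, φ z 0 = z ∧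
      ∀ t ∈ Icc (0:ℝ) 1, HasDerivWithinAt (φ z) (f t (φ z t)) (Icc 0 1) t) ∧
      ContinuousOn (fun z => φ z 1) (closedBall 0 r) := by
  have hPL : IsPicardLindelof f (tmin := 0) (tmax := 1) ⟨0, by simp⟩ (0:E) (L + r) r L K :=
    { lipschitzOnWith := fun t ht => (hlip t ht).lipschitzOnWith
      continuousOn := fun z _ => hcont z
      norm_le := fun t ht z _ => hbd t ht z
      mul_max_le := by simp }
  obtain ⟨φ, hφ, L', hL'⟩ :=
    hPL.exists_forall_mem_closedBall_eq_hasDerivWithinAt_lipschitzOnWith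
  exact ⟨φ, hφ, (hL' 1 (by simp)).continuousOn⟩

/-- `(x, w)` solves `x' = p w`, `w' = -q G(x)` on `[0, 1]` with `x 0 = 0` and `w 0 = α`. -/
structure IsShot (p q G : ℝ → ℝ) (α : ℝ) (x w : ℝ → ℝ) : Prop where
  x_zero : x 0 = 0
  w_zero : w 0 = α
  hasDeriv_x : ∀ t ∈ Icc (0:ℝ) 1, HasDerivWithinAt x (p t * w t) (Icc 0 1) t
  hasDeriv_w : ∀ t ∈ Icc (0:ℝ) 1, HasDerivWithinAt w (-(q t * G (x t))) (Icc 0 1) t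

theorem antitoneOn_Icc_of_hasDerivWithinAt_nonpos {f f' : ℝ → ℝ} {a b : ℝ}
    (hf : ∀ t ∈ Icc a b, HasDerivWithinAt f (f' t) (Icc a b) t)
    (hf' : ∀ t ∈ Icc a b, f' t ≤ 0) : AntitoneOn f (Icc a b) :=
  antitoneOn_of_hasDerivWithinAt_nonpos (convex_Icc a b)
    (fun t ht => (hf t ht).continuousWithinAt)
    (fun t ht => (hf t (interior_subset ht)).mono interior_subset)
    (fun t ht => hf' t (interior_subset ht))

theorem monotoneOn_Icc_of_hasDerivWithinAt_nonneg {f f' : ℝ → ℝ} {a b : ℝ}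
    (hf : ∀ t ∈ Icc a b, HasDerivWithinAt f (f' t) (Icc a b) t)
    (hf' : ∀ t ∈ Icc a b, 0 ≤ f' t) : MonotoneOn f (Icc a b) :=
  monotoneOn_of_hasDerivWithinAt_nonneg (convex_Icc a b)
    (fun t ht => (hf t ht).continuousWithinAt)
    (fun t ht => (hf t (interior_subset ht)).mono interior_subset)
    (fun t ht => hf' t (interior_subset ht))

/-- Shooting from `α ∈ [0, r]` is possible, continuously in `α`, when `G` is bounded. -/
theorem exists_shots_of_bounded {p q G : ℝ → ℝ} (hp : Continuous p) (hq : Continuous q)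
    (hq0 : ∀ t, 0 ≤ q t) (hG : LipschitzWith 1 G) (hG0 : ∀ u, 0 ≤ G u)
    {M : ℝ} (hGM : ∀ u, G u ≤ M) {r : ℝ} (hr : 0 ≤ r) :
    ∃ X W : ℝ → ℝ → ℝ, (∀ α ∈ Icc 0 r, IsShot p q G α (X α) (W α)) ∧
      ContinuousOn (fun α => X α 1) (Icc 0 r) ∧ ContinuousOn (fun α => W α 1) (Icc 0 r) := by
  obtain ⟨P, hP⟩ := (isCompact_Icc (a := (0:ℝ)) (b := 1)).exists_bound_of_continuousOn
    hp.continuousOn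
  obtain ⟨Q, hQ⟩ := (isCompact_Icc (a := (0:ℝ)) (b := 1)).exists_bound_of_continuousOn
    hq.continuousOn
  have hP0 : 0 ≤ P := (norm_nonneg _).trans (hP 0 (by simp))
  have hQ0 : 0 ≤ Q := (norm_nonneg _).trans (hQ 0 (by simp))
  have hM0 : 0 ≤ M := (hG0 0).trans (hGM 0)
  simp only [Real.norm_eq_abs] at hP hQ
  set R := r + Q * M with hR
  have hR0 : 0 ≤ R := by positivity
  set c : ℝ → ℝ := fun w => max (-R) (min R w) with hc
  have hc_abs : ∀ w, |c w| ≤ R := fun w =>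
    abs_le.2 ⟨le_max_left _ _, max_le (by linarith) (min_le_left _ _)⟩
  have hc_lip : ∀ v w, |c v - c w| ≤ |v - w| := fun v w => by
    refine (abs_max_sub_max_le_max _ _ _ _).trans ?_
    refine max_le (by simp) ?_
    refine (abs_min_sub_min_le_max _ _ _ _).trans (max_le (by simp) le_rfl)
  have hc_eq : ∀ w, -R ≤ w → w ≤ R → c w = w := fun w h₁ h₂ => by
    simp only [hc, min_eq_right h₂, max_eq_right h₁]
  set f : ℝ → ℝ × ℝ → ℝ × ℝ := fun t z => (p t * c z.2, -(q t * G z.1)) with hf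
  have hlip : ∀ t ∈ Icc (0:ℝ) 1, LipschitzWith ⟨P + Q, by positivity⟩ (f t) := by
    intro t ht
    refine LipschitzWith.of_dist_le_mul fun y z => ?_
    simp only [hf, Prod.dist_eq, Real.dist_eq]
    change max _ _ ≤ (P + Q) * max _ _
    have h1 : |p t * c y.2 - p t * c z.2| ≤ P * |y.2 - z.2| := by
      rw [← mul_sub, abs_mul]
      exact mul_le_mul (hP t ht) (hc_lip _ _) (abs_nonneg _) hP0
    have h2 : |-(q t * G y.1) - -(q t * G z.1)| ≤ Q * |y.1 - z.1| := by
      rw [show -(q t * G y.1) - -(q t * G z.1) = -(q t * (G y.1 - G z.1)) by ring, abs_neg,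
        abs_mul]
      refine mul_le_mul (hQ t ht) ?_ (abs_nonneg _) hQ0
      simpa [Real.dist_eq] using hG.dist_le_mul y.1 z.1
    have h3 := le_max_left |y.1 - z.1| |y.2 - z.2|
    have h4 := le_max_right |y.1 - z.1| |y.2 - z.2|
    have h5 := abs_nonneg (y.1 - z.1)
    refine max_le ?_ ?_ <;> nlinarith
  have hcont : ∀ z, ContinuousOn (fun t => f t z) (Icc 0 1) := fun z => by
    simp only [hf]; fun_prop
  have hbd : ∀ t ∈ Icc (0:ℝ) 1, ∀ z, ‖f t z‖ ≤ (⟨P * R + Q * M, by positivity⟩ : NNReal) := by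
    intro t ht z
    simp only [hf, Prod.norm_def, Real.norm_eq_abs, abs_neg, abs_mul]
    have h1 : |p t| * |c z.2| ≤ P * R := mul_le_mul (hP t ht) (hc_abs _) (abs_nonneg _) hP0
    have h2 : |q t| * |G z.1| ≤ Q * M :=
      mul_le_mul (hQ t ht) (by rw [abs_of_nonneg (hG0 _)]; exact hGM _) (abs_nonneg _) hQ0
    have h3 : 0 ≤ P * R := by positivity
    have h4 : 0 ≤ Q * M := by positivity
    exact max_le (by linarith) (by linarith)
  obtain ⟨φ, hφ, hφc⟩ := exists_flow_Icc_zero_one hlip hcont hbd ⟨r, hr⟩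
  have hmem : ∀ α ∈ Icc (0:ℝ) r, ((0, α) : ℝ × ℝ) ∈ Metric.closedBall (0 : ℝ × ℝ) r :=
    fun α hα => by simp [Prod.norm_def, abs_of_nonneg hα.1, hα.2, hr]
  have hφc' : ContinuousOn (fun α : ℝ => φ (0, α) 1) (Icc 0 r) :=
    hφc.comp (by fun_prop) hmem
  refine ⟨fun α t => (φ (0, α) t).1, fun α t => (φ (0, α) t).2, fun α hα => ?_,
    hφc'.fst, hφc'.snd⟩
  obtain ⟨h0, hd⟩ := hφ _ (hmem α hα)
  have hdw : ∀ t ∈ Icc (0:ℝ) 1, HasDerivWithinAt (fun t => (φ (0, α) t).2)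
      (-(q t * G (φ (0, α) t).1)) (Icc 0 1) t := fun t ht => (hd t ht).snd
  have hanti := antitoneOn_Icc_of_hasDerivWithinAt_nonpos hdw
    (fun t _ => neg_nonpos.2 (mul_nonneg (hq0 t) (hG0 _)))
  have hmono := monotoneOn_Icc_of_hasDerivWithinAt_nonneg
    (fun t ht => (hdw t ht).add ((hasDerivWithinAt_id t _).const_mul (Q * M)))
    (fun t ht => by
      have := mul_le_mul ((le_abs_self _).trans (hQ t ht)) (hGM (φ (0, α) t).1) (hG0 _) hQ0
      simp only [mul_one]; linarith)
  refine ⟨by simp [h0], by simp [h0], fun t ht => ?_, hdw⟩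
  have h1 := hanti (left_mem_Icc.2 zero_le_one) ht ht.1
  have h2 := hmono (left_mem_Icc.2 zero_le_one) ht ht.1
  simp only [h0, Pi.add_apply, id, mul_zero, add_zero] at h1 h2
  have h3 : Q * M * t ≤ Q * M := mul_le_of_le_one_right (by positivity) ht.2
  have := (hd t ht).fst
  simp only [hf] at this
  rwa [hc_eq _ (by linarith [hα.1]) (by
    have : 0 ≤ Q * M := by positivity
    linarith [hα.2])] at this

theorem integral_zero_sub_integral_zero {p : ℝ → ℝ} (hp : Continuous p) (s t : ℝ) :
    (∫ τ in (0:ℝ)..t, p τ) - (∫ τ in (0:ℝ)..s, p τ) = ∫ τ in s..t, p τ :=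
  intervalIntegral.integral_interval_sub_left (hp.intervalIntegrable _ _)
    (hp.intervalIntegrable _ _)

theorem strictMono_integral_zero {p : ℝ → ℝ} (hp : Continuous p) (hp0 : ∀ t, 0 < p t) :
    StrictMono fun t => ∫ τ in (0:ℝ)..t, p τ := fun s t hst => by
  rw [← sub_pos, integral_zero_sub_integral_zero hp]
  exact intervalIntegral.intervalIntegral_pos_of_pos (hp.intervalIntegrable _ _) hp0 hst

theorem integral_zero_pos {p : ℝ → ℝ} (hp : Continuous p) (hp0 : ∀ t, 0 < p t) {t : ℝ}
    (ht : 0 < t) : 0 < ∫ τ in (0:ℝ)..t, p τ :=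
  intervalIntegral.intervalIntegral_pos_of_pos (hp.intervalIntegrable _ _) hp0 ht

namespace IsShot

variable {p q G : ℝ → ℝ} {α : ℝ} {x w : ℝ → ℝ}

theorem w_antitoneOn (h : IsShot p q G α x w) (hq0 : ∀ t, 0 ≤ q t) (hG0 : ∀ u, 0 ≤ G u) :
    AntitoneOn w (Icc 0 1) :=
  antitoneOn_Icc_of_hasDerivWithinAt_nonpos h.hasDeriv_w
    (fun t _ => neg_nonpos.2 (mul_nonneg (hq0 t) (hG0 _)))

theorem hasDerivWithinAt_x_sub (h : IsShot p q G α x w) (hp : Continuous p) {s t τ c : ℝ}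
    (hs : 0 ≤ s) (ht : t ≤ 1) (hτ : τ ∈ Icc s t) :
    HasDerivWithinAt (fun τ => x τ - c * ∫ σ in (0:ℝ)..τ, p σ) (p τ * w τ - c * p τ)
      (Icc s t) τ :=
  ((h.hasDeriv_x τ ⟨hs.trans hτ.1, hτ.2.trans ht⟩).mono (Icc_subset_Icc hs ht)).sub
    ((hp.integral_hasStrictDerivAt 0 τ).hasDerivAt.hasDerivWithinAt.const_mul c)

/-- Concavity of `x` as a function of `∫ p`, upper bound. -/
theorem x_sub_le (h : IsShot p q G α x w) (hp : Continuous p) (hp0 : ∀ t, 0 < p t)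
    (hq0 : ∀ t, 0 ≤ q t) (hG0 : ∀ u, 0 ≤ G u) {s t : ℝ} (hs : 0 ≤ s) (hst : s ≤ t)
    (ht : t ≤ 1) :
    x t - x s ≤ w s * ((∫ τ in (0:ℝ)..t, p τ) - ∫ τ in (0:ℝ)..s, p τ) := by
  have := antitoneOn_Icc_of_hasDerivWithinAt_nonpos
    (fun τ hτ => h.hasDerivWithinAt_x_sub hp (c := w s) hs ht hτ) (fun τ hτ => by
      have := h.w_antitoneOn hq0 hG0 ⟨hs, hst.trans ht⟩ ⟨hs.trans hτ.1, hτ.2.trans ht⟩ hτ.1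
      nlinarith [hp0 τ]) (left_mem_Icc.2 hst) (right_mem_Icc.2 hst) hst
  simp only at this
  linarith

/-- Concavity of `x` as a function of `∫ p`, lower bound. -/
theorem le_x_sub (h : IsShot p q G α x w) (hp : Continuous p) (hp0 : ∀ t, 0 < p t)
    (hq0 : ∀ t, 0 ≤ q t) (hG0 : ∀ u, 0 ≤ G u) {s t : ℝ} (hs : 0 ≤ s) (hst : s ≤ t)
    (ht : t ≤ 1) :
    w t * ((∫ τ in (0:ℝ)..t, p τ) - ∫ τ in (0:ℝ)..s, p τ) ≤ x t - x s := by
  have := monotoneOn_Icc_of_hasDerivWithinAt_nonneg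
    (fun τ hτ => h.hasDerivWithinAt_x_sub hp (c := w t) hs ht hτ) (fun τ hτ => by
      have := h.w_antitoneOn hq0 hG0 ⟨hs.trans hτ.1, hτ.2.trans ht⟩ ⟨hs.trans hst, ht⟩ hτ.2
      nlinarith [hp0 τ]) (left_mem_Icc.2 hst) (right_mem_Icc.2 hst) hst
  simp only at this
  linarith

theorem hasDerivWithinAt_w_add (h : IsShot p q G α x w) (hq : Continuous q) {s t τ c : ℝ}
    (hs : 0 ≤ s) (ht : t ≤ 1) (hτ : τ ∈ Icc s t) :
    HasDerivWithinAt (fun τ => w τ + c * ∫ σ in (0:ℝ)..τ, q σ) (-(q τ * G (x τ)) + c * q τ)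
      (Icc s t) τ :=
  ((h.hasDeriv_w τ ⟨hs.trans hτ.1, hτ.2.trans ht⟩).mono (Icc_subset_Icc hs ht)).add
    ((hq.integral_hasStrictDerivAt 0 τ).hasDerivAt.hasDerivWithinAt.const_mul c)

theorem w_sub_le (h : IsShot p q G α x w) (hq : Continuous q) (hq0 : ∀ t, 0 ≤ q t)
    {s t c : ℝ} (hs : 0 ≤ s) (hst : s ≤ t) (ht : t ≤ 1) (hc : ∀ τ ∈ Icc s t, G (x τ) ≤ c) :
    w s - w t ≤ c * ∫ τ in s..t, q τ := by
  have := monotoneOn_Icc_of_hasDerivWithinAt_nonneg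
    (fun τ hτ => h.hasDerivWithinAt_w_add hq (c := c) hs ht hτ) (fun τ hτ => by
      nlinarith [hq0 τ, hc τ hτ]) (left_mem_Icc.2 hst) (right_mem_Icc.2 hst) hst
  simp only at this
  rw [← integral_zero_sub_integral_zero hq]
  linarith

theorem le_w_sub (h : IsShot p q G α x w) (hq : Continuous q) (hq0 : ∀ t, 0 ≤ q t)
    {s t c : ℝ} (hs : 0 ≤ s) (hst : s ≤ t) (ht : t ≤ 1) (hc : ∀ τ ∈ Icc s t, c ≤ G (x τ)) :
    c * (∫ τ in s..t, q τ) ≤ w s - w t := by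
  have := antitoneOn_Icc_of_hasDerivWithinAt_nonpos
    (fun τ hτ => h.hasDerivWithinAt_w_add hq (c := c) hs ht hτ) (fun τ hτ => by
      nlinarith [hq0 τ, hc τ hτ]) (left_mem_Icc.2 hst) (right_mem_Icc.2 hst) hst
  simp only at this
  rw [← integral_zero_sub_integral_zero hq]
  linarith

theorem x_le (h : IsShot p q G α x w) (hp : Continuous p) (hp0 : ∀ t, 0 < p t)
    (hq0 : ∀ t, 0 ≤ q t) (hG0 : ∀ u, 0 ≤ G u) (hα : 0 ≤ α) {t : ℝ} (ht : t ∈ Icc (0:ℝ) 1) :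
    x t ≤ α * ∫ τ in (0:ℝ)..1, p τ := by
  have h1 := h.x_sub_le hp hp0 hq0 hG0 le_rfl ht.1 ht.2
  have h2 := (strictMono_integral_zero hp hp0).monotone ht.2
  simp only [h.x_zero, h.w_zero, intervalIntegral.integral_same, sub_zero] at h1 h2
  exact h1.trans (mul_le_mul_of_nonneg_left h2 hα)

theorem concave (h : IsShot p q G α x w) (hp : Continuous p) (hp0 : ∀ t, 0 < p t)
    (hq0 : ∀ t, 0 ≤ q t) (hG0 : ∀ u, 0 ≤ G u) {s t u : ℝ} (hs : 0 ≤ s) (hst : s ≤ t)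
    (htu : t ≤ u) (hu : u ≤ 1) :
    x s * ((∫ τ in (0:ℝ)..u, p τ) - ∫ τ in (0:ℝ)..t, p τ) +
      x u * ((∫ τ in (0:ℝ)..t, p τ) - ∫ τ in (0:ℝ)..s, p τ) ≤
      x t * ((∫ τ in (0:ℝ)..u, p τ) - ∫ τ in (0:ℝ)..s, p τ) := by
  have hA := (strictMono_integral_zero hp hp0).monotone
  have h1 := mul_le_mul_of_nonneg_right (h.x_sub_le hp hp0 hq0 hG0 (hs.trans hst) htu hu)
    (sub_nonneg.2 (hA hst))
  have h2 := mul_le_mul_of_nonneg_right (h.le_x_sub hp hp0 hq0 hG0 hs hst (htu.trans hu))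
    (sub_nonneg.2 (hA htu))
  simp only at h1 h2
  linarith

theorem pos_of_w_one_pos (h : IsShot p q G α x w) (hp : Continuous p) (hp0 : ∀ t, 0 < p t)
    (hq : Continuous q) (hq0 : ∀ t, 0 ≤ q t) (hG : Monotone G) (hG0 : ∀ u, 0 ≤ G u)
    (hα : 0 ≤ α) (hsmall : G (α * ∫ τ in (0:ℝ)..1, p τ) * (∫ τ in (0:ℝ)..1, q τ) < α) :
    0 < w 1 ∧ 0 < x 1 := by
  have h1 := h.w_sub_le hq hq0 le_rfl zero_le_one le_rfl
    (fun τ hτ => hG (h.x_le hp hp0 hq0 hG0 hα hτ))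
  rw [h.w_zero] at h1
  have hw : 0 < w 1 := by linarith
  have h2 := h.le_x_sub hp hp0 hq0 hG0 le_rfl zero_le_one le_rfl
  simp only [h.x_zero, intervalIntegral.integral_same, sub_zero] at h2
  exact ⟨hw, (mul_pos hw (integral_zero_pos hp hp0 one_pos)).trans_le h2⟩

/-- If `x 1 ≥ 0`, then `x` is bounded below at interior points proportionally to the slope `α`. -/
theorem exists_mul_le_x (hp : Continuous p) (hp0 : ∀ t, 0 < p t)
    (hq : Continuous q) (hq0 : ∀ t, 0 ≤ q t) (hG : Monotone G) (hG0 : ∀ u, 0 ≤ G u)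
    (hGid : ∀ u, 0 ≤ u → G u ≤ u) {t : ℝ} (ht : t ∈ Ioo (0:ℝ) 1) :
    ∃ c > 0, ∀ α x w, IsShot p q G α x w → 0 < α → 0 ≤ x 1 → c * α ≤ x t := by
  set A : ℝ → ℝ := fun t => ∫ τ in (0:ℝ)..t, p τ with hA
  have hA1 : 0 < A 1 := integral_zero_pos hp hp0 one_pos
  have hmono : StrictMono A := strictMono_integral_zero hp hp0
  have hcont : Continuous fun δ => A 1 * ∫ τ in (0:ℝ)..δ, q τ :=
    (intervalIntegral.continuous_primitive (fun _ _ => hq.intervalIntegrable _ _) 0).const_mul _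
  have hev : ∀ᶠ δ in 𝓝[>] (0:ℝ), A 1 * (∫ τ in (0:ℝ)..δ, q τ) < 1 / 2 :=
    (hcont.tendsto 0).mono_left nhdsWithin_le_nhds |>.eventually_lt_const (by simp)
  obtain ⟨δ, hδq, hδ0, hδt⟩ := (hev.and (Ioo_mem_nhdsGT ht.1)).exists
  have hAδ : 0 < A δ := integral_zero_pos hp hp0 hδ0
  have hAt : 0 < A 1 - A t := sub_pos.2 (hmono ht.2)
  refine ⟨A δ / 2 * (A 1 - A t) / A 1, by positivity, fun α x w h hα hx1 => ?_⟩
  have hδ1 : δ ≤ 1 := hδt.le.trans ht.2.le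
  have h1 := h.w_sub_le hq hq0 (c := α * A 1) le_rfl hδ0.le hδ1 (fun τ hτ =>
    (hG (h.x_le hp hp0 hq0 hG0 hα.le ⟨hτ.1, hτ.2.trans hδ1⟩)).trans
      (hGid _ (mul_nonneg hα.le hA1.le)))
  have h2 := h.le_x_sub hp hp0 hq0 hG0 le_rfl hδ0.le hδ1
  simp only [h.x_zero, intervalIntegral.integral_same, sub_zero] at h2
  rw [h.w_zero] at h1
  have hwδ : α / 2 ≤ w δ := by nlinarith
  have hxδ : α / 2 * A δ ≤ x δ := (mul_le_mul_of_nonneg_right hwδ hAδ.le).trans h2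
  have h3 := h.concave hp hp0 hq0 hG0 hδ0.le hδt.le ht.2.le le_rfl
  change x δ * (A 1 - A t) + x 1 * (A t - A δ) ≤ x t * (A 1 - A δ) at h3
  have h4 : 0 ≤ x 1 * (A t - A δ) := mul_nonneg hx1 (sub_nonneg.2 (hmono hδt).le)
  have h5 := mul_le_mul_of_nonneg_right hxδ hAt.le
  have h6 : 0 < A 1 - A δ := sub_pos.2 (hmono (hδt.trans ht.2))
  have h7 : 0 < α / 2 * A δ * (A 1 - A t) := by positivity
  have hxt : 0 < x t := by
    by_contra! hneg
    nlinarith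
  rw [div_mul_eq_mul_div, div_le_iff₀ hA1]
  nlinarith

/-- If `x 1 ≥ 0`, then the mass of `q` on `[t₁, t₂]` is controlled. -/
theorem G_mul_integral_le (h : IsShot p q G α x w) (hp : Continuous p) (hp0 : ∀ t, 0 < p t)
    (hq : Continuous q) (hq0 : ∀ t, 0 ≤ q t) (hG : Monotone G) (hG0 : ∀ u, 0 ≤ G u)
    {t₁ t₂ : ℝ} (ht₁ : t₁ ∈ Ioo (0:ℝ) 1) (ht₂ : t₂ ∈ Ioo (0:ℝ) 1) (ht₁₂ : t₁ < t₂)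
    (hx1 : 0 ≤ x 1) :
    G (min (x t₁) (x t₂)) * (∫ τ in t₁..t₂, q τ) ≤
      (∫ τ in (0:ℝ)..1, p τ) / ((∫ τ in (0:ℝ)..t₁, p τ) *
        ((∫ τ in (0:ℝ)..1, p τ) - ∫ τ in (0:ℝ)..t₂, p τ)) * min (x t₁) (x t₂) := by
  have hmono := strictMono_integral_zero hp hp0
  have hc1 := h.concave hp hp0 hq0 hG0 le_rfl ht₁.1.le ht₁₂.le ht₂.2.le
  have hc2 := h.concave hp hp0 hq0 hG0 ht₁.1.le ht₁₂.le ht₂.2.le le_rfl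
  have hw1 := h.le_x_sub hp hp0 hq0 hG0 le_rfl ht₁.1.le ht₁.2.le
  have hw2 := h.x_sub_le hp hp0 hq0 hG0 ht₂.1.le ht₂.2.le le_rfl
  have hw := h.le_w_sub hq hq0 (c := G (min (x t₁) (x t₂))) ht₁.1.le ht₁₂.le ht₂.2.le
    (fun τ hτ => hG (by
      have hc := h.concave hp hp0 hq0 hG0 ht₁.1.le hτ.1 hτ.2 ht₂.2.le
      have h12 := sub_pos.2 (hmono ht₁₂)
      have h1 := mul_le_mul_of_nonneg_right (min_le_left (x t₁) (x t₂))
        (sub_nonneg.2 (hmono.monotone hτ.2))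
      have h2 := mul_le_mul_of_nonneg_right (min_le_right (x t₁) (x t₂))
        (sub_nonneg.2 (hmono.monotone hτ.1))
      simp only at h1 h2 h12
      refine le_of_mul_le_mul_right ?_ h12
      linarith))
  have hP := integral_zero_pos hp hp0 ht₁.1
  have hD := sub_pos.2 (hmono ht₁₂)
  have hR := sub_pos.2 (hmono ht₂.2)
  simp only [h.x_zero, intervalIntegral.integral_same, sub_zero, zero_mul, zero_add] at *
  set A₁ := ∫ τ in (0:ℝ)..t₁, p τ
  set A₂ := ∫ τ in (0:ℝ)..t₂, p τ
  set A := ∫ τ in (0:ℝ)..1, p τ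
  refine hw.trans ?_
  rw [div_mul_eq_mul_div, le_div_iff₀ (mul_pos hP hR)]
  have e1 := mul_le_mul_of_nonneg_right hw1 hR.le
  have e2 := mul_le_mul_of_nonneg_right hw2 hP.le
  have e3 := mul_nonneg hx1 hD.le
  have e4 := mul_nonneg hx1 hP.le
  rcases min_cases (x t₁) (x t₂) with ⟨hm, -⟩ | ⟨hm, -⟩ <;> rw [hm] <;> linarith

end IsShot

theorem exists_shots {p q G : ℝ → ℝ} (hp : Continuous p) (hp0 : ∀ t, 0 < p t)
    (hq : Continuous q) (hq0 : ∀ t, 0 ≤ q t) (hGL : LipschitzWith 1 G) (hG : Monotone G)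
    (hG0 : ∀ u, 0 ≤ G u) {r : ℝ} (hr : 0 ≤ r) :
    ∃ X W : ℝ → ℝ → ℝ, (∀ α ∈ Icc 0 r, IsShot p q G α (X α) (W α)) ∧
      ContinuousOn (fun α => X α 1) (Icc 0 r) ∧ ContinuousOn (fun α => W α 1) (Icc 0 r) := by
  set M := r * ∫ τ in (0:ℝ)..1, p τ
  obtain ⟨X, W, hXW, hX, hW⟩ := exists_shots_of_bounded (G := fun u => G (min u M)) hp hq hq0
    (by simpa [Function.comp_def] using hGL.comp (LipschitzWith.id.min_const M)) (fun _ => hG0 _)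
    (fun u => hG (min_le_right u M)) hr
  refine ⟨X, W, fun α hα => ?_, hX, hW⟩
  obtain ⟨h1, h2, h3, h4⟩ := hXW α hα
  refine ⟨h1, h2, h3, fun t ht => ?_⟩
  have hle : X α t ≤ M := ((hXW α hα).x_le hp hp0 hq0 (fun _ => hG0 _) hα.1 ht).trans
    (mul_le_mul_of_nonneg_right hα.2 (integral_zero_pos hp hp0 one_pos).le)
  simpa only [min_eq_left hle] using h4 t ht

/-- A slope from which the shot overshoots, given fast growth at `0⁺` or `∞`. -/
theorem exists_overshoot {p q G : ℝ → ℝ} (hp : Continuous p) (hp0 : ∀ t, 0 < p t)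
    (hq : Continuous q) (hq0 : ∀ t, 0 ≤ q t) (hG : Monotone G) (hG0 : ∀ u, 0 ≤ G u)
    (hGid : ∀ u, 0 ≤ u → G u ≤ u) {t₁ t₂ : ℝ} (ht₁ : t₁ ∈ Ioo (0:ℝ) 1)
    (ht₂ : t₂ ∈ Ioo (0:ℝ) 1) (ht₁₂ : t₁ < t₂) {l : Filter ℝ} (hl : l = 𝓝[>] 0 ∨ l = atTop)
    (hlarge : ∀ᶠ u in l, (∫ τ in (0:ℝ)..1, p τ) / ((∫ τ in (0:ℝ)..t₁, p τ) *
        ((∫ τ in (0:ℝ)..1, p τ) - ∫ τ in (0:ℝ)..t₂, p τ)) * u <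
      G u * ∫ τ in t₁..t₂, q τ) :
    ∃ α > 0, ∀ x w, IsShot p q G α x w → x 1 < 0 ∧ w 1 < 0 := by
  have hA1 := integral_zero_pos hp hp0 one_pos
  obtain ⟨c₁, hc₁, hx₁⟩ := IsShot.exists_mul_le_x hp hp0 hq hq0 hG hG0 hGid ht₁
  obtain ⟨c₂, hc₂, hx₂⟩ := IsShot.exists_mul_le_x hp hp0 hq hq0 hG hG0 hGid ht₂
  suffices H : ∃ α > 0, ∀ x w, IsShot p q G α x w → x 1 < 0 by
    obtain ⟨α, hα, H⟩ := H
    refine ⟨α, hα, fun x w h => ⟨H x w h, ?_⟩⟩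
    have h1 := h.le_x_sub hp hp0 hq0 hG0 le_rfl zero_le_one le_rfl
    simp only [h.x_zero, intervalIntegral.integral_same, sub_zero] at h1
    by_contra! hw
    exact absurd (H x w h) (not_lt.2 ((mul_nonneg hw hA1.le).trans h1))
  rcases hl with rfl | rfl
  · obtain ⟨ε, hε, hlarge⟩ := mem_nhdsGT_iff_exists_Ioo_subset.1 hlarge
    have hε0 : 0 < ε := hε
    refine ⟨ε / 2 / ∫ τ in (0:ℝ)..1, p τ, by positivity, fun x w h => ?_⟩
    by_contra! hx1
    have hα : 0 < ε / 2 / ∫ τ in (0:ℝ)..1, p τ := by positivity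
    have hm1 : 0 < min (x t₁) (x t₂) := lt_min
      ((mul_pos hc₁ hα).trans_le (hx₁ _ x w h hα hx1))
      ((mul_pos hc₂ hα).trans_le (hx₂ _ x w h hα hx1))
    have hm2 := (min_le_left (x t₁) (x t₂)).trans
      (h.x_le hp hp0 hq0 hG0 hα.le ⟨ht₁.1.le, ht₁.2.le⟩)
    rw [div_mul_cancel₀ _ hA1.ne'] at hm2
    exact absurd (h.G_mul_integral_le hp hp0 hq hq0 hG hG0 ht₁ ht₂ ht₁₂ hx1)
      (not_le.2 (hlarge ⟨hm1, by linarith⟩))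
  · obtain ⟨N, hN⟩ := eventually_atTop.1 hlarge
    have hc : 0 < min c₁ c₂ := lt_min hc₁ hc₂
    have hN1 : 0 < max N 1 := lt_max_of_lt_right one_pos
    have hα : 0 < max N 1 / min c₁ c₂ := div_pos hN1 hc
    refine ⟨max N 1 / min c₁ c₂, hα, fun x w h => ?_⟩
    by_contra! hx1
    have key : min c₁ c₂ * (max N 1 / min c₁ c₂) = max N 1 := mul_div_cancel₀ _ hc.ne'
    have hm : N ≤ min (x t₁) (x t₂) := (le_max_left N 1).trans (key.symm.le.trans (le_min
      ((mul_le_mul_of_nonneg_right (min_le_left _ _) hα.le).trans (hx₁ _ x w h hα hx1))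
      ((mul_le_mul_of_nonneg_right (min_le_right _ _) hα.le).trans (hx₂ _ x w h hα hx1))))
    exact absurd (h.G_mul_integral_le hp hp0 hq hq0 hG hG0 ht₁ ht₂ ht₁₂ hx1)
      (not_le.2 (hN _ hm))

theorem exists_shot_x_one_eq_zero_and_exists_shot_w_one_eq_zero {p q G : ℝ → ℝ}
    (hp : Continuous p) (hp0 : ∀ t, 0 < p t)
    (hq : Continuous q) (hq0 : ∀ t, 0 ≤ q t) (hGL : LipschitzWith 1 G) (hG : Monotone G)
    (hG0 : ∀ u, 0 ≤ G u) (hGid : ∀ u, 0 ≤ u → G u ≤ u) {t₁ t₂ : ℝ} (ht₁ : t₁ ∈ Ioo (0:ℝ) 1)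
    (ht₂ : t₂ ∈ Ioo (0:ℝ) 1) (ht₁₂ : t₁ < t₂)
    {l : Filter ℝ} (hl : l = 𝓝[>] 0 ∨ l = atTop)
    (hlarge : ∀ᶠ u in l, (∫ τ in (0:ℝ)..1, p τ) / ((∫ τ in (0:ℝ)..t₁, p τ) *
        ((∫ τ in (0:ℝ)..1, p τ) - ∫ τ in (0:ℝ)..t₂, p τ)) * u <
      G u * ∫ τ in t₁..t₂, q τ)
    (hsmall : ∃ u > 0, G u * (∫ τ in (0:ℝ)..1, p τ) * (∫ τ in (0:ℝ)..1, q τ) < u) :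
    (∃ α x w, IsShot p q G α x w ∧ x 1 = 0 ∧ ∀ t ∈ Ioo (0:ℝ) 1, 0 < x t) ∧
    (∃ α x w, IsShot p q G α x w ∧ w 1 = 0 ∧ ∀ t ∈ Ioc (0:ℝ) 1, 0 < x t) := by
  have hA1 := integral_zero_pos hp hp0 one_pos
  obtain ⟨β, hβ, hover⟩ := exists_overshoot hp hp0 hq hq0 hG hG0 hGid ht₁ ht₂ ht₁₂ hl hlarge
  obtain ⟨u, hu, hsmall⟩ := hsmall
  obtain ⟨γ, hγ, hγu⟩ : ∃ γ > 0, γ * (∫ τ in (0:ℝ)..1, p τ) = u :=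
    ⟨u / ∫ τ in (0:ℝ)..1, p τ, by positivity, div_mul_cancel₀ _ hA1.ne'⟩
  obtain ⟨X, W, hXW, hX, hW⟩ := exists_shots hp hp0 hq hq0 hGL hG hG0
    (r := max β γ) (hβ.le.trans (le_max_left _ _))
  have hβmem : β ∈ Icc 0 (max β γ) := ⟨hβ.le, le_max_left _ _⟩
  have hγmem : γ ∈ Icc 0 (max β γ) := ⟨hγ.le, le_max_right _ _⟩
  obtain ⟨hXβ, hWβ⟩ := hover _ _ (hXW β hβmem)
  obtain ⟨hWγ, hXγ⟩ := (hXW γ hγmem).pos_of_w_one_pos hp hp0 hq hq0 hG hG0 hγ.le (by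
    rw [hγu]
    refine lt_of_mul_lt_mul_right ?_ hA1.le
    rw [hγu]; linarith)
  have hsub : uIcc β γ ⊆ Icc 0 (max β γ) := Icc_subset_Icc (le_min hβ.le hγ.le) le_rfl
  have hpos : ∀ α ∈ uIcc β γ, 0 < α := fun α hα => (lt_min hβ hγ).trans_le hα.1
  have hint : ∀ α x w, 0 < α → IsShot p q G α x w → 0 ≤ x 1 → ∀ t ∈ Ioo (0:ℝ) 1, 0 < x t := by
    intro α x w hα h hx t ht
    obtain ⟨c, hc, H⟩ := IsShot.exists_mul_le_x hp hp0 hq hq0 hG hG0 hGid ht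
    exact (mul_pos hc hα).trans_le (H α x w h hα hx)
  constructor
  · obtain ⟨α, hα, h0⟩ := intermediate_value_uIcc (hX.mono hsub)
      (Icc_subset_uIcc ⟨hXβ.le, hXγ.le⟩)
    exact ⟨α, X α, W α, hXW α (hsub hα), h0,
      hint α _ _ (hpos α hα) (hXW α (hsub hα)) h0.ge⟩
  · obtain ⟨α, hα, h0⟩ := intermediate_value_uIcc (hW.mono hsub)
      (Icc_subset_uIcc ⟨hWβ.le, hWγ.le⟩)
    have h := hXW α (hsub hα)
    simp only at h0
    have hstep : ∀ s ∈ Icc (0:ℝ) 1, X α s ≤ X α 1 := fun s hs => by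
      have := h.le_x_sub hp hp0 hq0 hG0 hs.1 hs.2 le_rfl
      rw [h0, zero_mul] at this
      linarith
    have hx1 : 0 ≤ X α 1 := h.x_zero ▸ hstep 0 (by simp)
    have hI := hint α _ _ (hpos α hα) h hx1
    refine ⟨α, X α, W α, h, h0, fun t ht => ?_⟩
    rcases ht.2.lt_or_eq with h1 | rfl
    · exact hI t ⟨ht.1, h1⟩
    · exact (hI (1 / 2) (by norm_num)).trans_le (hstep _ (by norm_num))

/-- Proposition 1(i): under the standing assumptions and the integral conditions,
the equation `(a x')' + b F(x) = 0` has on `[0,1]` a solution in `Δ₁` and a solution in `Δ₂`. -/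
theorem exists_solutions_Delta1_Delta2_of_integral_conditions
    (a b F : ℝ → ℝ) (B k₀ kinf : ℝ)
    (ha_cont : ContinuousOn a (Ici 0)) (ha_pos : ∀ t ∈ Ici (0:ℝ), 0 < a t)
    (ha_int : IntegrableOn (fun t => 1 / a t) (Ici 0))
    (hb_cont : ContinuousOn b (Ici 0))
    (hb_nonneg : ∀ t ∈ Icc (0:ℝ) 1, 0 ≤ b t)
    (hb_ne : ∃ t ∈ Icc (0:ℝ) 1, b t ≠ 0)
    (hB : 0 < B) (hbB : ∀ t ∈ Ici (1:ℝ), b t ≤ B)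
    (hF_cont : Continuous F) (hF_sign : ∀ u : ℝ, u ≠ 0 → 0 < F u * u)
    (F' : ℝ → ℝ) (hF_deriv : ∀ u ∈ Ici (0:ℝ), HasDerivWithinAt F (F' u) (Ici 0) u)
    (hF'_bd : ∀ u ∈ Ici (0:ℝ), 0 ≤ F' u ∧ F' u ≤ 1)
    (hk₀ : Tendsto (fun u => F u / u) (𝓝[>] (0:ℝ)) (𝓝 k₀))
    (hkinf : Tendsto (fun u => F u / u) atTop (𝓝 kinf))
    (hk₀_nonneg : 0 ≤ k₀) (hk_ne : k₀ ≠ kinf)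
    (t₁ t₂ : ℝ) (ht₁ : t₁ ∈ Ioo (0:ℝ) 1) (ht₂ : t₂ ∈ Ioo (0:ℝ) 1) (ht₁₂ : t₁ < t₂)
    (hb_int_pos : 0 < ∫ t in t₁..t₂, b t)
    (hA1 : min k₀ kinf * (∫ s in (0:ℝ)..1, 1 / a s) * (∫ t in (0:ℝ)..1, |b t|) < 1)
    (hA2 : max k₀ kinf * (∫ t in t₁..t₂, b t) >
      (∫ s in (0:ℝ)..1, 1 / a s) /
        ((∫ s in (0:ℝ)..t₁, 1 / a s) *
          ((∫ s in (0:ℝ)..1, 1 / a s) - ∫ s in (0:ℝ)..t₂, 1 / a s))) :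
    (∃ x₁ x₁' : ℝ → ℝ, SolODE a b F (Icc 0 1) x₁ x₁' ∧
      x₁ 0 = 0 ∧ x₁ 1 = 0 ∧ ∀ t ∈ Ioo (0:ℝ) 1, 0 < x₁ t) ∧
    (∃ x₂ x₂' : ℝ → ℝ, SolODE a b F (Icc 0 1) x₂ x₂' ∧
      x₂ 0 = 0 ∧ x₂' 1 = 0 ∧ ∀ t ∈ Ioc (0:ℝ) 1, 0 < x₂ t) := by
  have hFmono : MonotoneOn F (Ici 0) :=
    monotoneOn_of_hasDerivWithinAt_nonneg (convex_Ici 0) hF_cont.continuousOn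
      (fun u hu => (hF_deriv u (interior_subset hu)).mono interior_subset)
      (fun u hu => (hF'_bd u (interior_subset hu)).1)
  have hFlip : LipschitzOnWith 1 F (Ici 0) :=
    (convex_Ici 0).lipschitzOnWith_of_nnnorm_hasDerivWithin_le hF_deriv (fun u hu => by
      rw [← NNReal.coe_le_coe, coe_nnnorm, Real.norm_eq_abs, abs_of_nonneg (hF'_bd u hu).1]
      exact (hF'_bd u hu).2)
  have hF0 : F 0 = 0 := by
    refine le_antisymm
      (le_of_tendsto ((hF_cont.tendsto 0).mono_left (nhdsWithin_le_nhds (s := Iio 0))) ?_)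
      (ge_of_tendsto ((hF_cont.tendsto 0).mono_left (nhdsWithin_le_nhds (s := Ioi 0))) ?_)
    · filter_upwards [self_mem_nhdsWithin] with u hu
      have hu' : u < 0 := hu
      exact (neg_of_mul_pos_left (hF_sign u hu'.ne) hu'.le).le
    · filter_upwards [self_mem_nhdsWithin] with u hu
      have hu' : 0 < u := hu
      exact (pos_of_mul_pos_left (hF_sign u hu'.ne') hu'.le).le
  set G : ℝ → ℝ := fun u => F (max u 0) with hGdef
  have hmax0 : ∀ u : ℝ, max u 0 ∈ Ici (0:ℝ) := fun u => le_max_right u 0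
  have hGF : ∀ u, 0 ≤ u → G u = F u := fun u hu => by simp only [hGdef, max_eq_left hu]
  have hG : Monotone G := fun u v huv =>
    hFmono (hmax0 u) (hmax0 v) (max_le_max_right 0 huv)
  have hG0 : ∀ u, 0 ≤ G u := fun u => by
    rw [← hF0]
    exact hFmono (mem_Ici.2 le_rfl) (hmax0 u) (hmax0 u)
  have hGL : LipschitzWith 1 G := LipschitzWith.of_dist_le_mul fun u v => by
    have h1 := hFlip.dist_le_mul _ (hmax0 u) _ (hmax0 v)
    have h2 := (LipschitzWith.id.max_const (0:ℝ)).dist_le_mul u v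
    simp only [NNReal.coe_one, one_mul, id] at h1 h2 ⊢
    exact h1.trans h2
  have hGid : ∀ u, 0 ≤ u → G u ≤ u := fun u hu => by
    have h1 := hFlip.dist_le_mul u hu 0 (mem_Ici.2 le_rfl)
    simp only [NNReal.coe_one, one_mul, Real.dist_eq, hF0, sub_zero, abs_of_nonneg hu] at h1
    rw [hGF u hu]
    exact (le_abs_self _).trans h1
  have ha_cont' : Continuous fun t : ℝ => a (max t 0) :=
    ha_cont.comp_continuous (by fun_prop) hmax0
  have hb_cont' : Continuous fun t : ℝ => b (max (min t 1) 0) :=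
    hb_cont.comp_continuous (by fun_prop) (fun t => hmax0 _)
  set p : ℝ → ℝ := fun t => 1 / a (max t 0) with hpdef
  set q : ℝ → ℝ := fun t => b (max (min t 1) 0) with hqdef
  have hp0 : ∀ t, 0 < p t := fun t => one_div_pos.2 (ha_pos _ (hmax0 t))
  have hp : Continuous p := continuous_const.div₀ ha_cont' fun t => (ha_pos _ (hmax0 t)).ne'
  have hq0 : ∀ t, 0 ≤ q t := fun t =>
    hb_nonneg _ ⟨hmax0 _, max_le (min_le_right _ _) zero_le_one⟩
  have hpa : ∀ t, 0 ≤ t → p t = 1 / a t := fun t ht => by simp only [hpdef, max_eq_left ht]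
  have hqb : ∀ t ∈ Icc (0:ℝ) 1, q t = b t := fun t ht => by
    simp only [hqdef, min_eq_left ht.2, max_eq_left ht.1]
  have hIp : ∀ t, 0 ≤ t → ∫ s in (0:ℝ)..t, 1 / a s = ∫ s in (0:ℝ)..t, p s := fun t ht =>
    intervalIntegral.integral_congr fun s hs => (hpa s (by
      rw [uIcc_of_le ht] at hs
      exact hs.1)).symm
  have hIq : ∫ t in t₁..t₂, b t = ∫ t in t₁..t₂, q t :=
    intervalIntegral.integral_congr fun s hs => (hqb s (by
      rw [uIcc_of_le ht₁₂.le] at hs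
      exact ⟨ht₁.1.le.trans hs.1, hs.2.trans ht₂.2.le⟩)).symm
  have hIq' : ∫ t in (0:ℝ)..1, |b t| = ∫ t in (0:ℝ)..1, q t :=
    intervalIntegral.integral_congr fun s hs => by
      rw [uIcc_of_le zero_le_one] at hs
      simp only [hqb s hs, abs_of_nonneg (hb_nonneg s hs)]
  rw [hIp 1 zero_le_one, hIq'] at hA1
  rw [hIp 1 zero_le_one, hIp t₁ ht₁.1.le, hIp t₂ ht₂.1.le, hIq] at hA2
  have hsmall_of : ∀ {l : Filter ℝ} [l.NeBot] {k : ℝ}, (∀ᶠ u in l, 0 < u) →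
      Tendsto (fun u => F u / u) l (𝓝 k) →
      k * (∫ s in (0:ℝ)..1, p s) * (∫ t in (0:ℝ)..1, q t) < 1 →
      ∃ u > 0, G u * (∫ s in (0:ℝ)..1, p s) * (∫ t in (0:ℝ)..1, q t) < u := by
    intro l _ k hl hk hlt
    obtain ⟨u, hu, hu0⟩ :=
      ((((hk.mul_const _).mul_const _).eventually_lt_const hlt).and hl).exists
    refine ⟨u, hu0, ?_⟩
    rw [hGF u hu0.le]
    have := mul_lt_mul_of_pos_right hu hu0
    rw [one_mul] at this
    refine lt_of_eq_of_lt ?_ this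
    field_simp
  have hlarge_of : ∀ {l : Filter ℝ} {k C J : ℝ}, (∀ᶠ u in l, 0 < u) →
      Tendsto (fun u => F u / u) l (𝓝 k) → C < k * J → ∀ᶠ u in l, C * u < G u * J := by
    intro l k C J hl hk hlt
    filter_upwards [hl, (hk.mul_const J).eventually_const_lt hlt] with u hu0 hu
    rw [hGF u hu0.le]
    refine (mul_lt_mul_of_pos_right hu hu0).trans_eq ?_
    field_simp
  have hpos_nhds : ∀ᶠ u in 𝓝[>] (0:ℝ), 0 < u := self_mem_nhdsWithin
  have hpos_top : ∀ᶠ u : ℝ in atTop, 0 < u := eventually_gt_atTop 0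
  have hshots : (∃ α x w, IsShot p q G α x w ∧ x 1 = 0 ∧ ∀ t ∈ Ioo (0:ℝ) 1, 0 < x t) ∧
      (∃ α x w, IsShot p q G α x w ∧ w 1 = 0 ∧ ∀ t ∈ Ioc (0:ℝ) 1, 0 < x t) := by
    rcases le_total k₀ kinf with hk | hk
    · rw [min_eq_left hk] at hA1
      rw [max_eq_right hk] at hA2
      exact exists_shot_x_one_eq_zero_and_exists_shot_w_one_eq_zero hp hp0 hb_cont' hq0 hGL hG
        hG0 hGid ht₁ ht₂ ht₁₂ (.inr rfl) (hlarge_of hpos_top hkinf hA2)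
        (hsmall_of hpos_nhds hk₀ hA1)
    · rw [min_eq_right hk] at hA1
      rw [max_eq_left hk] at hA2
      exact exists_shot_x_one_eq_zero_and_exists_shot_w_one_eq_zero hp hp0 hb_cont' hq0 hGL hG
        hG0 hGid ht₁ ht₂ ht₁₂ (.inl rfl) (hlarge_of hpos_nhds hk₀ hA2)
        (hsmall_of hpos_top hkinf hA1)
  have hsol : ∀ {α x w}, IsShot p q G α x w → (∀ t ∈ Icc (0:ℝ) 1, 0 ≤ x t) →
      SolODE a b F (Icc 0 1) x (fun t => p t * w t) := by
    intro α x w h hx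
    have hxc : ContinuousOn x (Icc 0 1) := fun t ht => (h.hasDeriv_x t ht).continuousWithinAt
    have hwc : ContinuousOn w (Icc 0 1) := fun t ht => (h.hasDeriv_w t ht).continuousWithinAt
    have haw : ∀ t ∈ Icc (0:ℝ) 1, a t * (p t * w t) = w t := fun t ht => by
      have := (ha_pos t ht.1).ne'
      rw [hpa t ht.1]
      field_simp
    refine ⟨h.hasDeriv_x, hp.continuousOn.mul hwc, fun t => -(q t * G (x t)), fun t ht => ?_,
      (hb_cont'.continuousOn.mul (hGL.continuous.comp_continuousOn hxc)).neg, fun t ht => ?_⟩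
    · exact (h.hasDeriv_w t ht).congr haw (haw t ht)
    · simp only [hqb t ht, hGF _ (hx t ht), neg_add_cancel]
  obtain ⟨⟨α₁, x₁, w₁, h₁, h₁1, h₁pos⟩, α₂, x₂, w₂, h₂, h₂1, h₂pos⟩ := hshots
  refine ⟨⟨x₁, _, hsol h₁ fun t ht => ?_, h₁.x_zero, h₁1, h₁pos⟩,
    x₂, _, hsol h₂ fun t ht => ?_, h₂.x_zero, by simp [h₂1], h₂pos⟩
  · rcases ht.1.eq_or_lt with rfl | h0
    · exact h₁.x_zero.ge
    rcases ht.2.eq_or_lt with rfl | h1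
    · exact h₁1.ge
    · exact (h₁pos t ⟨h0, h1⟩).le
  · rcases ht.1.eq_or_lt with rfl | h0
    · exact h₂.x_zero.ge
    · exact (h₂pos t ⟨h0, ht.2⟩).le
end

section
/- Let a : [T,∞) → ℝ be continuous and positive with ∫_T^∞ dt/a(t) < ∞, and let M > 0 be a constant. If the equation v'' + (M/a(t))·v = 0 is disconjugate on [T,∞), then the equation (a(t)y')' + M·y = 0 has a solution y₀ such that y₀(t) > 0 for all t ∈ [T,∞), y₀'(t) < 0 for all t ∈ (T,∞), and ∫_T^∞ dt/(a(t)·y₀(t)²) = ∞ (so y₀ is a principal solution of (a(t)y')' + M·y = 0). -/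
open Set Filter MeasureTheory Topology Real

/-- Global forward existence for a linear differential equation `x' = A(t) x` with continuous
coefficients, obtained from the contraction principle in an exponentially weighted norm. -/
theorem exists_forall_hasDerivAt_linear {E : Type*} [NormedAddCommGroup E] [NormedSpace ℝ E]
    [CompleteSpace E] (A : ℝ → E →L[ℝ] E) (hA : Continuous A) (T : ℝ) (x₀ : E) :
    ∃ x : ℝ → E, x T = x₀ ∧ ∀ t, T ≤ t → HasDerivAt x (A t (x t)) t := by
  have hk : Continuous fun t => 2 * ‖A t‖ := by fun_prop
  set g : ℝ → ℝ := fun t => Real.exp (∫ s in T..t, 2 * ‖A s‖) with hg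
  have hgd : ∀ t, HasDerivAt g (g t * (2 * ‖A t‖)) t := fun t =>
    (intervalIntegral.integral_hasDerivAt_right (hk.intervalIntegrable _ _)
      (hk.stronglyMeasurableAtFilter _ _) hk.continuousAt).exp
  have hgc : Continuous g := continuous_iff_continuousAt.2 fun t => (hgd t).continuousAt
  have hgpos : ∀ t, 0 < g t := fun t => Real.exp_pos _
  have hgT : g T = 1 := by simp [hg]
  have hg1 : ∀ t, T ≤ t → 1 ≤ g t := fun t ht =>
    Real.one_le_exp (intervalIntegral.integral_nonneg ht fun s _ => by positivity)
  have hgint : ∀ t, ∫ s in T..t, g s * ‖A s‖ = (g t - 1) / 2 := by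
    intro t
    have h := intervalIntegral.integral_eq_sub_of_hasDerivAt (a := T) (b := t)
      (fun s _ => hgd s) ((by fun_prop : Continuous fun t => g t * (2 * ‖A t‖)).intervalIntegrable
        _ _)
    have h2 : ∫ s in T..t, g s * (2 * ‖A s‖) = 2 * ∫ s in T..t, g s * ‖A s‖ := by
      rw [← intervalIntegral.integral_const_mul]
      congr 1
      ext s
      ring
    rw [h2, hgT] at h
    linarith
  have hIc : ∀ z : BoundedContinuousFunction ℝ E, Continuous fun s => g s • A s (z s) := fun z =>
    hgc.smul (hA.clm_apply z.continuous)
  have hIb : ∀ (z : BoundedContinuousFunction ℝ E) (t : ℝ), T ≤ t →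
      ‖∫ s in T..t, g s • A s (z s)‖ ≤ g t * (‖z‖ / 2) := by
    intro z t ht
    calc ‖∫ s in T..t, g s • A s (z s)‖
        ≤ ∫ s in T..t, (g s * ‖A s‖) * ‖z‖ := by
          refine intervalIntegral.norm_integral_le_of_norm_le ht
            (Eventually.of_forall fun s _ => ?_)
            ((by fun_prop : Continuous fun s => (g s * ‖A s‖) * ‖z‖).intervalIntegrable _ _)
          rw [norm_smul, Real.norm_of_nonneg (hgpos s).le, mul_assoc]
          exact mul_le_mul_of_nonneg_left ((A s).le_opNorm_of_le (z.norm_coe_le_norm s))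
            (hgpos s).le
      _ = (g t - 1) / 2 * ‖z‖ := by rw [intervalIntegral.integral_mul_const, hgint]
      _ ≤ g t * (‖z‖ / 2) := by nlinarith [norm_nonneg z]
  let S₀ : BoundedContinuousFunction ℝ E → ℝ → E := fun z t =>
    (g (max t T))⁻¹ • (x₀ + ∫ s in T..max t T, g s • A s (z s))
  have hS₀c : ∀ z, Continuous (S₀ z) := by
    intro z
    have h1 : Continuous fun t => ∫ s in T..t, g s • A s (z s) :=
      intervalIntegral.continuous_primitive (fun _ _ => (hIc z).intervalIntegrable _ _) T
    have hm : Continuous fun t : ℝ => max t T := by fun_prop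
    exact ((hgc.comp hm).inv₀ fun t => (hgpos _).ne').smul (continuous_const.add (h1.comp hm))
  have hinv : ∀ (e : E) (t C : ℝ), ‖e‖ ≤ g t * C → ‖(g t)⁻¹ • e‖ ≤ C := by
    intro e t C h
    rw [norm_smul, norm_inv, Real.norm_of_nonneg (hgpos t).le]
    exact (inv_mul_le_iff₀ (hgpos t)).2 h
  have hS₀b : ∀ z t, ‖S₀ z t‖ ≤ ‖x₀‖ + ‖z‖ / 2 := by
    intro z t
    refine hinv _ _ _ ((norm_add_le _ _).trans ?_)
    have := hIb z _ (le_max_right t T)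
    have := hg1 _ (le_max_right t T)
    nlinarith [norm_nonneg x₀]
  let S : BoundedContinuousFunction ℝ E → BoundedContinuousFunction ℝ E := fun z =>
    BoundedContinuousFunction.ofNormedAddCommGroup (S₀ z) (hS₀c z) _ (hS₀b z)
  have hS : ContractingWith (1 / 2) S := by
    refine ⟨by norm_num, LipschitzWith.of_dist_le_mul fun z w => ?_⟩
    rw [BoundedContinuousFunction.dist_le (by positivity)]
    intro t
    have hdiff : S z t - S w t =
        (g (max t T))⁻¹ • ∫ s in T..max t T, g s • A s ((z - w) s) := by
      change S₀ z t - S₀ w t = _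
      simp only [S₀]
      rw [← smul_sub, add_sub_add_left_eq_sub, ← intervalIntegral.integral_sub
        ((hIc z).intervalIntegrable _ _) ((hIc w).intervalIntegrable _ _)]
      simp [smul_sub]
    rw [dist_eq_norm, hdiff, dist_eq_norm]
    refine (hinv _ _ _ (hIb (z - w) _ (le_max_right t T))).trans (le_of_eq ?_)
    push_cast
    ring
  set z := hS.fixedPoint S with hz
  have hfix : S z = z := hS.fixedPoint_isFixedPt
  refine ⟨fun t => x₀ + ∫ s in T..t, g s • A s (z s), by simp, fun t ht => ?_⟩
  have hzt : g t • z t = x₀ + ∫ s in T..t, g s • A s (z s) := by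
    have h : z t = S₀ z t := by
      conv_lhs => rw [← hfix]
      rfl
    rw [h]
    simp only [S₀, max_eq_left ht]
    rw [smul_inv_smul₀ (hgpos t).ne']
  have hd := (intervalIntegral.integral_hasDerivAt_right ((hIc z).intervalIntegrable T t)
    ((hIc z).stronglyMeasurableAtFilter _ _) (hIc z).continuousAt).const_add x₀
  simp only [← hzt, map_smul]
  exact hd

/-- Initial value problems for `v'' + Q(t) v = 0` with continuous `Q` have global forward
solutions. -/
theorem exists_forall_hasDerivAt_second_order (Q : ℝ → ℝ) (hQ : Continuous Q) (T p q : ℝ) :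
    ∃ v v' : ℝ → ℝ, v T = p ∧ v' T = q ∧ (∀ t, T ≤ t → HasDerivAt v (v' t) t) ∧
      ∀ t, T ≤ t → HasDerivAt v' (-(Q t * v t)) t := by
  obtain ⟨x, hx0, hx⟩ := exists_forall_hasDerivAt_linear
    (fun t => (ContinuousLinearMap.snd ℝ ℝ ℝ).prod 0 +
      Q t • (0 : ℝ × ℝ →L[ℝ] ℝ).prod (-ContinuousLinearMap.fst ℝ ℝ ℝ))
    (by fun_prop) T (p, q)
  refine ⟨fun t => (x t).1, fun t => (x t).2, by simp [hx0], by simp [hx0],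
    fun t ht => ?_, fun t ht => ?_⟩
  · exact ((hasFDerivAt_fst (p := x t)).comp_hasDerivAt t (hx t ht)).congr_deriv (by simp)
  · exact ((hasFDerivAt_snd (p := x t)).comp_hasDerivAt t (hx t ht)).congr_deriv (by simp)

/-- A function which is positive on `(T,∞)` and whose derivative is strictly decreasing on
`[T,∞)` has positive derivative on `[T,∞)`. -/
theorem deriv_pos_of_pos_of_strictAntiOn {v v' : ℝ → ℝ} {T : ℝ}
    (hv : ∀ t, T ≤ t → HasDerivAt v (v' t) t) (hpos : ∀ t, T < t → 0 < v t)
    (hanti : StrictAntiOn v' (Ici T)) {t : ℝ} (ht : T ≤ t) : 0 < v' t := by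
  by_contra! hle
  have hneg : v' (t + 1) < 0 :=
    (hanti (mem_Ici.2 ht) (mem_Ici.2 (by linarith)) (by linarith)).trans_le hle
  set d := v' (t + 1) with hd
  have hvpos : 0 < v (t + 1) := hpos _ (by linarith)
  have hlen : 0 < v (t + 1) / -d := div_pos hvpos (by linarith)
  obtain ⟨c, hc, hcd⟩ := exists_hasDerivAt_eq_slope v v'
    (show t + 1 < t + 1 + v (t + 1) / -d by linarith)
    (fun s hs => (hv s (by linarith [hs.1])).continuousAt.continuousWithinAt)
    (fun s hs => hv s (by linarith [hs.1]))
  have hlt : v' c < d :=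
    hanti (mem_Ici.2 (by linarith)) (mem_Ici.2 (by linarith [hc.1])) hc.1
  have hend := hpos (t + 1 + v (t + 1) / -d) (by linarith)
  rw [hcd, add_sub_cancel_left, div_lt_iff₀ hlen] at hlt
  have : d * (v (t + 1) / -d) = -v (t + 1) := by
    rw [div_neg, mul_neg, mul_div_cancel₀ _ hneg.ne]
  linarith

/-- If the solution of `v'' + Q(t) v = 0` vanishing at `T` with unit slope has no further zero,
then there are solutions `v`, `w` with unit Wronskian, `v` positive on `(T,∞)` and `w / v`
tending to infinity; that is, `v` is principal. -/
theorem exists_principal_second_order {Q u u' v v' : ℝ → ℝ} {T : ℝ}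
    (hu : ∀ t, T ≤ t → HasDerivAt u (u' t) t)
    (hu' : ∀ t, T ≤ t → HasDerivAt u' (-(Q t * u t)) t)
    (hv : ∀ t, T ≤ t → HasDerivAt v (v' t) t)
    (hv' : ∀ t, T ≤ t → HasDerivAt v' (-(Q t * v t)) t)
    (hW : ∀ t, T ≤ t → u t * v' t - u' t * v t = 1) (hpos : ∀ t, T < t → 0 < v t) :
    ∃ z z' w w' : ℝ → ℝ, (∀ t, T ≤ t → HasDerivAt z (z' t) t) ∧
      (∀ t, T ≤ t → HasDerivAt z' (-(Q t * z t)) t) ∧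
      (∀ t, T ≤ t → HasDerivAt w' (-(Q t * w t)) t) ∧
      (∀ t, T ≤ t → w' t * z t - w t * z' t = 1) ∧ (∀ t, T < t → 0 < z t) ∧
      Tendsto (fun t => w t / z t) atTop atTop := by
  have hr : ∀ t, T < t → HasDerivAt (fun s => u s / v s) (-1 / v t ^ 2) t := by
    intro t ht
    refine ((hu t ht.le).div (hv t ht.le) (hpos t ht).ne').congr_deriv ?_
    congr 1
    linarith [hW t ht.le]
  have hanti : StrictAntiOn (fun s => u s / v s) (Ioi T) := by
    refine strictAntiOn_of_deriv_neg (convex_Ioi T)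
      (fun t ht => (hr t ht).continuousAt.continuousWithinAt) fun t ht => ?_
    rw [interior_Ioi] at ht
    rw [(hr t ht).deriv]
    exact div_neg_of_neg_of_pos (by norm_num) (pow_pos (hpos t ht) 2)
  have hmax : Antitone fun t => u (max t (T + 1)) / v (max t (T + 1)) := by
    intro s t hst
    exact hanti.antitoneOn (mem_Ioi.2 (by linarith [le_max_right s (T + 1)]))
      (mem_Ioi.2 (by linarith [le_max_right t (T + 1)])) (max_le_max_right _ hst)
  have heq : (fun t => u (max t (T + 1)) / v (max t (T + 1))) =ᶠ[atTop] fun t => u t / v t := by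
    filter_upwards [eventually_ge_atTop (T + 1)] with t ht
    rw [max_eq_left ht]
  rcases tendsto_atTop_of_antitone hmax with h | ⟨c, hc⟩
  · refine ⟨v, v', fun t => -u t, fun t => -u' t, hv, hv', fun t ht => ?_, fun t ht => ?_, hpos,
      ?_⟩
    · exact (hu' t ht).neg.congr_deriv (by ring)
    · linarith [hW t ht]
    · refine (tendsto_neg_atBot_atTop.comp (h.congr' heq)).congr fun t => ?_
      simp [neg_div]
  · have hc' := hc.congr' heq
    have hlt : ∀ t, T < t → c < u t / v t := by
      intro t ht
      refine lt_of_le_of_lt (le_of_tendsto hc' ?_)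
        (hanti (mem_Ioi.2 ht) (mem_Ioi.2 (by linarith)) (lt_add_one t))
      filter_upwards [eventually_ge_atTop (t + 1)] with s hs
      exact hanti.antitoneOn (mem_Ioi.2 (by linarith)) (mem_Ioi.2 (by linarith)) hs
    refine ⟨fun t => u t - c * v t, fun t => u' t - c * v' t, v, v', fun t ht => ?_,
      fun t ht => ?_, hv', fun t ht => ?_, fun t ht => ?_, ?_⟩
    · exact (hu t ht).sub ((hv t ht).const_mul c)
    · exact ((hu' t ht).sub ((hv' t ht).const_mul c)).congr_deriv (by ring)
    · linear_combination hW t ht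
    · have := hlt t ht
      rw [lt_div_iff₀ (hpos t ht)] at this
      linarith
    · have h0 : Tendsto (fun t => u t / v t - c) atTop (𝓝[>] 0) := by
        refine tendsto_nhdsWithin_iff.2 ⟨by simpa using hc'.sub_const c, ?_⟩
        filter_upwards [eventually_gt_atTop T] with t ht
        exact sub_pos.2 (hlt t ht)
      refine (tendsto_inv_nhdsGT_zero.comp h0).congr' ?_
      filter_upwards [eventually_gt_atTop T] with t ht
      have := (hpos t ht).ne'
      simp only [Function.comp_apply]
      rw [← inv_div (u t - c * v t), sub_div, mul_div_cancel_right₀ _ this]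

/-- Disconjugacy of `v'' + β(t) v = 0` makes the solution vanishing at `T` with unit slope
positive on `(T,∞)`. -/
theorem Disconjugate2.pos_of_initial {β v v' v'' : ℝ → ℝ} {T : ℝ}
    (h : Disconjugate2 β (Ici T)) (hsol : SolODE2 β id (Ici T) v v' v'') (h0 : v T = 0)
    (h1 : v' T = 1) {t : ℝ} (ht : T < t) : 0 < v t := by
  have hslope : ∀ᶠ s in 𝓝[>] T, 0 < slope v T s := by
    have := hasDerivWithinAt_iff_tendsto_slope.1 (hsol.1 T self_mem_Ici)
    rw [Ici_sdiff_left, h1] at this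
    exact this.eventually_const_lt one_pos
  obtain ⟨s, hs, hsT, hst⟩ := (hslope.and (Ioo_mem_nhdsGT ht)).exists
  have hvs : 0 < v s := by
    rw [slope_def_field, h0, sub_zero] at hs
    exact (div_pos_iff_of_pos_right (sub_pos.2 hsT)).1 hs
  by_contra! hle
  have hcont : ContinuousOn v (Icc s t) := fun r hr =>
    (hsol.1 r (mem_Ici.2 (hsT.le.trans hr.1))).continuousWithinAt.mono
      fun x hx => mem_Ici.2 (hsT.le.trans hx.1)
  obtain ⟨r, hr, hvr⟩ := intermediate_value_Icc' hst.le hcont ⟨hle, hvs.le⟩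
  have := h v v' v'' hsol ⟨s, hsT.le, hvs.ne'⟩ T self_mem_Ici r
    (mem_Ici.2 (hsT.le.trans hr.1)) h0 hvr
  linarith [hr.1]

/-- A function tending to infinity does not have an integrable nonnegative derivative. -/
theorem not_integrableOn_Ici_of_hasDerivAt_of_tendsto_atTop {F G : ℝ → ℝ} {T : ℝ}
    (hF : ∀ t, T ≤ t → HasDerivAt F (G t) t) (hG : ∀ t, T ≤ t → 0 ≤ G t)
    (hlim : Tendsto F atTop atTop) : ¬ IntegrableOn G (Ici T) := by
  intro hint
  obtain ⟨t, hlt, ht⟩ := ((hlim.eventually_gt_atTop (F T + ∫ s in Ici T, G s)).and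
    (eventually_ge_atTop T)).exists
  have hsub : Ioc T t ⊆ Ici T := fun s hs => hs.1.le
  have hFTC : ∫ s in T..t, G s = F t - F T :=
    intervalIntegral.integral_eq_sub_of_hasDerivAt
      (fun s hs => hF s (by rw [uIcc_of_le ht] at hs; exact hs.1))
      ((intervalIntegrable_iff_integrableOn_Ioc_of_le ht).2 (hint.mono_set hsub))
  rw [intervalIntegral.integral_of_le ht] at hFTC
  have := setIntegral_mono_set hint
    ((ae_restrict_iff' measurableSet_Ici).2 (Eventually.of_forall hG)) hsub.eventuallyLE
  linarith

/-- Lemma 5: if the dual equation `v'' + (M/a(t))v = 0` is disconjugate on `[T,∞)`,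
then `(a y')' + M y = 0` has a (principal) solution `y₀` with `y₀ > 0` on `[T,∞)`,
`y₀' < 0` on `(T,∞)` and `∫_T^∞ dt/(a y₀²) = ∞`. -/
theorem principal_solution_of_dual_disconjugate
    (T M : ℝ) (hM : 0 < M) (a : ℝ → ℝ)
    (ha_cont : ContinuousOn a (Ici T)) (ha_pos : ∀ t ∈ Ici T, 0 < a t)
    (ha_int : IntegrableOn (fun t => 1 / a t) (Ici T))
    (hdisc : Disconjugate2 (fun t => M / a t) (Ici T)) :
    ∃ y₀ y₀' : ℝ → ℝ, SolODE a (fun _ => M) id (Ici T) y₀ y₀' ∧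
      (∀ t ∈ Ici T, 0 < y₀ t) ∧ (∀ t ∈ Ioi T, y₀' t < 0) ∧
      ¬ IntegrableOn (fun t => 1 / (a t * y₀ t ^ 2)) (Ici T) := by
  have hmaxT : ∀ t : ℝ, T ≤ max t T := fun t => le_max_right t T
  set Q : ℝ → ℝ := fun t => M / a (max t T) with hQdef
  have hQ : Continuous Q := by
    refine continuous_const.div ?_ fun t => (ha_pos _ (hmaxT t)).ne'
    exact ha_cont.comp_continuous (by fun_prop) hmaxT
  have hQa : ∀ t, T ≤ t → Q t = M / a t := fun t ht => by simp [hQdef, max_eq_left ht]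
  have hQpos : ∀ t, 0 < Q t := fun t => div_pos hM (ha_pos _ (hmaxT t))
  obtain ⟨u, u', huT, huT', hu, hu'⟩ := exists_forall_hasDerivAt_second_order Q hQ T 1 0
  obtain ⟨v, v', hvT, hvT', hv, hv'⟩ := exists_forall_hasDerivAt_second_order Q hQ T 0 1
  have hvc : ContinuousOn v (Ici T) := fun t ht => (hv t ht).continuousAt.continuousWithinAt
  have hsol : SolODE2 (fun t => M / a t) id (Ici T) v v' (fun t => -(Q t * v t)) := by
    refine ⟨fun t ht => (hv t ht).hasDerivWithinAt, fun t ht => (hv' t ht).hasDerivWithinAt,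
      (hQ.continuousOn.mul hvc).neg, fun t ht => ?_⟩
    simp [hQa t ht]
  have hW : ∀ t, T ≤ t → u t * v' t - u' t * v t = 1 := by
    have hd : ∀ t, T ≤ t → HasDerivAt (fun s => u s * v' s - u' s * v s) 0 t := by
      intro t ht
      exact (((hu t ht).mul (hv' t ht)).sub ((hu' t ht).mul (hv t ht))).congr_deriv (by ring)
    intro t ht
    have := constant_of_has_deriv_right_zero (a := T) (b := t)
      (fun s hs => (hd s hs.1).continuousAt.continuousWithinAt)
      (fun s hs => (hd s hs.1).hasDerivWithinAt) t (right_mem_Icc.2 ht)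
    rw [this, huT, hvT', hvT]
    ring
  obtain ⟨z, z', w, w', hz, hz', hw', hzw, hzpos, hlim⟩ := exists_principal_second_order hu hu' hv
    hv' hW fun t ht => hdisc.pos_of_initial hsol hvT hvT' ht
  have hz'c : ContinuousOn z' (Ici T) := fun t ht => (hz' t ht).continuousAt.continuousWithinAt
  have hzc : ContinuousOn z (Ici T) := fun t ht => (hz t ht).continuousAt.continuousWithinAt
  have hz'' : ∀ t, T < t → -(Q t * z t) < 0 := fun t ht =>
    neg_neg_of_pos (mul_pos (hQpos t) (hzpos t ht))
  have hanti : StrictAntiOn z' (Ici T) := by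
    refine strictAntiOn_of_deriv_neg (convex_Ici T) hz'c fun t ht => ?_
    rw [interior_Ici] at ht
    rw [(hz' t (mem_Ioi.1 ht).le).deriv]
    exact hz'' t ht
  have hz'pos : ∀ t, T ≤ t → 0 < z' t := fun t ht =>
    deriv_pos_of_pos_of_strictAntiOn hz hzpos hanti ht
  refine ⟨z', fun t => -(Q t * z t), ⟨fun t ht => (hz' t ht).hasDerivWithinAt,
    (hQ.continuousOn.mul hzc).neg, fun t => -M * z' t, fun t ht => ?_,
    continuousOn_const.mul hz'c, fun t _ => by simp⟩, hz'pos, hz'', fun hint => ?_⟩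
  · have heq : ∀ s ∈ Ici T, a s * -(Q s * z s) = -M * z s := by
      intro s hs
      have := (ha_pos s hs).ne'
      rw [hQa s hs]
      field_simp
    exact ((hz t ht).hasDerivWithinAt.const_mul (-M)).congr heq (heq t ht)
  · refine not_integrableOn_Ici_of_hasDerivAt_of_tendsto_atTop (T := T)
      (F := fun t => w' t / z' t) (G := fun t => M * (1 / (a t * z' t ^ 2))) (fun t ht => ?_)
      (fun t ht => ?_) ?_ (hint.const_mul M)
    · have h1 := (hz'pos t ht).ne'
      have h2 := (ha_pos t ht).ne'
      refine ((hw' t ht).div (hz' t ht) h1).congr_deriv ?_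
      rw [hQa t ht]
      field_simp
      linear_combination hzw t ht
    · have := ha_pos t ht
      have := hz'pos t ht
      positivity
    · refine tendsto_atTop_mono' atTop ?_ hlim
      filter_upwards [eventually_gt_atTop T] with t ht
      rw [div_le_div_iff₀ (hzpos t ht) (hz'pos t ht.le)]
      linarith [hzw t ht.le]
end

section
/- Under the standing assumptions on a, b, F, suppose that the linear equation v'' + (B/a(t))·v = 0 is disconjugate on [1,∞). Let {cₙ} be a sequence of positive numbers converging to zero, and for each n let xₙ be the unique solution of (a(t)x')' + b(t)F(x) = 0 on [1,∞) satisfying xₙ(1) = cₙ, xₙ'(1) ≤ 0, xₙ(t) > 0 on [1,∞), and lim_{t→∞} xₙ(t) = 0. Then the sequence {xₙ'(1)} converges to zero. -/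
open Set Filter MeasureTheory Topology Real

/-- A one-sided mean value inequality: an upper bound on the derivative bounds the growth. -/
lemma le_add_mul_of_hasDerivWithinAt_le {f f' : ℝ → ℝ} {p q C : ℝ}
    (hf : ∀ t ∈ Ici p, HasDerivWithinAt f (f' t) (Ici p) t)
    (hC : ∀ t ∈ Ico p q, f' t ≤ C) {t : ℝ} (ht : t ∈ Icc p q) :
    f t ≤ f p + C * (t - p) := by
  refine image_le_of_deriv_right_le_deriv_boundary (f' := f')
    (B := fun s => f p + C * (s - p)) (B' := fun _ => C)
    (fun s hs => ((hf s hs.1).continuousWithinAt).mono Icc_subset_Ici_self)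
    (fun s hs => (hf s hs.1).mono (Ici_subset_Ici.2 hs.1)) (by simp) (by fun_prop)
    (fun s _ => ?_) hC ht
  simpa using ((((hasDerivAt_id s).sub_const p).const_mul C).const_add (f p)).hasDerivWithinAt

/-- A positive solution starting at height `x 1` cannot start with a slope much steeper
than `-x 1`. -/
lemma neg_mul_deriv_le_of_pos {a b F x x' : ℝ → ℝ} {M A : ℝ}
    (ha_pos : ∀ t ∈ Ici (0 : ℝ), 0 < a t)
    (hA : ∀ t ∈ Icc (1 : ℝ) 2, a t ≤ A) (hM : ∀ t ∈ Icc (1 : ℝ) 2, |b t| ≤ M)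
    (hF_nonneg : ∀ u, 0 < u → 0 ≤ F u) (hF_le : ∀ u, 0 < u → F u ≤ u)
    (hsol : SolODE a b F (Ici 1) x x') (hpos : ∀ t ∈ Ici (1 : ℝ), 0 < x t) :
    -(a 1 * x' 1) ≤ (M + A) * x 1 := by
  obtain ⟨hx, -, w, hy, -, hw⟩ := hsol
  by_contra! hs
  have hx1 := hpos 1 self_mem_Ici
  have hM0 : 0 ≤ M := (abs_nonneg _).trans (hM 1 (by norm_num))
  have hA0 : 0 < A := (ha_pos 1 (by simp)).trans_le (hA 1 (by norm_num))
  have ha1 : ∀ t ∈ Ici (1 : ℝ), 0 < a t := fun t ht => ha_pos t (zero_le_one.trans (mem_Ici.1 ht))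
  have key : ∀ τ ∈ Icc (1 : ℝ) 2, (∀ t ∈ Ico 1 τ, a t * x' t ≤ 0) →
      a τ * x' τ < -(A * x 1) := by
    intro τ hτ hneg
    have hxle : ∀ t ∈ Ico 1 τ, x t ≤ x 1 := fun t ht => by
      simpa using le_add_mul_of_hasDerivWithinAt_le (C := 0) hx
        (fun r hr => nonpos_of_mul_nonpos_right (hneg r hr) (ha1 r hr.1)) (Ico_subset_Icc_self ht)
    have hyle := le_add_mul_of_hasDerivWithinAt_le (C := M * x 1) hy (fun t ht => by
      have hxt := hpos t ht.1
      have hb := hM t ⟨ht.1, ht.2.le.trans hτ.2⟩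
      calc w t = -b t * F (x t) := by linarith [hw t ht.1]
        _ ≤ M * F (x t) := by
          gcongr
          · exact hF_nonneg _ hxt
          · exact (neg_le_abs _).trans hb
        _ ≤ M * x 1 := by
          gcongr
          exact (hF_le _ hxt).trans (hxle t ht)) (right_mem_Icc.2 hτ.1)
    have : M * x 1 * (τ - 1) ≤ M * x 1 * 1 := by
      gcongr
      linarith [hτ.2]
    linarith
  have hcont : ContinuousOn (fun t => a t * x' t) (Icc 1 2) := fun t ht =>
    ((hy t ht.1).continuousWithinAt).mono Icc_subset_Ici_self
  have hneg : ∀ t ∈ Icc (1 : ℝ) 2, a t * x' t < 0 := by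
    by_contra! hne
    have hcomp : IsCompact (Icc (1 : ℝ) 2 ∩ (fun t => a t * x' t) ⁻¹' Ici 0) :=
      isCompact_Icc.of_isClosed_subset (hcont.preimage_isClosed_of_isClosed isClosed_Icc
        isClosed_Ici) inter_subset_left
    obtain ⟨τ, ⟨hτ, hτ0⟩, hmin⟩ := hcomp.exists_isLeast (by
      obtain ⟨t, ht, h0⟩ := hne
      exact ⟨t, ht, h0⟩)
    have hτ0 : 0 ≤ a τ * x' τ := hτ0
    have := key τ hτ fun t ht => by
      by_contra! h
      exact ht.2.not_ge (hmin ⟨⟨ht.1, ht.2.le.trans hτ.2⟩, h.le⟩)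
    nlinarith
  have hx2 := le_add_mul_of_hasDerivWithinAt_le (q := 2) (C := -x 1) hx (fun t ht => by
    have htI := Ico_subset_Icc_self ht
    have hk := key t htI fun r hr => (hneg r ⟨hr.1, hr.2.le.trans htI.2⟩).le
    have : a t * x 1 ≤ A * x 1 := by
      gcongr
      exact hA t htI
    refine le_of_mul_le_mul_left ?_ (ha1 t ht.1)
    linarith) (right_mem_Icc.2 one_le_two)
  linarith [hpos 2 (by simp : (1 : ℝ) ≤ 2)]

/-- Theorem 5 (continuity in the initial data): if `cₙ > 0`, `cₙ → 0`, and `xₙ` is the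
solution of `(a x')' + b F(x) = 0` on `[1,∞)` with `xₙ(1) = cₙ`, `xₙ'(1) ≤ 0`, `xₙ > 0`
and `xₙ(∞) = 0`, then `xₙ'(1) → 0`. -/
theorem derivative_at_one_tendsto_zero
    (a b F : ℝ → ℝ) (B k₀ kinf : ℝ)
    (ha_cont : ContinuousOn a (Ici 0)) (ha_pos : ∀ t ∈ Ici (0:ℝ), 0 < a t)
    (ha_int : IntegrableOn (fun t => 1 / a t) (Ici 0))
    (hb_cont : ContinuousOn b (Ici 0))
    (hb_nonneg : ∀ t ∈ Icc (0:ℝ) 1, 0 ≤ b t)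
    (hb_ne : ∃ t ∈ Icc (0:ℝ) 1, b t ≠ 0)
    (hB : 0 < B) (hbB : ∀ t ∈ Ici (1:ℝ), b t ≤ B)
    (hF_cont : Continuous F) (hF_sign : ∀ u : ℝ, u ≠ 0 → 0 < F u * u)
    (F' : ℝ → ℝ) (hF_deriv : ∀ u ∈ Ici (0:ℝ), HasDerivWithinAt F (F' u) (Ici 0) u)
    (hF'_bd : ∀ u ∈ Ici (0:ℝ), 0 ≤ F' u ∧ F' u ≤ 1)
    (hk₀ : Tendsto (fun u => F u / u) (𝓝[>] (0:ℝ)) (𝓝 k₀))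
    (hkinf : Tendsto (fun u => F u / u) atTop (𝓝 kinf))
    (hk₀_nonneg : 0 ≤ k₀) (hk_ne : k₀ ≠ kinf)
    (hdisc : Disconjugate2 (fun t => B / a t) (Ici 1))
    (c : ℕ → ℝ) (hc_pos : ∀ n, 0 < c n) (hc_lim : Tendsto c atTop (𝓝 0))
    (x x' : ℕ → ℝ → ℝ)
    (hsol : ∀ n, SolODE a b F (Ici 1) (x n) (x' n))
    (hinit : ∀ n, x n 1 = c n) (hder : ∀ n, x' n 1 ≤ 0)
    (hpos : ∀ n, ∀ t ∈ Ici (1:ℝ), 0 < x n t)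
    (hlim : ∀ n, Tendsto (x n) atTop (𝓝 0)) :
    Tendsto (fun n => x' n 1) atTop (𝓝 0) := by
  have hF_pos : ∀ u, 0 < u → 0 ≤ F u := fun u hu => (pos_of_mul_pos_left (hF_sign u hu.ne') hu.le).le
  have hF0 : F 0 = 0 := by
    have h1 : Tendsto F (𝓝[>] 0) (𝓝 (F 0)) := hF_cont.continuousAt.mono_left nhdsWithin_le_nhds
    have h2 : Tendsto (fun u => F u / u * u) (𝓝[>] (0 : ℝ)) (𝓝 (k₀ * 0)) :=
      hk₀.mul (tendsto_id.mono_left nhdsWithin_le_nhds)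
    have h3 : (fun u => F u / u * u) =ᶠ[𝓝[>] (0 : ℝ)] F := by
      filter_upwards [self_mem_nhdsWithin] with u hu
      exact div_mul_cancel₀ _ (ne_of_gt hu)
    simpa using tendsto_nhds_unique h1 (h2.congr' h3)
  have hF_le : ∀ u, 0 < u → F u ≤ u := fun u hu => by
    simpa [hF0] using le_add_mul_of_hasDerivWithinAt_le (C := 1) hF_deriv
      (fun t ht => (hF'_bd t ht.1).2) (right_mem_Icc.2 hu.le)
  have hsub : Icc (1 : ℝ) 2 ⊆ Ici 0 := fun t ht => zero_le_one.trans ht.1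
  obtain ⟨M, hM⟩ := isCompact_Icc.exists_bound_of_continuousOn (hb_cont.mono hsub)
  obtain ⟨A, hA⟩ := isCompact_Icc.exists_bound_of_continuousOn (ha_cont.mono hsub)
  have ha1 : 0 < a 1 := ha_pos 1 (by simp)
  have hbound : ∀ n, -((M + A) / a 1 * c n) ≤ x' n 1 := fun n => by
    have h := neg_mul_deriv_le_of_pos ha_pos (fun t ht => (le_abs_self _).trans (hA t ht)) hM
      hF_pos hF_le (hsol n) (hpos n)
    rw [hinit] at h
    rw [div_mul_eq_mul_div, ← neg_div, div_le_iff₀ ha1]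
    linarith
  refine tendsto_of_tendsto_of_tendsto_of_le_of_le ?_ tendsto_const_nhds hbound hder
  simpa using (hc_lim.const_mul ((M + A) / a 1)).neg
end

section
/- Let F : [T₁,T₂] × ℝⁿ → ℝⁿ be continuous and bounded, and let K₀ be a continuum (a nonempty compact connected set) contained in {T₁} × ℝⁿ. Suppose that every solution z of the system z' = F(t,z) with (T₁, z(T₁)) ∈ K₀ is defined on the whole interval [T₁,T₂]. Then the cross-section {z(T₂) : z is a solution of z' = F(t,z) on [T₁,T₂] with (T₁, z(T₁)) ∈ K₀} is a continuum (a nonempty compact connected subset) in ℝⁿ. -/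
open Set Filter MeasureTheory Topology Real

/-- A trajectory whose speed is bounded by `M` and which starts in the ball of radius `R` stays in
the ball of radius `R + M (b - a)`. -/
lemma norm_le_of_norm_deriv_le {E : Type*} [NormedAddCommGroup E] [NormedSpace ℝ E] {a b M R : ℝ}
    {z z' : ℝ → E} (hz : ∀ t ∈ Icc a b, HasDerivWithinAt z (z' t) (Icc a b) t)
    (hM : ∀ t ∈ Icc a b, ‖z' t‖ ≤ M) (hR : ‖z a‖ ≤ R) {t : ℝ} (ht : t ∈ Icc a b) :
    ‖z t‖ ≤ R + M * (b - a) := by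
  have hab : a ≤ b := ht.1.trans ht.2
  have hM0 : 0 ≤ M := (norm_nonneg _).trans (hM t ht)
  have h := (convex_Icc a b).norm_image_sub_le_of_norm_hasDerivWithin_le hz hM
    (left_mem_Icc.2 hab) ht
  rw [Real.norm_of_nonneg (sub_nonneg.2 ht.1)] at h
  calc ‖z t‖ = ‖z a + (z t - z a)‖ := by rw [add_sub_cancel]
    _ ≤ ‖z a‖ + ‖z t - z a‖ := norm_add_le _ _
    _ ≤ R + M * (b - a) := by
      gcongr
      exact h.trans (by gcongr; exact ht.2)

/-- Arzelà–Ascoli for trajectories of bounded speed with bounded initial values. -/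
lemma exists_subseq_tendsto_of_norm_deriv_le {E : Type*} [NormedAddCommGroup E] [NormedSpace ℝ E]
    [ProperSpace E] {a b M R : ℝ} (hab : a ≤ b) {z z' : ℕ → ℝ → E}
    (hz : ∀ k, ∀ t ∈ Icc a b, HasDerivWithinAt (z k) (z' k t) (Icc a b) t)
    (hM : ∀ k, ∀ t ∈ Icc a b, ‖z' k t‖ ≤ M) (hR : ∀ k, ‖z k a‖ ≤ R) :
    ∃ w : ℝ → E, Continuous w ∧ ∃ φ : ℕ → ℕ, StrictMono φ ∧
      ∀ t ∈ Icc a b, Tendsto (fun k => z (φ k) t) atTop (𝓝 (w t)) := by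
  let g : ℕ → BoundedContinuousFunction (Icc a b) E := fun k =>
    BoundedContinuousFunction.mkOfCompact
      ⟨(Icc a b).domRestrict (z k), continuousOn_iff_continuous_domRestrict.1
        fun t ht => (hz k t ht).continuousWithinAt⟩
  have hg : ∀ k (t : Icc a b), g k t = z k t := fun k t => rfl
  let A : Set (BoundedContinuousFunction (Icc a b) E) :=
    {f | (∀ t, f t ∈ Metric.closedBall (0 : E) (R + M * (b - a))) ∧
      ∀ s t, dist (f s) (f t) ≤ M * dist s t}
  have hAc : IsClosed A := by
    simp only [A, Set.ofPred_and, Set.ofPred_forall]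
    have hev : ∀ t : Icc a b,
        Continuous fun f : BoundedContinuousFunction (Icc a b) E => f t :=
      fun t => by fun_prop
    refine (isClosed_iInter fun t => Metric.isClosed_closedBall.preimage (hev t)).inter
      (isClosed_iInter fun s => isClosed_iInter fun t => ?_)
    exact isClosed_le ((hev s).dist (hev t)) continuous_const
  have hA : IsCompact A := by
    refine BoundedContinuousFunction.arzela_ascoli₂ _ (isCompact_closedBall (0 : E) _) A hAc
      (fun f t hf => hf.1 t) ?_
    refine Metric.equicontinuous_of_continuity_modulus (fun r => M * r) ?_ _
      fun s t f => f.2.2 s t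
    simpa using (continuous_const_mul M).tendsto 0
  have hgA : ∀ k, g k ∈ A := by
    refine fun k => ⟨fun t => ?_, fun s t => ?_⟩
    · rw [mem_closedBall_zero_iff, hg]
      exact norm_le_of_norm_deriv_le (hz k) (hM k) (hR k) t.2
    · rw [hg, hg, dist_eq_norm, Subtype.dist_eq, dist_eq_norm]
      exact (convex_Icc a b).norm_image_sub_le_of_norm_hasDerivWithin_le (hz k) (hM k) t.2 s.2
  obtain ⟨f, -, φ, hφ, hlim⟩ := hA.tendsto_subseq hgA
  refine ⟨fun t => f (projIcc a b hab t), f.continuous.comp continuous_projIcc, φ, hφ,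
    fun t ht => ?_⟩
  have hev : Continuous fun f : BoundedContinuousFunction (Icc a b) E => f ⟨t, ht⟩ := by fun_prop
  have := (hev.tendsto f).comp hlim
  simp only [projIcc_of_mem hab ht]
  exact this

/-- Limits of approximate solutions with vanishing error are solutions. -/
lemma exists_subseq_tendsto_solution {E : Type*} [NormedAddCommGroup E] [NormedSpace ℝ E]
    [FiniteDimensional ℝ E] {a b C : ℝ} (hab : a ≤ b) {F : ℝ → E → E}
    (hF : Continuous fun p : ℝ × E => F p.1 p.2) (hC : ∀ t x, ‖F t x‖ ≤ C)
    {K : Set E} (hK : IsCompact K) {z z' : ℕ → ℝ → E} {ε : ℕ → ℝ}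
    (hz : ∀ k, ∀ t ∈ Icc a b, HasDerivWithinAt (z k) (z' k t) (Icc a b) t)
    (hε : ∀ k, ∀ t ∈ Icc a b, ‖z' k t - F t (z k t)‖ ≤ ε k)
    (hε0 : Tendsto ε atTop (𝓝 0)) (hzK : ∀ k, z k a ∈ K) :
    ∃ w : ℝ → E, (∀ t ∈ Icc a b, HasDerivWithinAt w (F t (w t)) (Icc a b) t) ∧ w a ∈ K ∧
      ∃ φ : ℕ → ℕ, StrictMono φ ∧ Tendsto (fun k => z (φ k) b) atTop (𝓝 (w b)) := by
  have := FiniteDimensional.proper ℝ E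
  have := FiniteDimensional.complete ℝ E
  obtain ⟨e, he⟩ := hε0.bddAbove_range
  obtain ⟨R, hR⟩ := hK.isBounded.exists_norm_le
  have haI : a ∈ Icc a b := left_mem_Icc.2 hab
  obtain ⟨w, hw, φ, hφ, hlim⟩ := exists_subseq_tendsto_of_norm_deriv_le (M := e + C) hab hz
    (fun k t ht => by
      have h1 : ε k ≤ e := he (mem_range_self k)
      calc ‖z' k t‖ = ‖(z' k t - F t (z k t)) + F t (z k t)‖ := by rw [sub_add_cancel]
        _ ≤ ‖z' k t - F t (z k t)‖ + ‖F t (z k t)‖ := norm_add_le _ _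
        _ ≤ e + C := add_le_add ((hε k t ht).trans h1) (hC _ _))
    (fun k => hR _ (hzK k))
  have hderiv : ∀ y : ℝ → E, Continuous y → ∀ t,
      HasDerivAt (fun t => ∫ s in a..t, F s (y s)) (F t (y t)) t := fun y hy t =>
    ((hF.comp (continuous_id.prodMk hy)).integral_hasStrictDerivAt a t).hasDerivAt
  let y : ℕ → ℝ → E := fun k t => z k (projIcc a b hab t)
  have hyc : ∀ k, Continuous (y k) := fun k =>
    (continuousOn_iff_continuous_domRestrict.1
      fun t ht => (hz k t ht).continuousWithinAt).comp continuous_projIcc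
  have hyz : ∀ k, ∀ t ∈ Icc a b, y k t = z k t := fun k t ht => by
    simp only [y, projIcc_of_mem hab ht]
  have hdefect : ∀ k, ∀ t ∈ Icc a b,
      ‖(z k t - ∫ s in a..t, F s (y k s)) - z k a‖ ≤ ε k * ‖t - a‖ := by
    intro k t ht
    have := (convex_Icc a b).norm_image_sub_le_of_norm_hasDerivWithin_le
      (f := fun t => z k t - ∫ s in a..t, F s (y k s)) (f' := fun t => z' k t - F t (y k t))
      (fun t ht => (hz k t ht).sub (hderiv (y k) (hyc k) t).hasDerivWithinAt)
      (fun t ht => by rw [hyz k t ht]; exact hε k t ht) haI ht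
    simpa using this
  have hint : ∀ t ∈ Icc a b, w t = w a + ∫ s in a..t, F s (w s) := by
    intro t ht
    have hI : Tendsto (fun k => ∫ s in a..t, F s (y (φ k) s)) atTop
        (𝓝 (∫ s in a..t, F s (w s))) := by
      refine intervalIntegral.tendsto_integral_filter_of_dominated_convergence (fun _ => C)
        (.of_forall fun k => (hF.comp (continuous_id.prodMk (hyc _))).aestronglyMeasurable)
        (.of_forall fun k => .of_forall fun s _ => hC _ _) intervalIntegrable_const
        (.of_forall fun s hs => ?_)
      rw [uIoc_of_le ht.1] at hs
      have hs' : s ∈ Icc a b := ⟨hs.1.le, hs.2.trans ht.2⟩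
      have h1 : Tendsto (fun k => (s, y (φ k) s)) atTop (𝓝 (s, w s)) := by
        simp only [hyz _ s hs']
        exact tendsto_const_nhds.prodMk_nhds (hlim s hs')
      exact (hF.tendsto (s, w s)).comp h1
    have h2 : Tendsto (fun k => ‖(z (φ k) t - ∫ s in a..t, F s (y (φ k) s)) - z (φ k) a‖) atTop
        (𝓝 ‖(w t - ∫ s in a..t, F s (w s)) - w a‖) :=
      (((hlim t ht).sub hI).sub (hlim a haI)).norm
    have h3 : Tendsto (fun k => ε (φ k) * ‖t - a‖) atTop (𝓝 (0 * ‖t - a‖)) :=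
      (hε0.comp hφ.tendsto_atTop).mul_const _
    have h4 := le_of_tendsto_of_tendsto' h2 h3 fun k => hdefect (φ k) t ht
    rw [zero_mul, norm_le_zero_iff, sub_sub, sub_eq_zero] at h4
    rw [h4, add_comm]
  refine ⟨w, fun t ht => ?_, hK.isClosed.mem_of_tendsto (hlim a haI) (.of_forall fun k => hzK _),
    φ, hφ, hlim b (right_mem_Icc.2 hab)⟩
  exact ((hderiv w hw t).const_add (w a)).hasDerivWithinAt.congr hint (hint t ht)

/-- A bounded continuous field is approximated, uniformly on a ball, by a continuous field that is
globally Lipschitz in space. -/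
lemma exists_lipschitz_approx {n : ℕ} {F : ℝ → (Fin n → ℝ) → (Fin n → ℝ)} {a b C R ε : ℝ}
    (hF : Continuous fun p : ℝ × (Fin n → ℝ) => F p.1 p.2) (hC : ∀ t x, ‖F t x‖ ≤ C)
    (hR : 0 ≤ R) (hε : 0 < ε) :
    ∃ (G : ℝ → (Fin n → ℝ) → (Fin n → ℝ)) (L : NNReal),
      (Continuous fun p : ℝ × (Fin n → ℝ) => G p.1 p.2) ∧
      (∀ t ∈ Icc a b, LipschitzWith L (G t)) ∧ (∀ t x, ‖G t x‖ ≤ C + ε) ∧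
      ∀ t x, ‖x‖ ≤ R → ‖F t x - G t x‖ ≤ ε := by
  obtain ⟨g, hg, hgF, -⟩ := hF.exists_contDiff_approx (ε := fun _ => ε) 1 continuous_const
    fun _ => hε
  let c : (Fin n → ℝ) → (Fin n → ℝ) := fun x i => max (-R) (min R (x i))
  have hcL : LipschitzWith 1 c := by
    refine LipschitzWith.of_dist_le_mul fun x y => ?_
    rw [NNReal.coe_one, one_mul, dist_pi_le_iff dist_nonneg]
    intro i
    have := ((LipschitzWith.id.const_min R).const_max (-R)).dist_le_mul (x i) (y i)
    simp only [NNReal.coe_one, one_mul, id] at this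
    exact this.trans (dist_le_pi_dist x y i)
  have hcR : ∀ x, c x ∈ Metric.closedBall (0 : Fin n → ℝ) R := by
    intro x
    rw [mem_closedBall_zero_iff, pi_norm_le_iff_of_nonneg hR]
    exact fun i => abs_le.2 ⟨le_max_left _ _, max_le (by linarith) (min_le_left _ _)⟩
  have hcx : ∀ x, ‖x‖ ≤ R → c x = x := by
    intro x hx
    ext i
    have := abs_le.1 ((norm_le_pi_norm x i).trans hx)
    simp only [c]
    rw [min_eq_right this.2, max_eq_right this.1]
  have hgF' : ∀ t x, ‖g (t, x) - F t x‖ < ε := fun t x => by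
    rw [← dist_eq_norm]; exact hgF (t, x)
  obtain ⟨L, hL⟩ := (hg.contDiffOn (s := Icc a b ×ˢ Metric.closedBall (0 : Fin n → ℝ) R)
    ).exists_lipschitzOnWith (by simp) ((convex_Icc a b).prod (convex_closedBall _ _))
    (isCompact_Icc.prod (isCompact_closedBall _ _))
  refine ⟨fun t x => g (t, c x), L, ?_, fun t ht => ?_, fun t x => ?_, fun t x hx => ?_⟩
  · exact hg.continuous.comp (continuous_fst.prodMk (hcL.continuous.comp continuous_snd))
  · refine LipschitzWith.of_dist_le_mul fun x y => ?_
    refine (hL.dist_le_mul _ ⟨ht, hcR x⟩ _ ⟨ht, hcR y⟩).trans ?_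
    gcongr
    simpa [Prod.dist_eq] using hcL.dist_le_mul x y
  · calc ‖g (t, c x)‖ = ‖F t (c x) + (g (t, c x) - F t (c x))‖ := by rw [add_sub_cancel]
      _ ≤ C + ε := (norm_add_le _ _).trans (add_le_add (hC _ _) (hgF' _ _).le)
  · simp only [hcx x hx]
    rw [norm_sub_rev]
    exact (hgF' t x).le

/-- A bounded, globally Lipschitz field has solutions on all of `[a, b]`, and they can be chosen to
depend continuously on the initial value. -/
lemma exists_continuousOn_flow {E : Type*} [NormedAddCommGroup E] [NormedSpace ℝ E]
    [CompleteSpace E] {f : ℝ → E → E} {a b M : ℝ} (hab : a ≤ b) {L : NNReal}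
    (hL : ∀ t ∈ Icc a b, LipschitzWith L (f t))
    (hf : ∀ x, ContinuousOn (fun t => f t x) (Icc a b)) (hM : ∀ t ∈ Icc a b, ∀ x, ‖f t x‖ ≤ M)
    (R : ℝ) :
    ∃ α : E → ℝ → E, (∀ x ∈ Metric.closedBall 0 R, α x a = x ∧
      ∀ t ∈ Icc a b, HasDerivWithinAt (α x) (f t (α x t)) (Icc a b) t) ∧
      ContinuousOn (fun x => α x b) (Metric.closedBall 0 R) := by
  have hM0 : 0 ≤ M := (norm_nonneg _).trans (hM a (left_mem_Icc.2 hab) 0)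
  have hab' : 0 ≤ b - a := sub_nonneg.2 hab
  have hP : IsPicardLindelof f (⟨a, left_mem_Icc.2 hab⟩ : Icc a b) 0
      (R.toNNReal + M.toNNReal * (b - a).toNNReal) R.toNNReal M.toNNReal L :=
    { lipschitzOnWith := fun t ht => (hL t ht).lipschitzOnWith
      continuousOn := fun x _ => hf x
      norm_le := fun t ht x _ => by rw [Real.coe_toNNReal _ hM0]; exact hM t ht x
      mul_max_le := by
        simp only [NNReal.coe_add, NNReal.coe_mul, Real.coe_toNNReal _ hM0,
          Real.coe_toNNReal _ hab', sub_self, max_eq_left hab']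
        linarith }
  obtain ⟨α, hα, K, hK⟩ := hP.exists_forall_mem_closedBall_eq_hasDerivWithinAt_lipschitzOnWith
  have hsub : Metric.closedBall (0 : E) R ⊆ Metric.closedBall 0 (R.toNNReal : ℝ) :=
    Metric.closedBall_subset_closedBall (Real.le_coe_toNNReal R)
  exact ⟨α, fun x hx => hα x (hsub hx),
    (hK b (right_mem_Icc.2 hab)).continuousOn.mono hsub⟩

/-- The endpoints of two solutions emanating from a connected set of initial values lie in a
connected set of endpoints of approximate solutions emanating from it. -/
lemma exists_isPreconnected_approx_endpoints {n : ℕ} {F : ℝ → (Fin n → ℝ) → (Fin n → ℝ)}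
    {a b C ε : ℝ} (hab : a ≤ b) (hF : Continuous fun p : ℝ × (Fin n → ℝ) => F p.1 p.2)
    (hC : ∀ t x, ‖F t x‖ ≤ C) {K : Set (Fin n → ℝ)} (hK : Bornology.IsBounded K)
    (hKc : IsPreconnected K) (hε : 0 < ε) {u v : ℝ → Fin n → ℝ}
    (hu : ∀ t ∈ Icc a b, HasDerivWithinAt u (F t (u t)) (Icc a b) t) (huK : u a ∈ K)
    (hv : ∀ t ∈ Icc a b, HasDerivWithinAt v (F t (v t)) (Icc a b) t) (hvK : v a ∈ K) :
    ∃ S : Set (Fin n → ℝ), IsPreconnected S ∧ u b ∈ S ∧ v b ∈ S ∧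
      ∀ p ∈ S, ∃ z z' : ℝ → Fin n → ℝ,
        (∀ t ∈ Icc a b, HasDerivWithinAt z (z' t) (Icc a b) t) ∧
        (∀ t ∈ Icc a b, ‖z' t - F t (z t)‖ ≤ ε) ∧ z a ∈ K ∧ z b = p := by
  obtain ⟨R₀, hR₀⟩ := hK.exists_norm_le
  have hR₀0 : 0 ≤ R₀ := (norm_nonneg _).trans (hR₀ _ huK)
  have hC0 : 0 ≤ C := (norm_nonneg _).trans (hC a 0)
  have hab' : 0 ≤ b - a := sub_nonneg.2 hab
  have hbI : b ∈ Icc a b := right_mem_Icc.2 hab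
  obtain ⟨G, L, hG, hGL, hGC, hFG⟩ := exists_lipschitz_approx (a := a) (b := b)
    (R := R₀ + (C + ε) * (b - a)) hF hC (by positivity) (half_pos hε)
  have hsol : ∀ w : ℝ → Fin n → ℝ,
      (∀ t ∈ Icc a b, HasDerivWithinAt w (F t (w t)) (Icc a b) t) → w a ∈ K →
      ContinuousOn (fun t => F t (w t) - G t (w t)) (Icc a b) ∧
      ∀ t ∈ Icc a b, F t (w t) - G t (w t) ∈ Metric.closedBall (0 : Fin n → ℝ) (ε / 2) := by
    refine fun w hw hwK => ⟨?_, fun t ht => ?_⟩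
    · have hwc : ContinuousOn (fun t => (t, w t)) (Icc a b) :=
        continuousOn_id.prodMk fun t ht => (hw t ht).continuousWithinAt
      exact (hF.comp_continuousOn hwc).sub (hG.comp_continuousOn hwc)
    · rw [mem_closedBall_zero_iff]
      exact hFG t _ (norm_le_of_norm_deriv_le hw
        (fun t _ => (hC t _).trans (le_add_of_nonneg_right hε.le)) (hR₀ _ hwK) ht)
  obtain ⟨huc, hub⟩ := hsol u hu huK
  obtain ⟨hvc, hvb⟩ := hsol v hv hvK
  set eu : ℝ → Fin n → ℝ := fun t => F t (u t) - G t (u t)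
  set ev : ℝ → Fin n → ℝ := fun t => F t (v t) - G t (v t)
  let c : ℝ → ℝ := fun l => max 0 (min 1 l)
  have hcI : ∀ l, c l ∈ Icc (0 : ℝ) 1 := fun l =>
    ⟨le_max_left _ _, max_le zero_le_one (min_le_left _ _)⟩
  have hcL : LipschitzWith 1 c := (LipschitzWith.id.const_min 1).const_max 0
  have hcorr : ∀ t ∈ Icc a b, ∀ l, ‖ev t + c l • (eu t - ev t)‖ ≤ ε / 2 := fun t ht l =>
    mem_closedBall_zero_iff.1
      ((convex_closedBall (0 : Fin n → ℝ) (ε / 2)).add_smul_sub_mem (hvb t ht) (hub t ht) (hcI l))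
  let f : ℝ → (Fin n → ℝ) × ℝ → (Fin n → ℝ) × ℝ := fun t p =>
    (G t p.1 + (ev t + c p.2 • (eu t - ev t)), 0)
  have hfL : ∀ t ∈ Icc a b, LipschitzWith (max (L * 1 + (0 + ε.toNNReal)) 0) (f t) := by
    intro t ht
    refine LipschitzWith.prodMk (((hGL t ht).comp LipschitzWith.prod_fst).add
      ((LipschitzWith.const (ev t)).add ?_)) (LipschitzWith.const 0)
    refine LipschitzWith.of_dist_le_mul fun p q => ?_
    have h1 : ‖eu t - ev t‖ ≤ ε := by
      have := norm_sub_le_of_le (mem_closedBall_zero_iff.1 (hub t ht))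
        (mem_closedBall_zero_iff.1 (hvb t ht))
      linarith
    have h2 : dist (c p.2) (c q.2) ≤ dist p q := by
      have := hcL.dist_le_mul p.2 q.2
      rw [NNReal.coe_one, one_mul] at this
      exact this.trans (le_max_right _ _)
    rw [dist_eq_norm, ← sub_smul, norm_smul, ← dist_eq_norm, Real.coe_toNNReal _ hε.le, mul_comm]
    gcongr
  have hfc : ∀ p, ContinuousOn (fun t => f t p) (Icc a b) := by
    intro p
    have : Continuous fun t => G t p.1 := hG.comp (continuous_id.prodMk continuous_const)
    exact (this.continuousOn.add (hvc.add ((huc.sub hvc).const_smul (c p.2)))).prodMk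
      continuousOn_const
  have hfM1 : ∀ t ∈ Icc a b, ∀ p, ‖(f t p).1‖ ≤ C + ε := fun t ht p => by
    have := norm_add_le_of_le (hGC t p.1) (hcorr t ht p.2)
    simp only [f]
    linarith
  have hfM : ∀ t ∈ Icc a b, ∀ p, ‖f t p‖ ≤ C + ε := fun t ht p =>
    max_le (hfM1 t ht p) (by simp only [f, norm_zero]; positivity)
  obtain ⟨α, hα, hαc⟩ := exists_continuousOn_flow hab hfL hfc hfM (max R₀ 1)
  have hball : K ×ˢ Icc (0 : ℝ) 1 ⊆ Metric.closedBall 0 (max R₀ 1) := by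
    rintro ⟨x, l⟩ ⟨hx, hl⟩
    rw [mem_closedBall_zero_iff]
    exact max_le_max (hR₀ x hx) (by rw [Real.norm_of_nonneg hl.1]; exact hl.2)
  have hend : ∀ w : ℝ → Fin n → ℝ, ∀ l ∈ Icc (0 : ℝ) 1, w a ∈ K →
      (∀ t ∈ Icc a b, HasDerivWithinAt w (f t (w t, l)).1 (Icc a b) t) →
      (α (w a, l) b).1 = w b := by
    intro w l hl hwK hw
    obtain ⟨h0, h1⟩ := hα (w a, l) (hball ⟨hwK, hl⟩)
    have h2 : ∀ t ∈ Icc a b,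
        HasDerivWithinAt (fun t => (w t, l)) (f t (w t, l)) (Icc a b) t := fun t ht =>
      (hw t ht).prodMk (hasDerivWithinAt_const t _ l)
    have hEq := ODE_solution_unique_of_mem_Icc_right (s := fun _ => univ)
      (fun t ht => (hfL t (Ico_subset_Icc_self ht)).lipschitzOnWith)
      (fun t ht => (h1 t ht).continuousWithinAt)
      (fun t ht => (h1 t (Ico_subset_Icc_self ht)).mono_of_mem_nhdsWithin
        (Icc_mem_nhdsGE_of_mem ht))
      (fun _ _ => mem_univ _)
      (fun t ht => (h2 t ht).continuousWithinAt)
      (fun t ht => (h2 t (Ico_subset_Icc_self ht)).mono_of_mem_nhdsWithin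
        (Icc_mem_nhdsGE_of_mem ht))
      (fun _ _ => mem_univ _) h0 hbI
    exact congrArg Prod.fst hEq
  refine ⟨(fun q => (α q b).1) '' (K ×ˢ Icc (0 : ℝ) 1),
    (hKc.prod isPreconnected_Icc).image _ (continuous_fst.comp_continuousOn (hαc.mono hball)),
    ⟨(u a, 1), ⟨huK, by simp⟩, hend u 1 (by simp) huK fun t ht => ?_⟩,
    ⟨(v a, 0), ⟨hvK, by simp⟩, hend v 0 (by simp) hvK fun t ht => ?_⟩, ?_⟩
  · simpa [f, c, eu] using hu t ht
  · simpa [f, c, ev] using hv t ht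
  rintro _ ⟨⟨x, l⟩, hq, rfl⟩
  obtain ⟨h0, h1⟩ := hα (x, l) (hball hq)
  have hz : ∀ t ∈ Icc a b,
      HasDerivWithinAt (fun t => (α (x, l) t).1) (f t (α (x, l) t)).1 (Icc a b) t := fun t ht =>
    (ContinuousLinearMap.fst ℝ (Fin n → ℝ) ℝ).hasFDerivAt.comp_hasDerivWithinAt t (h1 t ht)
  have hza : (α (x, l) a).1 = x := by rw [h0]
  refine ⟨fun t => (α (x, l) t).1, fun t => (f t (α (x, l) t)).1, hz, fun t ht => ?_, ?_, rfl⟩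
  · have hR := norm_le_of_norm_deriv_le (R := R₀) hz (fun t ht => hfM1 t ht _)
      (by rw [hza]; exact hR₀ x hq.1) ht
    have h3 := norm_sub_le_of_le (hcorr t ht (α (x, l) t).2) (hFG t _ hR)
    calc _ = ‖ev t + c (α (x, l) t).2 • (eu t - ev t) -
          (F t (α (x, l) t).1 - G t (α (x, l) t).1)‖ := by
            congr 1
            simp only [f]
            abel
      _ ≤ ε := by linarith
  · simp only [hza]
    exact hq.1

/-- Proposition 2 (Kneser-type theorem): for a continuous bounded `F` on `[T₁,T₂] × ℝⁿ`
and a continuum `K₀` of initial values at `t = T₁`, if every solution of `z' = F(t,z)`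
emanating from `K₀` extends to the whole of `[T₁,T₂]`, then the cross-section at `T₂`
of the solution funnel is a continuum in `ℝⁿ`. -/
theorem kneser_cross_section_continuum
    (n : ℕ) (T₁ T₂ : ℝ) (hT : T₁ ≤ T₂)
    (F : ℝ → (Fin n → ℝ) → (Fin n → ℝ))
    (hF_cont : ContinuousOn (fun p : ℝ × (Fin n → ℝ) => F p.1 p.2) (Icc T₁ T₂ ×ˢ univ))
    (C : ℝ) (hF_bd : ∀ t ∈ Icc T₁ T₂, ∀ v, ‖F t v‖ ≤ C)
    (K₀ : Set (Fin n → ℝ)) (hK₀_cpt : IsCompact K₀) (hK₀_conn : IsConnected K₀)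
    (hext : ∀ s ∈ Icc T₁ T₂, ∀ z : ℝ → Fin n → ℝ,
      (∀ t ∈ Icc T₁ s, HasDerivWithinAt z (F t (z t)) (Icc T₁ s) t) → z T₁ ∈ K₀ →
      ∃ w : ℝ → Fin n → ℝ,
        (∀ t ∈ Icc T₁ T₂, HasDerivWithinAt w (F t (w t)) (Icc T₁ T₂) t) ∧
        ∀ t ∈ Icc T₁ s, w t = z t) :
    IsCompact {p : Fin n → ℝ | ∃ z : ℝ → Fin n → ℝ,
        (∀ t ∈ Icc T₁ T₂, HasDerivWithinAt z (F t (z t)) (Icc T₁ T₂) t) ∧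
        z T₁ ∈ K₀ ∧ z T₂ = p} ∧
    IsConnected {p : Fin n → ℝ | ∃ z : ℝ → Fin n → ℝ,
        (∀ t ∈ Icc T₁ T₂, HasDerivWithinAt z (F t (z t)) (Icc T₁ T₂) t) ∧
        z T₁ ∈ K₀ ∧ z T₂ = p} := by
  have hmem : ∀ t, (projIcc T₁ T₂ hT t : ℝ) ∈ Icc T₁ T₂ := fun t => (projIcc T₁ T₂ hT t).2
  let H : ℝ → (Fin n → ℝ) → (Fin n → ℝ) := fun t => F (projIcc T₁ T₂ hT t)
  have hHF : ∀ t ∈ Icc T₁ T₂, H t = F t := fun t ht => by simp only [H, projIcc_of_mem hT ht]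
  have hH : Continuous fun p : ℝ × (Fin n → ℝ) => H p.1 p.2 :=
    hF_cont.comp_continuous (f := fun p : ℝ × (Fin n → ℝ) => ((projIcc T₁ T₂ hT p.1 : ℝ), p.2))
      ((continuous_subtype_val.comp (continuous_projIcc.comp continuous_fst)).prodMk
        continuous_snd) fun p => ⟨hmem p.1, mem_univ _⟩
  have hHC : ∀ t x, ‖H t x‖ ≤ C := fun t x => hF_bd _ (hmem t) x
  have hlim : ∀ (z z' : ℕ → ℝ → Fin n → ℝ) (ε : ℕ → ℝ),
      (∀ k, ∀ t ∈ Icc T₁ T₂, HasDerivWithinAt (z k) (z' k t) (Icc T₁ T₂) t) →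
      (∀ k, ∀ t ∈ Icc T₁ T₂, ‖z' k t - H t (z k t)‖ ≤ ε k) → Tendsto ε atTop (𝓝 0) →
      (∀ k, z k T₁ ∈ K₀) →
      ∃ p ∈ {p : Fin n → ℝ | ∃ z : ℝ → Fin n → ℝ,
        (∀ t ∈ Icc T₁ T₂, HasDerivWithinAt z (F t (z t)) (Icc T₁ T₂) t) ∧
        z T₁ ∈ K₀ ∧ z T₂ = p}, ∃ φ : ℕ → ℕ, StrictMono φ ∧
        Tendsto (fun k => z (φ k) T₂) atTop (𝓝 p) := by
    intro z z' ε hz hε hε0 hzK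
    obtain ⟨w, hw, hwK, hφ⟩ := exists_subseq_tendsto_solution hT hH hHC hK₀_cpt hz hε hε0 hzK
    exact ⟨w T₂, ⟨w, fun t ht => hHF t ht ▸ hw t ht, hwK, rfl⟩, hφ⟩
  have hcpt : IsCompact {p : Fin n → ℝ | ∃ z : ℝ → Fin n → ℝ,
        (∀ t ∈ Icc T₁ T₂, HasDerivWithinAt z (F t (z t)) (Icc T₁ T₂) t) ∧
        z T₁ ∈ K₀ ∧ z T₂ = p} := by
    rw [isCompact_iff_isSeqCompact]
    intro p hp
    choose z hz hzK hzp using hp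
    obtain ⟨q, hq, φ, hφ, h⟩ := hlim z (fun k t => F t (z k t)) (fun _ => 0) hz
      (fun k t ht => by simp [hHF t ht]) tendsto_const_nhds hzK
    exact ⟨q, hq, φ, hφ, by simpa only [hzp, Function.comp_def] using h⟩
  refine ⟨hcpt, ?_, ?_⟩
  · obtain ⟨x, hx⟩ := hK₀_conn.nonempty
    obtain ⟨w, hw, hwx⟩ := hext T₁ (left_mem_Icc.2 hT) (fun _ => x)
      (fun t _ => by
        rw [Icc_self]
        exact HasFDerivWithinAt.of_finite (finite_singleton T₁)) hx
    exact ⟨w T₂, w, hw, by rwa [hwx T₁ (by simp)], rfl⟩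
  · rw [isPreconnected_closed_iff]
    intro A B hA hB hAB hneA hneB
    by_contra hne
    obtain ⟨U, V, hU, hV, hAU, hBV, hUV⟩ := SeparatedNhds.of_isCompact_isCompact
      (hcpt.inter_right hA) (hcpt.inter_right hB) (by
        rw [Set.disjoint_left]
        exact fun p hpA hpB => hne ⟨p, hpA.1, hpA.2, hpB.2⟩)
    obtain ⟨p, hp⟩ := hneA
    obtain ⟨q, hq⟩ := hneB
    have hpU := hAU hp
    have hqV := hBV hq
    obtain ⟨⟨u, hu, huK, rfl⟩, -⟩ := hp
    obtain ⟨⟨v, hv, hvK, rfl⟩, -⟩ := hq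
    have happrox : ∀ k : ℕ, ∃ z z' : ℝ → Fin n → ℝ,
        (∀ t ∈ Icc T₁ T₂, HasDerivWithinAt z (z' t) (Icc T₁ T₂) t) ∧
        (∀ t ∈ Icc T₁ T₂, ‖z' t - H t (z t)‖ ≤ 1 / ((k : ℝ) + 1)) ∧ z T₁ ∈ K₀ ∧
        z T₂ ∉ U ∪ V := by
      intro k
      obtain ⟨S, hS, huS, hvS, hSz⟩ := exists_isPreconnected_approx_endpoints hT hH hHC
        hK₀_cpt.isBounded hK₀_conn.isPreconnected (Nat.one_div_pos_of_nat (α := ℝ) (n := k))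
        (fun t ht => (hHF t ht).symm ▸ hu t ht) huK (fun t ht => (hHF t ht).symm ▸ hv t ht) hvK
      by_contra! hcon
      have hSUV : S ⊆ U ∪ V := by
        intro p hp
        obtain ⟨z, z', hz, hε, hzK, rfl⟩ := hSz p hp
        exact hcon z z' hz hε hzK
      obtain ⟨p, -, hp⟩ := hS U V hU hV hSUV ⟨_, huS, hpU⟩ ⟨_, hvS, hqV⟩
      exact Set.disjoint_left.1 hUV hp.1 hp.2
    choose z z' hz hε hzK hzUV using happrox
    obtain ⟨p, hp, φ, -, h⟩ := hlim z z' _ hz hε tendsto_one_div_add_atTop_nhds_zero_nat hzK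
    have hpUV : p ∉ U ∪ V :=
      (hU.union hV).isClosed_compl.mem_of_tendsto h (.of_forall fun k => hzUV _)
    exact hpUV ((hAB hp).imp (fun hpA => hAU ⟨hp, hpA⟩) fun hpB => hBV ⟨hp, hpB⟩)
end

section
/- Under the standing assumptions on a, b, F, suppose that the linear equation v'' + (B/a(t))·v = 0 is disconjugate on [1,∞), and that there exist t₁, t₂ ∈ (0,1) with t₁ < t₂ such that ∫_{t₁}^{t₂} b(t) dt > 0, min{k₀, k_∞}·A(1)·|b|_L < 1, and max{k₀, k_∞}·∫_{t₁}^{t₂} b(t) dt > A(1)/(A(t₁)(A(1) − A(t₂))). Let b₁ : [0,∞) → ℝ be continuous with b₁(t) = 0 for t ∈ [0,1] and b₁(t) ≤ 0 for t > 1. Then the perturbed equation (a(t)z')' + (b(t) + b₁(t))F(z) = 0 has a solution z on [0,∞) satisfying z(0) = 0, z(t) > 0 for all t ∈ (0,∞), and lim_{t→∞} z(t) = 0. -/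
open Set Filter MeasureTheory Topology Real

/-- The planar vector field of the first-order system `z' = p(t) w`, `w' = -q(t) G(z)`. -/
def planarField (p q G : ℝ → ℝ) (t : ℝ) (x : ℝ × ℝ) : ℝ × ℝ := (p t * x.2, -(q t * G x.1))

/-- `(z, w)` is a global solution of the system `z' = p(t) w`, `w' = -q(t) G(z)`. -/
structure IsTraj (p q G z w : ℝ → ℝ) : Prop where
  fst : ∀ t, HasDerivAt z (p t * w t) t
  snd : ∀ t, HasDerivAt w (-(q t * G (z t))) t

lemma planarField_lipschitz {p q G : ℝ → ℝ} (hG : LipschitzWith 1 G) {t : ℝ} {K : NNReal}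
    (hp : |p t| ≤ K) (hq : |q t| ≤ K) : LipschitzWith K (planarField p q G t) := by
  refine LipschitzWith.of_dist_le_mul fun x y => ?_
  have h1 : dist x.1 y.1 ≤ dist x y := le_max_left _ _
  have h2 : dist x.2 y.2 ≤ dist x y := le_max_right _ _
  have h3 := hG.dist_le_mul x.1 y.1
  simp only [NNReal.coe_one, one_mul] at h3
  rw [Prod.dist_eq (x := planarField p q G t x)]
  refine max_le ?_ ?_
  · have : dist (p t * x.2) (p t * y.2) = |p t| * dist x.2 y.2 := by
      rw [Real.dist_eq, ← mul_sub, abs_mul, Real.dist_eq]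
    simp only [planarField, this]
    gcongr
  · have : dist (-(q t * G x.1)) (-(q t * G y.1)) = |q t| * dist (G x.1) (G y.1) := by
      rw [dist_neg_neg, Real.dist_eq, ← mul_sub, abs_mul, Real.dist_eq]
    simp only [planarField, this]
    gcongr
    exact h3.trans h1

lemma planarField_zero {p q G : ℝ → ℝ} (hG0 : G 0 = 0) (t : ℝ) :
    planarField p q G t 0 = 0 := by
  simp [planarField, hG0]

lemma continuous_planarField {p q : ℝ → ℝ} (G : ℝ → ℝ) (hp : Continuous p) (hq : Continuous q)
    (x : ℝ × ℝ) : Continuous fun t => planarField p q G t x := by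
  unfold planarField; fun_prop

/-- Continuous functions have a common bound on a compact interval. -/
lemma exists_common_bound {p q : ℝ → ℝ} (hp : Continuous p) (hq : Continuous q) (T : ℝ) :
    ∃ K : NNReal, ∀ t ∈ Icc (-T) T, |p t| ≤ K ∧ |q t| ≤ K := by
  obtain ⟨C₁, h₁⟩ := (isCompact_Icc (a := -T) (b := T)).exists_bound_of_continuousOn hp.continuousOn
  obtain ⟨C₂, h₂⟩ := (isCompact_Icc (a := -T) (b := T)).exists_bound_of_continuousOn hq.continuousOn
  refine ⟨Real.toNNReal (max C₁ C₂), fun t ht => ⟨?_, ?_⟩⟩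
  · exact ((h₁ t ht).trans (le_max_left _ _)).trans (Real.le_coe_toNNReal _)
  · exact ((h₂ t ht).trans (le_max_right _ _)).trans (Real.le_coe_toNNReal _)

/-- The retraction of the plane onto the square `[-M, M]²`. -/
def clampSquare (M : ℝ) (x : ℝ × ℝ) : ℝ × ℝ := (max (-M) (min M x.1), max (-M) (min M x.2))

lemma clampSquare_lipschitz (M : ℝ) : LipschitzWith 1 (clampSquare M) := by
  have h : LipschitzWith 1 fun s : ℝ => max (-M) (min M s) :=
    (LipschitzWith.id.const_min M).const_max (-M)
  have := (h.comp LipschitzWith.prod_fst).prodMk (h.comp LipschitzWith.prod_snd)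
  simpa [clampSquare, Function.comp_def] using! this

lemma clampSquare_of_norm_le {M : ℝ} {x : ℝ × ℝ} (hx : ‖x‖ ≤ M) : clampSquare M x = x := by
  have h1 := abs_le.1 ((norm_fst_le x).trans hx)
  have h2 := abs_le.1 ((norm_snd_le x).trans hx)
  ext <;> simp [clampSquare, *]

lemma norm_clampSquare_le {M : ℝ} (hM : 0 ≤ M) (x : ℝ × ℝ) : ‖clampSquare M x‖ ≤ M := by
  refine max_le ?_ ?_ <;> rw [Real.norm_eq_abs, abs_le] <;> simp [clampSquare, hM]

lemma norm_clampSquare_le_norm {M : ℝ} (hM : 0 ≤ M) (x : ℝ × ℝ) : ‖clampSquare M x‖ ≤ ‖x‖ := by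
  have h0 : clampSquare M 0 = 0 := clampSquare_of_norm_le (by simpa using hM)
  have := (clampSquare_lipschitz M).dist_le_mul x 0
  simpa [h0] using this

lemma exists_planar_solution_Icc {p q G : ℝ → ℝ} (hp : Continuous p) (hq : Continuous q)
    (hG : LipschitzWith 1 G) (hG0 : G 0 = 0) (x₀ : ℝ × ℝ) {T : ℝ} (hT : 0 ≤ T) :
    ∃ φ : ℝ → ℝ × ℝ, φ 0 = x₀ ∧
      ∀ t ∈ Icc (-T) T, HasDerivWithinAt φ (planarField p q G t (φ t)) (Icc (-T) T) t := by
  obtain ⟨K, hK⟩ := exists_common_bound hp hq T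
  set M : NNReal := ‖x₀‖₊ * (Real.exp (K * T)).toNNReal with hMdef
  have hMv : (M : ℝ) = ‖x₀‖ * Real.exp (K * T) := by
    simp [hMdef, Real.exp_nonneg]
  set g : ℝ → ℝ × ℝ → ℝ × ℝ := fun t x => planarField p q G t (clampSquare M x) with hg
  have hfl : ∀ t ∈ Icc (-T) T, LipschitzWith K (planarField p q G t) := fun t ht =>
    planarField_lipschitz hG (hK t ht).1 (hK t ht).2
  have hfn : ∀ t ∈ Icc (-T) T, ∀ x, ‖planarField p q G t x‖ ≤ K * ‖x‖ := fun t ht x => by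
    have := (hfl t ht).dist_le_mul x 0
    simpa [planarField_zero hG0] using this
  have hgn : ∀ t ∈ Icc (-T) T, ∀ x, ‖g t x‖ ≤ K * ‖x‖ := fun t ht x =>
    (hfn t ht _).trans (by gcongr; exact norm_clampSquare_le_norm M.2 x)
  have hPL : IsPicardLindelof g (tmin := -T) (tmax := T) ⟨0, by simp [hT]⟩ x₀
      (K * M * T.toNNReal) 0 (K * M) K := by
    refine ⟨fun t ht => ?_, fun x _ => ?_, fun t ht x _ => ?_, ?_⟩
    · have := (hfl t ht).comp (clampSquare_lipschitz M)
      rw [mul_one] at this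
      exact this.lipschitzOnWith
    · exact (continuous_planarField G hp hq _).continuousOn
    · refine (hfn t ht _).trans ?_
      push_cast
      gcongr
      exact norm_clampSquare_le M.2 x
    · simp [hT]
  obtain ⟨φ, hφ0, hφ⟩ := hPL.exists_eq_forall_mem_Icc_hasDerivWithinAt₀
  simp only at hφ0
  have key : ∀ (ψ ψ' : ℝ → ℝ × ℝ), ψ 0 = x₀ → 
      (∀ t ∈ Icc (0:ℝ) T, HasDerivWithinAt ψ (ψ' t) (Icc 0 T) t) →
      (∀ t ∈ Icc (0:ℝ) T, ‖ψ' t‖ ≤ K * ‖ψ t‖) → ∀ t ∈ Icc (0:ℝ) T, ‖ψ t‖ ≤ M := by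
    intro ψ ψ' h0 hd hb t ht
    have := norm_le_gronwallBound_of_norm_deriv_right_le (f := ψ) (f' := ψ') (δ := ‖x₀‖) (K := K)
      (ε := 0) (a := 0) (b := T) (fun s hs => (hd s hs).continuousWithinAt)
      (fun s hs => (hd s (Ico_subset_Icc_self hs)).mono_of_mem_nhdsWithin
        (Icc_mem_nhdsGE_of_mem hs)) (by rw [h0])
      (fun s hs => by simpa using hb s (Ico_subset_Icc_self hs)) t ht
    rw [gronwallBound_ε0, sub_zero] at this
    rw [hMv]
    refine this.trans ?_
    gcongr
    exact ht.2
  have hbd : ∀ t ∈ Icc (-T) T, ‖φ t‖ ≤ M := by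
    intro t ht
    rcases le_total 0 t with h | h
    · exact key φ (fun t => g t (φ t)) hφ0
        (fun s hs => (hφ s ⟨by linarith [hs.1], hs.2⟩).mono (Icc_subset_Icc_left (by linarith)))
        (fun s hs => hgn s ⟨by linarith [hs.1], hs.2⟩ _) t ⟨h, ht.2⟩
    · have := key (fun s => φ (-s)) (fun s => -g (-s) (φ (-s))) (by simpa using hφ0)
        (fun s hs => ?_)
        (fun s hs => by
          rw [norm_neg]; exact hgn (-s) ⟨by linarith [hs.2], by linarith [hs.1]⟩ _) (-t)
        ⟨by linarith, by linarith [ht.1]⟩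
      · simpa using this
      · have hm : MapsTo (fun s : ℝ => -s) (Icc 0 T) (Icc (-T) T) := fun u hu =>
          ⟨by linarith [hu.2], by linarith [hu.1]⟩
        have := (hφ (-s) (hm hs)).scomp s (hasDerivAt_neg s).hasDerivWithinAt hm
        simpa [Function.comp_def] using! this
  refine ⟨φ, hφ0, fun t ht => ?_⟩
  have := hφ t ht
  simp only [hg] at this
  rwa [clampSquare_of_norm_le (hbd t ht)] at this

lemma planar_unique_Ioo {p q G : ℝ → ℝ} (hp : Continuous p) (hq : Continuous q)
    (hG : LipschitzWith 1 G) {T t₀ : ℝ} (ht₀ : t₀ ∈ Ioo (-T) T) {φ ψ : ℝ → ℝ × ℝ}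
    (hφ : ∀ t ∈ Ioo (-T) T, HasDerivAt φ (planarField p q G t (φ t)) t)
    (hψ : ∀ t ∈ Ioo (-T) T, HasDerivAt ψ (planarField p q G t (ψ t)) t)
    (h : φ t₀ = ψ t₀) : EqOn φ ψ (Ioo (-T) T) := by
  obtain ⟨K, hK⟩ := exists_common_bound hp hq T
  exact ODE_solution_unique_of_mem_Ioo (s := fun _ => univ) (K := K)
    (fun t ht => (planarField_lipschitz hG (hK t (Ioo_subset_Icc_self ht)).1
      (hK t (Ioo_subset_Icc_self ht)).2).lipschitzOnWith) ht₀
    (fun t ht => ⟨hφ t ht, trivial⟩) (fun t ht => ⟨hψ t ht, trivial⟩) h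

lemma exists_planar_solution {p q G : ℝ → ℝ} (hp : Continuous p) (hq : Continuous q)
    (hG : LipschitzWith 1 G) (hG0 : G 0 = 0) (x₀ : ℝ × ℝ) :
    ∃ φ : ℝ → ℝ × ℝ, φ 0 = x₀ ∧ ∀ t, HasDerivAt φ (planarField p q G t (φ t)) t := by
  have hex : ∀ n : ℕ, ∃ φ : ℝ → ℝ × ℝ, φ 0 = x₀ ∧
      ∀ t ∈ Ioo (-((n : ℝ) + 1)) (n + 1), HasDerivAt φ (planarField p q G t (φ t)) t := by
    intro n
    obtain ⟨φ, h0, h⟩ := exists_planar_solution_Icc hp hq hG hG0 x₀ (T := n + 1) (by positivity)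
    exact ⟨φ, h0, fun t ht => (h t (Ioo_subset_Icc_self ht)).hasDerivAt (Icc_mem_nhds ht.1 ht.2)⟩
  choose S hS0 hS using hex
  have hagree : ∀ m n : ℕ, m ≤ n → EqOn (S m) (S n) (Ioo (-((m : ℝ) + 1)) (m + 1)) := by
    intro m n hmn
    have hmn' : (m : ℝ) ≤ n := by exact_mod_cast hmn
    refine planar_unique_Ioo hp hq hG (t₀ := 0) ⟨?_, ?_⟩ (hS m) (fun t ht => hS n t ?_) ?_
    · linarith [m.cast_nonneg (α := ℝ)]
    · positivity
    · exact ⟨by linarith [ht.1], by linarith [ht.2]⟩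
    · rw [hS0, hS0]
  have hloc : ∀ (n : ℕ) (s : ℝ), |s| < n → S ⌈|s|⌉₊ s = S n s := by
    intro n s hs
    refine hagree _ n (Nat.ceil_le.2 hs.le) ?_
    have := Nat.le_ceil |s|
    exact abs_lt.1 (by linarith)
  refine ⟨fun t => S ⌈|t|⌉₊ t, by simpa using hS0 _, fun t => ?_⟩
  obtain ⟨n, hn⟩ := exists_nat_gt |t|
  have hmem : t ∈ Ioo (-((n : ℝ) + 1)) (n + 1) := abs_lt.1 (by linarith)
  have hev : (fun t => S ⌈|t|⌉₊ t) =ᶠ[𝓝 t] S n := by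
    filter_upwards [(continuous_abs.tendsto t).eventually (gt_mem_nhds hn)] with s hs
    exact hloc n s hs
  have := (hS n t hmem).congr_of_eventuallyEq hev
  simpa only [hloc n t hn] using this

lemma exists_isTraj {p q G : ℝ → ℝ} (hp : Continuous p) (hq : Continuous q)
    (hG : LipschitzWith 1 G) (hG0 : G 0 = 0) (z₀ w₀ : ℝ) :
    ∃ z w, IsTraj p q G z w ∧ z 0 = z₀ ∧ w 0 = w₀ := by
  obtain ⟨φ, h0, h⟩ := exists_planar_solution hp hq hG hG0 (z₀, w₀)
  refine ⟨fun t => (φ t).1, fun t => (φ t).2, ⟨fun t => (h t).fst, fun t => (h t).snd⟩, ?_, ?_⟩ <;>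
    simp [h0]

namespace IsTraj

variable {p q G z w z₁ w₁ z₂ w₂ : ℝ → ℝ}

lemma hasDerivAt_prodMk (h : IsTraj p q G z w) (t : ℝ) :
    HasDerivAt (fun t => (z t, w t)) (planarField p q G t (z t, w t)) t :=
  (h.fst t).prodMk (h.snd t)

lemma continuous_fst (h : IsTraj p q G z w) : Continuous z :=
  continuous_iff_continuousAt.2 fun t => (h.fst t).continuousAt

lemma continuous_snd (h : IsTraj p q G z w) : Continuous w :=
  continuous_iff_continuousAt.2 fun t => (h.snd t).continuousAt

lemma unique (hp : Continuous p) (hq : Continuous q) (hG : LipschitzWith 1 G)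
    (h₁ : IsTraj p q G z₁ w₁) (h₂ : IsTraj p q G z₂ w₂) {t₀ : ℝ} (hz : z₁ t₀ = z₂ t₀)
    (hw : w₁ t₀ = w₂ t₀) : z₁ = z₂ ∧ w₁ = w₂ := by
  have key : ∀ t, (z₁ t, w₁ t) = (z₂ t, w₂ t) := by
    intro t
    have hmem : ∀ s : ℝ, |s| ≤ max |t| |t₀| →
        s ∈ Ioo (-(max |t| |t₀| + 1)) (max |t| |t₀| + 1) := fun s hs => abs_lt.1 (by linarith)
    exact planar_unique_Ioo hp hq hG (hmem t₀ (le_max_right _ _))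
      (fun s _ => h₁.hasDerivAt_prodMk s) (fun s _ => h₂.hasDerivAt_prodMk s)
      (by simp [hz, hw]) (hmem t (le_max_left _ _))
  exact ⟨funext fun t => (Prod.ext_iff.1 (key t)).1, funext fun t => (Prod.ext_iff.1 (key t)).2⟩

/-- Continuous dependence on the initial slope. -/
lemma exists_dist_le (hp : Continuous p) (hq : Continuous q) (hG : LipschitzWith 1 G) {T : ℝ}
    (hT : 0 ≤ T) : ∃ C : ℝ, ∀ z₁ w₁ z₂ w₂ : ℝ → ℝ, IsTraj p q G z₁ w₁ → IsTraj p q G z₂ w₂ →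
      z₁ 0 = z₂ 0 → dist (z₁ T) (z₂ T) ≤ C * dist (w₁ 0) (w₂ 0) := by
  obtain ⟨K, hK⟩ := exists_common_bound hp hq T
  refine ⟨Real.exp (K * T), fun z₁ w₁ z₂ w₂ h₁ h₂ h0 => ?_⟩
  have := dist_le_of_trajectories_ODE_of_mem (s := fun _ => univ) (v := planarField p q G)
    (a := 0) (b := T) (K := K)
    (fun t ht => (planarField_lipschitz hG (hK t ⟨by linarith [ht.1], ht.2.le⟩).1
      (hK t ⟨by linarith [ht.1], ht.2.le⟩).2).lipschitzOnWith)
    (h₁.continuous_fst.prodMk h₁.continuous_snd).continuousOn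
    (fun t _ => (h₁.hasDerivAt_prodMk t).hasDerivWithinAt) (fun _ _ => trivial)
    (h₂.continuous_fst.prodMk h₂.continuous_snd).continuousOn
    (fun t _ => (h₂.hasDerivAt_prodMk t).hasDerivWithinAt) (fun _ _ => trivial)
    (δ := dist (w₁ 0) (w₂ 0)) (by simp [Prod.dist_eq, h0]) T ⟨hT, le_rfl⟩
  rw [sub_zero, mul_comm] at this
  exact (le_max_left _ _).trans this

end IsTraj
lemma monotoneOn_of_hasDerivAt_nonneg {f f' : ℝ → ℝ} {a b : ℝ}
    (hf : ∀ t ∈ Icc a b, HasDerivAt f (f' t) t) (h : ∀ t ∈ Icc a b, 0 ≤ f' t) :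
    MonotoneOn f (Icc a b) :=
  monotoneOn_of_deriv_nonneg (convex_Icc a b)
    (fun t ht => (hf t ht).continuousAt.continuousWithinAt)
    (fun t ht => (hf t (interior_subset ht)).differentiableAt.differentiableWithinAt)
    (fun t ht => by
      rw [(hf t (interior_subset ht)).deriv]
      exact h t (interior_subset ht))

lemma antitoneOn_of_hasDerivAt_nonpos {f f' : ℝ → ℝ} {a b : ℝ}
    (hf : ∀ t ∈ Icc a b, HasDerivAt f (f' t) t) (h : ∀ t ∈ Icc a b, f' t ≤ 0) :
    AntitoneOn f (Icc a b) :=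
  antitoneOn_of_deriv_nonpos (convex_Icc a b)
    (fun t ht => (hf t ht).continuousAt.continuousWithinAt)
    (fun t ht => (hf t (interior_subset ht)).differentiableAt.differentiableWithinAt)
    (fun t ht => by
      rw [(hf t (interior_subset ht)).deriv]
      exact h t (interior_subset ht))

lemma eventually_pos_right_of_hasDerivAt {f : ℝ → ℝ} {f' x : ℝ} (hf : HasDerivAt f f' x)
    (hx : f x = 0) (hf' : 0 < f') : ∀ᶠ s in 𝓝[>] x, 0 < f s := by
  have h := (hasDerivAt_iff_tendsto_slope.1 hf).eventually (lt_mem_nhds hf')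
  have h' := h.filter_mono (nhdsWithin_mono x (fun s (hs : x < s) => hs.ne'))
  filter_upwards [h', self_mem_nhdsWithin] with s hs hxs
  rw [slope_def_field, hx, sub_zero] at hs
  exact (div_pos_iff_of_pos_right (sub_pos.2 hxs)).1 hs

lemma eventually_neg_left_of_hasDerivAt {f : ℝ → ℝ} {f' x : ℝ} (hf : HasDerivAt f f' x)
    (hx : f x = 0) (hf' : 0 < f') : ∀ᶠ s in 𝓝[<] x, f s < 0 := by
  have h := (hasDerivAt_iff_tendsto_slope.1 hf).eventually (lt_mem_nhds hf')
  have h' := h.filter_mono (nhdsWithin_mono x (fun s (hs : s < x) => hs.ne))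
  filter_upwards [h', self_mem_nhdsWithin] with s hs hxs
  rw [slope_def_field, hx, sub_zero] at hs
  by_contra hc
  push Not at hc
  exact absurd hs (not_lt.2 (div_nonpos_of_nonneg_of_nonpos hc (sub_nonpos.2 (le_of_lt hxs))))

/-- The new time variable `A(t) = ∫₀ᵗ p`. -/
noncomputable def timeChange (p : ℝ → ℝ) (t : ℝ) : ℝ := ∫ s in (0:ℝ)..t, p s

section TimeChange

variable {p : ℝ → ℝ}

lemma timeChange_zero : timeChange p 0 = 0 := intervalIntegral.integral_same

lemma hasDerivAt_timeChange (hp : Continuous p) (t : ℝ) : HasDerivAt (timeChange p) (p t) t :=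
  intervalIntegral.integral_hasDerivAt_right (hp.intervalIntegrable _ _)
    (hp.stronglyMeasurableAtFilter _ _) hp.continuousAt

lemma strictMono_timeChange (hp : Continuous p) (hpos : ∀ t, 0 < p t) :
    StrictMono (timeChange p) :=
  strictMono_of_hasDerivAt_pos (hasDerivAt_timeChange hp) hpos

lemma continuous_timeChange (hp : Continuous p) : Continuous (timeChange p) :=
  continuous_iff_continuousAt.2 fun t => (hasDerivAt_timeChange hp t).continuousAt

end TimeChange

namespace IsTraj

variable {p q G z w : ℝ → ℝ}

/-- Once the solution becomes nonpositive it is affine in the new time variable, when the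
nonlinearity vanishes on the negative half-line. -/
lemma eq_affine (hp : Continuous p) (hpos : ∀ t, 0 < p t) (hq : Continuous q)
    (hG : LipschitzWith 1 G) (hGneg : ∀ u ≤ 0, G u = 0) (h : IsTraj p q G z w) {t₀ t : ℝ}
    (hz : z t₀ = 0) (hw : w t₀ ≤ 0) (ht : t₀ ≤ t) :
    z t = w t₀ * (timeChange p t - timeChange p t₀) := by
  set T := max |t₀| |t| with hT
  obtain ⟨K, hK⟩ := exists_common_bound hp hq T
  have hsub : Icc t₀ t ⊆ Icc (-T) T := by
    refine Icc_subset_Icc ?_ ?_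
    · exact (neg_le_neg (le_max_left _ _)).trans (neg_abs_le t₀)
    · exact (le_abs_self t).trans (le_max_right _ _)
  have hA := continuous_timeChange hp
  have := ODE_solution_unique_of_mem_Icc_right (v := planarField p q G) (s := fun _ => univ)
    (K := K) (a := t₀) (b := t)
    (f := fun s => (z s, w s)) (g := fun s => (w t₀ * (timeChange p s - timeChange p t₀), w t₀))
    (fun s hs => (planarField_lipschitz hG (hK s (hsub (Ico_subset_Icc_self hs))).1
      (hK s (hsub (Ico_subset_Icc_self hs))).2).lipschitzOnWith)
    (h.continuous_fst.prodMk h.continuous_snd).continuousOn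
    (fun s _ => (h.hasDerivAt_prodMk s).hasDerivWithinAt) (fun _ _ => trivial)
    (by fun_prop) (fun s hs => ?_) (fun _ _ => trivial) (by simp [hz])
  · exact (Prod.ext_iff.1 (this ⟨ht, le_rfl⟩)).1
  · have hneg : w t₀ * (timeChange p s - timeChange p t₀) ≤ 0 :=
      mul_nonpos_of_nonpos_of_nonneg hw
        (sub_nonneg.2 ((strictMono_timeChange hp hpos).monotone hs.1))
    have h1 : HasDerivAt (fun s => w t₀ * (timeChange p s - timeChange p t₀)) (p s * w t₀) s := by
      rw [mul_comm (p s)]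
      exact ((hasDerivAt_timeChange hp s).sub_const _).const_mul _
    have h2 := h1.prodMk (hasDerivAt_const s (w t₀))
    have h3 : planarField p q G s (w t₀ * (timeChange p s - timeChange p t₀), w t₀)
        = (p s * w t₀, 0) := by
      simp [planarField, hGneg _ hneg]
    rw [h3]
    exact h2.hasDerivWithinAt

lemma zero (hG0 : G 0 = 0) : IsTraj p q G (fun _ => 0) (fun _ => 0) :=
  ⟨fun t => by simpa using hasDerivAt_const t (0:ℝ),
    fun t => by simpa [hG0] using hasDerivAt_const t (0:ℝ)⟩

/-- Zeros of a nontrivial solution are simple. -/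
lemma snd_ne_zero (hp : Continuous p) (hq : Continuous q) (hG : LipschitzWith 1 G)
    (hG0 : G 0 = 0) (h : IsTraj p q G z w) (hw0 : w 0 ≠ 0) {t : ℝ} (ht : z t = 0) : w t ≠ 0 :=
  fun hw => hw0 (congrFun (h.unique hp hq hG (zero hG0) ht hw).2 0)

/-- A solution starting at zero with positive slope and becoming nonpositive has a first positive
zero, which is crossed transversally, and stays negative afterwards. -/
lemma exists_first_zero (hp : Continuous p) (hpos : ∀ t, 0 < p t) (hq : Continuous q)
    (hG : LipschitzWith 1 G) (hGneg : ∀ u ≤ 0, G u = 0) (h : IsTraj p q G z w) (hz0 : z 0 = 0)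
    (hw0 : 0 < w 0) {t₀ : ℝ} (ht₀ : 0 < t₀) (hzt : z t₀ ≤ 0) :
    ∃ t₁, 0 < t₁ ∧ t₁ ≤ t₀ ∧ z t₁ = 0 ∧ w t₁ < 0 ∧ (∀ s ∈ Ioo 0 t₁, 0 < z s) ∧
      ∀ s, t₁ < s → z s < 0 := by
  have hev := eventually_pos_right_of_hasDerivAt (h.fst 0) hz0 (mul_pos (hpos 0) hw0)
  obtain ⟨ε, hε, hεz⟩ := (mem_nhdsGT_iff_exists_Ioo_subset).1 hev
  have hε' : (0:ℝ) < ε := hε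
  have hc : IsCompact {s | s ∈ Icc (ε / 2) t₀ ∧ z s ≤ 0} :=
    isCompact_Icc.inter_right (isClosed_le h.continuous_fst continuous_const)
  have ht₀ε : ε / 2 ≤ t₀ := by
    by_contra hc
    push Not at hc
    have := hεz ⟨ht₀, by linarith⟩
    exact absurd (show 0 < z t₀ from this) (not_lt.2 hzt)
  obtain ⟨t₁, ⟨⟨h1a, h1b⟩, h1c⟩, h1d⟩ := hc.exists_isLeast ⟨t₀, ⟨ht₀ε, le_rfl⟩, hzt⟩
  have ht₁ : 0 < t₁ := by linarith
  have hposz : ∀ s ∈ Ioo 0 t₁, 0 < z s := by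
    intro s hs
    by_cases hsε : s < ε
    · exact hεz ⟨hs.1, hsε⟩
    · by_contra hcon
      push Not at hcon hsε
      have := h1d ⟨⟨by linarith, by linarith [hs.2]⟩, hcon⟩
      linarith [hs.2]
  have hz1 : z t₁ = 0 := by
    refine le_antisymm h1c ?_
    have hlim : Tendsto z (𝓝[<] t₁) (𝓝 (z t₁)) :=
      (h.continuous_fst.tendsto t₁).mono_left nhdsWithin_le_nhds
    refine ge_of_tendsto hlim ?_
    filter_upwards [Ioo_mem_nhdsLT ht₁] with s hs using (hposz s hs).le
  have hw1 : w t₁ ≤ 0 := by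
    by_contra hcon
    push Not at hcon
    have := eventually_neg_left_of_hasDerivAt (h.fst t₁) hz1 (mul_pos (hpos t₁) hcon)
    obtain ⟨s, hs1, hs2⟩ := (this.and (Ioo_mem_nhdsLT ht₁)).exists
    exact absurd (hposz s hs2) (not_lt.2 hs1.le)
  have hw1' : w t₁ < 0 :=
    lt_of_le_of_ne hw1 (h.snd_ne_zero hp hq hG (hGneg 0 le_rfl) hw0.ne' hz1)
  refine ⟨t₁, ht₁, h1b, hz1, hw1', hposz, fun s hs => ?_⟩
  rw [h.eq_affine hp hpos hq hG hGneg hz1 hw1 hs.le]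
  exact mul_neg_of_neg_of_pos hw1' (sub_pos.2 (strictMono_timeChange hp hpos hs))

end IsTraj

/-- A positive decaying supersolution `Y` of `(y'/p)' + B y = 0` on `[1, ∞)`, with quasi-derivative
`U` vanishing at `1`. -/
structure DecayingBarrier (p : ℝ → ℝ) (B ℓ : ℝ) (Y U : ℝ → ℝ) : Prop where
  fst : ∀ t, HasDerivAt Y (p t * U t) t
  snd : ∀ t, HasDerivAt U (-(B * (Y t + ℓ))) t
  nonneg : 0 ≤ ℓ
  pos : ∀ t, 1 ≤ t → 0 < Y t
  neumann : U 1 = 0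
  tendsto : Tendsto Y atTop (𝓝 0)

/-- Disconjugacy yields a decaying barrier: subtract its limit from the derivative of the solution
vanishing at `1`. -/
lemma exists_decayingBarrier {p : ℝ → ℝ} (hp : Continuous p) (hpos : ∀ t, 0 < p t) {B : ℝ}
    (hB : 0 < B) (hdisc : Disconjugate2 (fun t => B * p t) (Ici 1)) :
    ∃ ℓ Y U, DecayingBarrier p B ℓ Y U := by
  obtain ⟨V, X, hVX, hV0, hX0⟩ := exists_isTraj (p := fun _ => 1) (q := fun t => B * p (t + 1))
    (G := id) continuous_const (by fun_prop) LipschitzWith.id rfl 0 1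
  set v : ℝ → ℝ := fun t => V (t - 1) with hvdef
  set x : ℝ → ℝ := fun t => X (t - 1) with hxdef
  have hv1 : v 1 = 0 := by simp [hvdef, hV0]
  have hx1 : x 1 = 1 := by simp [hxdef, hX0]
  have hv : ∀ t, HasDerivAt v (x t) t := fun t => by
    have := (hVX.fst (t - 1)).comp_sub_const t 1
    simpa [hvdef, hxdef] using! this
  have hx : ∀ t, HasDerivAt x (-(B * p t * v t)) t := fun t => by
    have := (hVX.snd (t - 1)).comp_sub_const t 1
    simpa [hvdef, hxdef] using! this
  have hvc : Continuous v := continuous_iff_continuousAt.2 fun t => (hv t).continuousAt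
  have hev := eventually_pos_right_of_hasDerivAt (hv 1) hv1 (by rw [hx1]; exact one_pos)
  obtain ⟨s₀, hs₀, hs₀1⟩ := (hev.and self_mem_nhdsWithin).exists
  have hs₀1' : 1 < s₀ := hs₀1
  have hne : ∀ t, 1 < t → v t ≠ 0 := by
    intro t ht h0
    have hsol : SolODE2 (fun t => B * p t) id (Ici 1) v x (fun t => -(B * p t * v t)) := by
      refine ⟨fun t _ => (hv t).hasDerivWithinAt, fun t _ => (hx t).hasDerivWithinAt, ?_, ?_⟩
      · exact (by fun_prop : Continuous fun t => -(B * p t * v t)).continuousOn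
      · intro t _
        simp
    exact ht.ne (hdisc v x _ hsol ⟨s₀, hs₀1'.le, hs₀.ne'⟩ 1 self_mem_Ici t ht.le hv1 h0)
  have hvpos : ∀ t, 1 < t → 0 < v t := by
    intro t ht
    by_contra hcon
    push Not at hcon
    have hsub : uIcc s₀ t ⊆ Ioi 1 := by
      intro r hr
      exact lt_of_lt_of_le (lt_min hs₀1' ht) hr.1
    obtain ⟨r, hr, hr0⟩ := intermediate_value_uIcc hvc.continuousOn
      (mem_uIcc.2 (Or.inr ⟨hcon, hs₀.le⟩) : (0:ℝ) ∈ uIcc (v s₀) (v t))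
    exact hne r (hsub hr) hr0
  have hvnn : ∀ t, 1 ≤ t → 0 ≤ v t := fun t ht => by
    rcases ht.eq_or_lt with rfl | h
    · exact hv1.ge
    · exact (hvpos t h).le
  have hxanti : StrictAntiOn x (Ici 1) := by
    refine strictAntiOn_of_deriv_neg (convex_Ici 1)
      (fun t _ => (hx t).continuousAt.continuousWithinAt) fun t ht => ?_
    rw [interior_Ici] at ht
    rw [(hx t).deriv, neg_lt_zero]
    exact mul_pos (mul_pos hB (hpos t)) (hvpos t ht)
  have hxnn : ∀ t, 1 ≤ t → 0 ≤ x t := by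
    intro s hs
    by_contra hcon
    push Not at hcon
    have hle : ∀ t, s ≤ t → v t ≤ v s + x s * (t - s) := by
      intro t hst
      have hd : ∀ r, HasDerivAt (fun r => v r - x s * r) (x r - x s) r := fun r => by
        simpa using (hv r).fun_sub ((hasDerivAt_id r).const_mul (x s))
      have := antitoneOn_of_hasDerivAt_nonpos (a := s) (b := t) (fun r _ => hd r) (fun r hr =>
        sub_nonpos.2 (hxanti.antitoneOn hs (le_trans hs hr.1) hr.1))
        ⟨le_rfl, hst⟩ ⟨hst, le_rfl⟩ hst
      simp only at this
      linarith
    have h1 : s ≤ s + (v s + 1) / (-x s) := by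
      have := div_nonneg (by linarith [hvnn s hs] : 0 ≤ v s + 1) (neg_nonneg.2 hcon.le)
      linarith
    have h2 := hle _ h1
    have h3 := hvnn _ (hs.trans h1)
    have h4 : x s * (s + (v s + 1) / (-x s) - s) = -(v s + 1) := by
      have := hcon.ne
      field_simp
      ring
    linarith
  obtain ⟨ℓ, hℓ⟩ : ∃ ℓ, IsGLB (x '' Ici 1) ℓ :=
    Real.exists_isGLB ⟨x 1, mem_image_of_mem x self_mem_Ici⟩
      ⟨0, by rintro _ ⟨t, ht, rfl⟩; exact hxnn t ht⟩
  refine ⟨ℓ, fun t => x t - ℓ, fun t => -(B * v t), ?_, ?_, ?_, ?_, ?_, ?_⟩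
  · intro t
    convert! (hx t).sub_const ℓ using 1
    ring
  · intro t
    simpa using ((hv t).const_mul B).fun_neg
  · exact hℓ.2 (by rintro _ ⟨t, ht, rfl⟩; exact hxnn t ht)
  · intro t ht
    have h1 := hℓ.1 (mem_image_of_mem x (show t + 1 ∈ Ici (1:ℝ) from by simp; linarith))
    have h2 := hxanti ht (show t + 1 ∈ Ici (1:ℝ) from by simp; linarith) (lt_add_one t)
    linarith
  · simp [hv1]
  · rw [Metric.tendsto_atTop]
    intro ε hε
    obtain ⟨_, ⟨N, hN, rfl⟩, hNε⟩ := (isGLB_lt_iff hℓ).1 (lt_add_of_pos_right ℓ hε)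
    refine ⟨N, fun t ht => ?_⟩
    have h1 := hℓ.1 (mem_image_of_mem x (le_trans hN ht))
    have h2 := hxanti.antitoneOn hN (le_trans hN ht) ht
    rw [Real.dist_eq, sub_zero, abs_of_nonneg] <;> linarith
lemma LipschitzWith.nonneg_le_self {G : ℝ → ℝ} (hG : LipschitzWith 1 G) (hGmono : Monotone G)
    (hG0 : G 0 = 0) {u : ℝ} (hu : 0 ≤ u) : 0 ≤ G u ∧ G u ≤ u := by
  have h1 : 0 ≤ G u := hG0 ▸ hGmono hu
  have h2 := hG.dist_le_mul u 0
  simp only [hG0, Real.dist_eq, sub_zero, NNReal.coe_one, one_mul, abs_of_nonneg h1,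
    abs_of_nonneg hu] at h2
  exact ⟨h1, h2⟩

namespace IsTraj

variable {p q G z w Y U : ℝ → ℝ} {B ℓ : ℝ}

/-- Comparison with the barrier: the Wronskian is monotone while the solution is nonnegative. -/
lemma monotoneOn_wronskian (hG : LipschitzWith 1 G) (hGmono : Monotone G) (hG0 : G 0 = 0)
    (hB : 0 ≤ B) (hqB : ∀ t, 1 ≤ t → q t ≤ B) (hY : DecayingBarrier p B ℓ Y U)
    (h : IsTraj p q G z w) {T : ℝ} (hz : ∀ t ∈ Icc 1 T, 0 ≤ z t) :
    MonotoneOn (fun t => w t * Y t - z t * U t) (Icc 1 T) := by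
  refine monotoneOn_of_hasDerivAt_nonneg
    (fun t _ => ((h.snd t).mul (hY.fst t)).sub ((h.fst t).mul (hY.snd t))) fun t ht => ?_
  have hzt := hz t ht
  obtain ⟨h1, h2⟩ := hG.nonneg_le_self hGmono hG0 hzt
  have hYt := (hY.pos t ht.1).le
  have h3 : q t * G (z t) ≤ B * z t :=
    (mul_le_mul_of_nonneg_right (hqB t ht.1) h1).trans (mul_le_mul_of_nonneg_left h2 hB)
  have h4 := mul_le_mul_of_nonneg_right h3 hYt
  have h5 := mul_nonneg (mul_nonneg hB hzt) hY.nonneg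
  linarith

/-- A solution vanishing at `T` is dominated by a multiple of the barrier on `[1, T]`. -/
lemma mul_le_barrier (hpos : ∀ t, 0 < p t) (hG : LipschitzWith 1 G) (hGmono : Monotone G)
    (hG0 : G 0 = 0) (hB : 0 ≤ B) (hqB : ∀ t, 1 ≤ t → q t ≤ B) (hY : DecayingBarrier p B ℓ Y U)
    (h : IsTraj p q G z w) {T : ℝ} (hz : ∀ t ∈ Icc 1 T, 0 ≤ z t) (hzT : z T = 0) (hwT : w T ≤ 0)
    {t : ℝ} (ht : t ∈ Icc 1 T) : z t ≤ z 1 * Y t / Y 1 := by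
  have hT : T ∈ Icc 1 T := ⟨ht.1.trans ht.2, le_rfl⟩
  have hW := h.monotoneOn_wronskian hG hGmono hG0 hB hqB hY hz
  have hanti : AntitoneOn (fun t => z t / Y t) (Icc 1 T) := by
    refine antitoneOn_of_hasDerivAt_nonpos
      (fun s hs => (h.fst s).div (hY.fst s) (hY.pos s hs.1).ne') fun s hs => ?_
    refine div_nonpos_of_nonpos_of_nonneg ?_ (sq_nonneg _)
    have h1 := hW hs hT hs.2
    simp only [hzT, zero_mul, sub_zero] at h1
    have h2 := h1.trans (mul_nonpos_of_nonpos_of_nonneg hwT (hY.pos T hT.1).le)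
    have h3 := mul_nonpos_of_nonneg_of_nonpos (hpos s).le h2
    linarith
  have h1 := hanti ⟨le_rfl, hT.1⟩ ht ht.1
  simp only at h1
  rw [div_le_div_iff₀ (hY.pos t ht.1) (hY.pos 1 le_rfl)] at h1
  rwa [le_div_iff₀ (hY.pos 1 le_rfl)]

/-- A solution that is still increasing at time `1` stays positive. -/
lemma pos_of_snd_one_pos (hp : Continuous p) (hpos : ∀ t, 0 < p t) (hq : Continuous q)
    (hG : LipschitzWith 1 G) (hGmono : Monotone G) (hGneg : ∀ u ≤ 0, G u = 0) (hB : 0 ≤ B)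
    (hqB : ∀ t, 1 ≤ t → q t ≤ B) (hY : DecayingBarrier p B ℓ Y U) (h : IsTraj p q G z w)
    (hz0 : z 0 = 0) (hw0 : 0 < w 0) (hz1 : 0 < z 1) (hw1 : 0 < w 1) {t : ℝ} (ht : 0 < t) :
    0 < z t := by
  by_contra hcon
  push Not at hcon
  obtain ⟨r, hr0, -, hzr, hwr, hzpos, hzneg⟩ :=
    h.exists_first_zero hp hpos hq hG hGneg hz0 hw0 ht hcon
  rcases lt_trichotomy r 1 with hr | rfl | hr
  · exact (hzneg 1 hr).not_gt hz1
  · exact hz1.ne' hzr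
  · have hz : ∀ s ∈ Icc 1 r, 0 ≤ z s := fun s hs => by
      rcases hs.2.eq_or_lt with rfl | hlt
      · exact hzr.ge
      · exact (hzpos s ⟨by linarith [hs.1], hlt⟩).le
    have := h.monotoneOn_wronskian hG hGmono (hGneg 0 le_rfl) hB hqB hY hz ⟨le_rfl, hr.le⟩
      ⟨hr.le, le_rfl⟩ hr.le
    simp only [hY.neumann, hzr, mul_zero, zero_mul, sub_zero] at this
    have h1 := mul_pos hw1 (hY.pos 1 le_rfl)
    have h2 := mul_neg_of_neg_of_pos hwr (hY.pos r hr.le)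
    linarith

lemma antitoneOn_snd (hGmono : Monotone G) (hGneg : ∀ u ≤ 0, G u = 0)
    (hq01 : ∀ t ∈ Icc (0:ℝ) 1, 0 ≤ q t) (h : IsTraj p q G z w) :
    AntitoneOn w (Icc 0 1) := by
  have hGnn : ∀ u, 0 ≤ G u := fun u => (hGneg (min u 0) (min_le_right _ _)).ge.trans
    (hGmono (min_le_left _ _))
  exact antitoneOn_of_hasDerivAt_nonpos (fun t _ => h.snd t)
    fun t ht => neg_nonpos.2 (mul_nonneg (hq01 t ht) (hGnn _))

lemma chord_le (hp : Continuous p) (hpos : ∀ t, 0 < p t) (h : IsTraj p q G z w)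
    (hw : AntitoneOn w (Icc 0 1)) {s t : ℝ} (hs : 0 ≤ s) (hst : s ≤ t) (ht : t ≤ 1) :
    z t - z s ≤ w s * (timeChange p t - timeChange p s) := by
  have := antitoneOn_of_hasDerivAt_nonpos (a := s) (b := t)
    (fun r _ => (h.fst r).fun_sub ((hasDerivAt_timeChange hp r).const_mul (w s))) (fun r hr => by
      have := hw ⟨hs, hst.trans ht⟩ ⟨hs.trans hr.1, hr.2.trans ht⟩ hr.1
      have := mul_le_mul_of_nonneg_left this (hpos r).le
      linarith) ⟨le_rfl, hst⟩ ⟨hst, le_rfl⟩ hst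
  simp only at this
  linarith

lemma le_chord (hp : Continuous p) (hpos : ∀ t, 0 < p t) (h : IsTraj p q G z w)
    (hw : AntitoneOn w (Icc 0 1)) {s t : ℝ} (hs : 0 ≤ s) (hst : s ≤ t) (ht : t ≤ 1) :
    w t * (timeChange p t - timeChange p s) ≤ z t - z s := by
  have := monotoneOn_of_hasDerivAt_nonneg (a := s) (b := t)
    (fun r _ => (h.fst r).fun_sub ((hasDerivAt_timeChange hp r).const_mul (w t))) (fun r hr => by
      have := hw ⟨hs.trans hr.1, hr.2.trans ht⟩ ⟨hs.trans hst, ht⟩ hr.2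
      have := mul_le_mul_of_nonneg_left this (hpos r).le
      linarith) ⟨le_rfl, hst⟩ ⟨hst, le_rfl⟩ hst
  simp only at this
  linarith

/-- Lower bound for the slope on the first interval. -/
lemma sub_le_snd (hp : Continuous p) (hpos : ∀ t, 0 < p t) (hq : Continuous q)
    (hG : LipschitzWith 1 G) (hGmono : Monotone G) (hGneg : ∀ u ≤ 0, G u = 0)
    (hq01 : ∀ t ∈ Icc (0:ℝ) 1, 0 ≤ q t) (h : IsTraj p q G z w) (hz0 : z 0 = 0) (hw0 : 0 ≤ w 0)
    {t : ℝ} (ht0 : 0 ≤ t) (ht : t ≤ 1) :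
    w 0 - G (w 0 * timeChange p t) * timeChange q 1 ≤ w t := by
  have hw := h.antitoneOn_snd hGmono hGneg hq01
  have hAmono := (strictMono_timeChange hp hpos).monotone
  have h1 := monotoneOn_of_hasDerivAt_nonneg (a := 0) (b := t)
    (fun r _ => (h.snd r).fun_add
      ((hasDerivAt_timeChange hq r).const_mul (G (w 0 * timeChange p t)))) (fun r hr => by
      have h1 := h.chord_le hp hpos hw le_rfl hr.1 (hr.2.trans ht)
      rw [hz0, timeChange_zero, sub_zero, sub_zero] at h1
      have h2 := hGmono (h1.trans (mul_le_mul_of_nonneg_left (hAmono hr.2) hw0))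
      have := mul_le_mul_of_nonneg_left h2 (hq01 r ⟨hr.1, hr.2.trans ht⟩)
      linarith) ⟨le_rfl, ht0⟩ ⟨ht0, le_rfl⟩ ht0
  simp only [timeChange_zero, mul_zero, add_zero] at h1
  have h2 : timeChange q t ≤ timeChange q 1 :=
    monotoneOn_of_hasDerivAt_nonneg (fun r _ => hasDerivAt_timeChange hq r) hq01 ⟨ht0, ht⟩
      ⟨zero_le_one, le_rfl⟩ ht
  have h3 : 0 ≤ w 0 * timeChange p t :=
    mul_nonneg hw0 (timeChange_zero (p := p) ▸ hAmono ht0)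
  have h4 := mul_le_mul_of_nonneg_left h2 (hG.nonneg_le_self hGmono (hGneg 0 le_rfl) h3).1
  linarith

/-- Green-function estimate for a solution that is concave and positive on `(0, 1]`. -/
lemma green_estimate (hp : Continuous p) (hpos : ∀ t, 0 < p t) (hq : Continuous q)
    (hGmono : Monotone G) (hGneg : ∀ u ≤ 0, G u = 0)
    (hq01 : ∀ t ∈ Icc (0:ℝ) 1, 0 ≤ q t) (h : IsTraj p q G z w) (hz0 : z 0 = 0)
    (hz1 : 0 ≤ z 1) {t₁ t₂ : ℝ} (ht₁ : 0 < t₁) (ht₁₂ : t₁ < t₂) (ht₂ : t₂ < 1) :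
    G (min (z t₁) (z t₂)) * (timeChange q t₂ - timeChange q t₁) *
      (timeChange p t₁ * (timeChange p 1 - timeChange p t₂)) ≤
      min (z t₁) (z t₂) * timeChange p 1 := by
  have hw := h.antitoneOn_snd hGmono hGneg hq01
  have hA := strictMono_timeChange hp hpos
  have hA1 : 0 < timeChange p t₁ := timeChange_zero (p := p) ▸ hA ht₁
  have hA12 := hA ht₁₂
  have hA2 := hA ht₂
  set m := min (z t₁) (z t₂) with hm
  have hmle : ∀ r ∈ Icc t₁ t₂, m ≤ z r := by
    intro r hr
    have hr0 : 0 ≤ r := ht₁.le.trans hr.1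
    have hr1 : r ≤ 1 := hr.2.trans ht₂.le
    rcases le_total 0 (w r) with hwr | hwr
    · have := h.le_chord hp hpos hw ht₁.le hr.1 hr1
      have := mul_nonneg hwr (sub_nonneg.2 (hA.monotone hr.1))
      linarith [min_le_left (z t₁) (z t₂)]
    · have := h.chord_le hp hpos hw hr0 hr.2 ht₂.le
      have := mul_nonpos_of_nonpos_of_nonneg hwr (sub_nonneg.2 (hA.monotone hr.2))
      linarith [min_le_right (z t₁) (z t₂)]
  have hdrop := antitoneOn_of_hasDerivAt_nonpos (a := t₁) (b := t₂)
    (fun r _ => (h.snd r).fun_add ((hasDerivAt_timeChange hq r).const_mul (G m))) (fun r hr => by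
      have := mul_le_mul_of_nonneg_left (hGmono (hmle r hr))
        (hq01 r ⟨ht₁.le.trans hr.1, hr.2.trans ht₂.le⟩)
      linarith) ⟨le_rfl, ht₁₂.le⟩ ⟨ht₁₂.le, le_rfl⟩ ht₁₂.le
  simp only at hdrop
  have c1 := h.le_chord hp hpos hw le_rfl ht₁.le (ht₁₂.trans ht₂).le
  rw [hz0, timeChange_zero, sub_zero, sub_zero] at c1
  have c2 := h.chord_le hp hpos hw (ht₁.trans ht₁₂).le ht₂.le le_rfl
  have c3 := h.chord_le hp hpos hw ht₁.le ht₁₂.le ht₂.le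
  have c4 := h.le_chord hp hpos hw ht₁.le ht₁₂.le ht₂.le
  generalize timeChange p t₁ = A₁ at *
  generalize timeChange p t₂ = A₂ at *
  generalize timeChange p 1 = A at *
  generalize timeChange q t₁ = Q₁ at *
  generalize timeChange q t₂ = Q₂ at *
  have hD : 0 < A - A₂ := by linarith
  have hd : G m * (Q₂ - Q₁) ≤ w t₁ - w t₂ := by linarith
  have hd' := mul_le_mul_of_nonneg_right hd (mul_pos hA1 hD).le
  refine hd'.trans ?_
  rcases min_choice (z t₁) (z t₂) with hc | hc
  · have e1 : (w t₁ * A₁) * (A - A₂) ≤ z t₁ * (A - A₂) := by gcongr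
    have e2 : -(w t₂ * (A - A₂)) * A₁ ≤ z t₂ * A₁ := by
      apply mul_le_mul_of_nonneg_right _ hA1.le; linarith
    have e3 : (w t₁ * A₁) * (A₂ - A₁) ≤ z t₁ * (A₂ - A₁) := by
      apply mul_le_mul_of_nonneg_right c1; linarith
    have e4 := mul_le_mul_of_nonneg_right c3 hA1.le
    rw [hm, hc]
    linarith
  · have e1 : (w t₁ * A₁) * (A - A₂) ≤ z t₁ * (A - A₂) := by gcongr
    have e2 : -(w t₂ * (A - A₂)) * A₁ ≤ z t₂ * A₁ := by
      apply mul_le_mul_of_nonneg_right _ hA1.le; linarith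
    have e3 : -(w t₂ * (A - A₂)) * (A₂ - A₁) ≤ z t₂ * (A₂ - A₁) := by
      apply mul_le_mul_of_nonneg_right _; all_goals linarith
    have e4 := mul_le_mul_of_nonneg_right c4 hD.le
    rw [hm, hc]
    linarith

/-- Concavity lower bound in terms of the initial slope. -/
lemma slope_mul_le (hp : Continuous p) (hpos : ∀ t, 0 < p t) (hq : Continuous q)
    (hG : LipschitzWith 1 G) (hGmono : Monotone G) (hGneg : ∀ u ≤ 0, G u = 0)
    (hq01 : ∀ t ∈ Icc (0:ℝ) 1, 0 ≤ q t) (h : IsTraj p q G z w) (hz0 : z 0 = 0) (hw0 : 0 < w 0)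
    (hz1 : 0 ≤ z 1) {δ t : ℝ} (hδ : 0 < δ) (hδt : δ ≤ t) (ht : t ≤ 1)
    (hδq : timeChange p δ * timeChange q 1 ≤ 1 / 2) :
    w 0 * timeChange p δ / 2 * (timeChange p 1 - timeChange p t) ≤ z t * timeChange p 1 := by
  have hw := h.antitoneOn_snd hGmono hGneg hq01
  have hA := strictMono_timeChange hp hpos
  have hAδ : 0 < timeChange p δ := timeChange_zero (p := p) ▸ hA hδ
  have hAδt := hA.monotone hδt
  have hAt := hA.monotone ht
  have h1 := h.sub_le_snd hp hpos hq hG hGmono hGneg hq01 hz0 hw0.le hδ.le (hδt.trans ht)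
  have h2 := (hG.nonneg_le_self hGmono (hGneg 0 le_rfl) (mul_pos hw0 hAδ).le).2
  have hQ : 0 ≤ timeChange q 1 := by
    have := monotoneOn_of_hasDerivAt_nonneg (fun r _ => hasDerivAt_timeChange hq r) hq01
      ⟨le_rfl, zero_le_one⟩ ⟨zero_le_one, le_rfl⟩ zero_le_one
    rwa [timeChange_zero] at this
  have c1 := h.le_chord hp hpos hw le_rfl hδ.le (hδt.trans ht)
  rw [hz0, timeChange_zero, sub_zero, sub_zero] at c1
  have c2 := h.le_chord hp hpos hw hδ.le hδt ht
  have c3 := h.chord_le hp hpos hw hδ.le hδt ht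
  have c4 := h.chord_le hp hpos hw (hδ.le.trans hδt) ht le_rfl
  generalize timeChange p t = At at *
  generalize timeChange p δ = Aδ at *
  generalize timeChange p 1 = A at *
  generalize timeChange q 1 = Q at *
  have h3 : w 0 / 2 ≤ w δ := by
    have := mul_le_mul_of_nonneg_right h2 hQ
    have := mul_le_mul_of_nonneg_left hδq hw0.le
    linarith
  have h4 : w 0 * Aδ / 2 ≤ z δ := by
    have := mul_le_mul_of_nonneg_right h3 hAδ.le
    linarith
  have hzδ : 0 ≤ z δ := le_trans (by positivity) h4
  have h5 : z δ * (A - At) ≤ z t * A := by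
    rcases le_total 0 (w t) with hwt | hwt
    · have e1 := mul_nonneg hwt (sub_nonneg.2 hAδt)
      have e2 : z δ * A ≤ z t * A := mul_le_mul_of_nonneg_right (by linarith) (by linarith)
      have e3 := mul_nonneg hzδ (by linarith : 0 ≤ At)
      linarith
    · have e1 : z δ * (A - At) ≤ (z t - w t * (At - Aδ)) * (A - At) :=
        mul_le_mul_of_nonneg_right (by linarith) (by linarith)
      have e2 : -(w t * (A - At)) * (At - Aδ) ≤ z t * (At - Aδ) :=
        mul_le_mul_of_nonneg_right (by linarith) (by linarith)
      have hzt : 0 ≤ z t := by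
        have := mul_nonpos_of_nonpos_of_nonneg hwt (sub_nonneg.2 hAt)
        linarith
      have e3 := mul_nonneg hzt hAδ.le
      linarith
  exact (mul_le_mul_of_nonneg_right h4 (by linarith)).trans h5

end IsTraj

/-- A filter on the line such that eventual properties at `u` propagate uniformly to all points
comparable to `u` up to positive constants. -/
def DilationStable (L : Filter ℝ) : Prop :=
  ∀ c C : ℝ, 0 < c → ∀ P : ℝ → Prop, (∀ᶠ u in L, P u) → ∀ᶠ r in L, ∀ u ∈ Icc (c * r) (C * r), P u

lemma dilationStable_nhdsGT_zero : DilationStable (𝓝[>] (0:ℝ)) := by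
  intro c C hc P hP
  obtain ⟨ε, hε, hεP⟩ := (mem_nhdsGT_iff_exists_Ioo_subset).1 hP
  have hC : 0 < max C 1 := lt_max_of_lt_right one_pos
  filter_upwards [Ioo_mem_nhdsGT (div_pos hε hC)] with r hr u hu
  refine hεP ⟨(mul_pos hc hr.1).trans_le hu.1, hu.2.trans_lt ?_⟩
  calc C * r ≤ max C 1 * r := mul_le_mul_of_nonneg_right (le_max_left _ _) hr.1.le
    _ < max C 1 * (ε / max C 1) := mul_lt_mul_of_pos_left hr.2 hC
    _ = ε := mul_div_cancel₀ _ hC.ne'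

lemma dilationStable_atTop : DilationStable atTop := by
  intro c C hc P hP
  obtain ⟨M, hM⟩ := eventually_atTop.1 hP
  filter_upwards [eventually_ge_atTop (M / c)] with r hr u hu
  exact hM u (((div_le_iff₀' hc).1 hr).trans hu.1)

section Shooting

variable {p q G : ℝ → ℝ} {L : Filter ℝ} {k : ℝ}

lemma eventually_slope_pos (hp : Continuous p) (hpos : ∀ t, 0 < p t) (hq : Continuous q)
    (hG : LipschitzWith 1 G) (hGmono : Monotone G) (hGneg : ∀ u ≤ 0, G u = 0)
    (hq01 : ∀ t ∈ Icc (0:ℝ) 1, 0 ≤ q t) (hL : DilationStable L) (hLpos : ∀ᶠ r in L, 0 < r)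
    (hk : Tendsto (fun u => G u / u) L (𝓝 k)) (hlt : k * timeChange p 1 * timeChange q 1 < 1) :
    ∀ᶠ r in L, ∀ z w, IsTraj p q G z w → z 0 = 0 → w 0 = r → 0 < z 1 ∧ 0 < w 1 := by
  have hA1 : 0 < timeChange p 1 := timeChange_zero (p := p) ▸ strictMono_timeChange hp hpos one_pos
  have hev := ((hk.mul_const (timeChange p 1)).mul_const (timeChange q 1)).eventually
    (gt_mem_nhds hlt)
  filter_upwards [hL _ (timeChange p 1) hA1 _ hev, hLpos] with r hr hr0 z w h hz0 hw0
  have h1 := hr (timeChange p 1 * r) ⟨le_rfl, le_rfl⟩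
  have h2 := h.sub_le_snd hp hpos hq hG hGmono hGneg hq01 hz0 (hw0 ▸ hr0.le) zero_le_one le_rfl
  have hw1 : 0 < w 1 := by
    refine lt_of_lt_of_le ?_ h2
    rw [hw0, mul_comm r, sub_pos]
    have h3 : G (timeChange p 1 * r) / (timeChange p 1 * r) * timeChange p 1 * timeChange q 1 =
        G (timeChange p 1 * r) * timeChange q 1 / r := by
      field_simp
    rwa [h3, div_lt_one hr0] at h1
  refine ⟨?_, hw1⟩
  have h4 := h.le_chord hp hpos (h.antitoneOn_snd hGmono hGneg hq01) le_rfl zero_le_one le_rfl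
  rw [hz0, timeChange_zero, sub_zero, sub_zero] at h4
  exact (mul_pos hw1 hA1).trans_le h4

lemma eventually_nonpos_at_one (hp : Continuous p) (hpos : ∀ t, 0 < p t) (hq : Continuous q)
    (hG : LipschitzWith 1 G) (hGmono : Monotone G) (hGneg : ∀ u ≤ 0, G u = 0)
    (hq01 : ∀ t ∈ Icc (0:ℝ) 1, 0 ≤ q t) (hL : DilationStable L) (hLpos : ∀ᶠ r in L, 0 < r)
    (hk : Tendsto (fun u => G u / u) L (𝓝 k)) {t₁ t₂ : ℝ} (ht₁ : 0 < t₁) (ht₁₂ : t₁ < t₂)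
    (ht₂ : t₂ < 1)
    (hlt : timeChange p 1 < k * (timeChange q t₂ - timeChange q t₁) *
      (timeChange p t₁ * (timeChange p 1 - timeChange p t₂))) :
    ∀ᶠ r in L, ∀ z w, IsTraj p q G z w → z 0 = 0 → w 0 = r → z 1 ≤ 0 := by
  have hA := strictMono_timeChange hp hpos
  have hA1 : 0 < timeChange p 1 := timeChange_zero (p := p) ▸ hA one_pos
  have hA2 : 0 < timeChange p 1 - timeChange p t₂ := sub_pos.2 (hA ht₂)
  obtain ⟨δ, hδ, hδt, hδq⟩ : ∃ δ, 0 < δ ∧ δ ≤ t₁ ∧ timeChange p δ * timeChange q 1 ≤ 1 / 2 := by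
    have hc : Tendsto (fun s => timeChange p s * timeChange q 1) (𝓝[>] 0) (𝓝 0) := by
      have := ((continuous_timeChange hp).mul_const (timeChange q 1)).tendsto 0
      rw [timeChange_zero, zero_mul] at this
      exact this.mono_left nhdsWithin_le_nhds
    obtain ⟨s, hs, hs'⟩ := ((hc.eventually (gt_mem_nhds one_half_pos)).and
      (Ioc_mem_nhdsGT ht₁)).exists
    exact ⟨s, hs'.1, hs'.2, hs.le⟩
  have hAδ : 0 < timeChange p δ := timeChange_zero (p := p) ▸ hA hδ
  have hc : 0 < timeChange p δ / 2 * (timeChange p 1 - timeChange p t₂) / timeChange p 1 := by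
    positivity
  have hev := ((hk.mul_const (timeChange q t₂ - timeChange q t₁)).mul_const
    (timeChange p t₁ * (timeChange p 1 - timeChange p t₂))).eventually (lt_mem_nhds hlt)
  filter_upwards [hL _ (timeChange p 1) hc _ hev, hLpos] with r hr hr0 z w h hz0 hw0
  by_contra! hz1
  have hw := h.antitoneOn_snd hGmono hGneg hq01
  have hlow : ∀ t, t₁ ≤ t → t ≤ t₂ →
      timeChange p δ / 2 * (timeChange p 1 - timeChange p t₂) / timeChange p 1 * r ≤ z t := by
    intro t h1 h2
    have h3 := h.slope_mul_le hp hpos hq hG hGmono hGneg hq01 hz0 (hw0 ▸ hr0) hz1.le hδ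
      (hδt.trans h1) (h2.trans ht₂.le) hδq
    rw [hw0] at h3
    have h4 : timeChange p t ≤ timeChange p t₂ := hA.monotone h2
    have h5 : r * timeChange p δ / 2 * (timeChange p 1 - timeChange p t₂) ≤
        r * timeChange p δ / 2 * (timeChange p 1 - timeChange p t) :=
      mul_le_mul_of_nonneg_left (by linarith) (by positivity)
    rw [div_mul_eq_mul_div, div_le_iff₀ hA1]
    linarith
  set m := min (z t₁) (z t₂) with hm
  have hmlow := le_min (hlow t₁ le_rfl ht₁₂.le) (hlow t₂ ht₁₂.le le_rfl)
  have hmhigh : m ≤ timeChange p 1 * r := by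
    have h1 := h.chord_le hp hpos hw le_rfl ht₁.le (ht₁₂.trans ht₂).le
    rw [hz0, timeChange_zero, sub_zero, sub_zero, hw0] at h1
    have h2 := mul_le_mul_of_nonneg_left (hA.monotone (ht₁₂.trans ht₂).le) hr0.le
    exact (min_le_left _ _).trans (by linarith)
  have hm0 : 0 < m := (mul_pos hc hr0).trans_le hmlow
  have h1 := h.green_estimate hp hpos hq hGmono hGneg hq01 hz0 hz1.le ht₁ ht₁₂ ht₂
  rw [← hm] at h1
  have h2 := mul_lt_mul_of_pos_left (hr m ⟨hmlow, hmhigh⟩) hm0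
  have h3 : m * (G m / m * (timeChange q t₂ - timeChange q t₁) *
      (timeChange p t₁ * (timeChange p 1 - timeChange p t₂))) =
      G m * (timeChange q t₂ - timeChange q t₁) *
      (timeChange p t₁ * (timeChange p 1 - timeChange p t₂)) := by
    field_simp
  linarith

/-- If a trajectory with initial slope `r₁` stays increasing up to time one and one with initial
slope `r₂` vanishes before time one, then some intermediate slope gives a positive decaying
trajectory. -/
lemma exists_decaying_of_shooting (hp : Continuous p) (hpos : ∀ t, 0 < p t) (hq : Continuous q)
    (hG : LipschitzWith 1 G) (hGmono : Monotone G) (hGneg : ∀ u ≤ 0, G u = 0) {B : ℝ}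
    (hB : 0 < B) (hqB : ∀ t, 1 ≤ t → q t ≤ B) (hdisc : Disconjugate2 (fun t => B * p t) (Ici 1))
    {r₁ r₂ : ℝ} (hr₁ : 0 < r₁) (hr₂ : 0 < r₂)
    (h₁ : ∀ z w, IsTraj p q G z w → z 0 = 0 → w 0 = r₁ → 0 < z 1 ∧ 0 < w 1)
    (h₂ : ∀ z w, IsTraj p q G z w → z 0 = 0 → w 0 = r₂ → z 1 ≤ 0) :
    ∃ z w, IsTraj p q G z w ∧ z 0 = 0 ∧ (∀ t, 0 < t → 0 < z t) ∧ Tendsto z atTop (𝓝 0) := by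
  obtain ⟨ℓ, Y, U, hY⟩ := exists_decayingBarrier hp hpos hB hdisc
  have hG0 := hGneg 0 le_rfl
  choose Z W hZ hZ0 hW0 using fun r => exists_isTraj hp hq hG hG0 0 r
  have hcont : ∀ T, 0 ≤ T → Continuous fun r => Z r T := by
    intro T hT
    obtain ⟨C, hC⟩ := IsTraj.exists_dist_le hp hq hG hT
    refine (LipschitzWith.of_dist_le' (K := C) fun r s => ?_).continuous
    have := hC _ _ _ _ (hZ r) (hZ s) (by rw [hZ0, hZ0])
    rwa [hW0, hW0] at this
  have hIpos : ∀ r ∈ uIcc r₁ r₂, 0 < r := fun r hr => (lt_min hr₁ hr₂).trans_le hr.1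
  have hroot : ∀ n : ℕ, ∃ r ∈ uIcc r₁ r₂, Z r (n + 2) = 0 := by
    intro n
    have hn : (0:ℝ) < n + 2 := by positivity
    have hn1 : (1:ℝ) < n + 2 := by linarith [n.cast_nonneg (α := ℝ)]
    have ha : 0 < Z r₁ (n + 2) :=
      (hZ r₁).pos_of_snd_one_pos hp hpos hq hG hGmono hGneg hB.le hqB hY (hZ0 _)
        (hr₁.trans_eq (hW0 r₁).symm)
        (h₁ _ _ (hZ r₁) (hZ0 _) (hW0 _)).1 (h₁ _ _ (hZ r₁) (hZ0 _) (hW0 _)).2 hn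
    have hb : Z r₂ (n + 2) < 0 := by
      obtain ⟨t, -, ht, -, -, -, hneg⟩ := (hZ r₂).exists_first_zero hp hpos hq hG hGneg (hZ0 _)
        (hr₂.trans_eq (hW0 r₂).symm) one_pos (h₂ _ _ (hZ r₂) (hZ0 _) (hW0 _))
      exact hneg _ (ht.trans_lt hn1)
    obtain ⟨r, hr, hr'⟩ := intermediate_value_uIcc (hcont _ hn.le).continuousOn
      (mem_uIcc.2 (Or.inr ⟨hb.le, ha.le⟩))
    exact ⟨r, hr, hr'⟩
  choose r hrI hr using hroot
  have hbound : ∀ n : ℕ, (∀ t ∈ Icc (0:ℝ) (n + 2), 0 ≤ Z (r n) t) ∧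
      ∀ t ∈ Icc (1:ℝ) (n + 2), Z (r n) t ≤ Z (r n) 1 * Y t / Y 1 := by
    intro n
    obtain ⟨T, hT0, hT, hzT, hwT, hzpos, hzneg⟩ := (hZ (r n)).exists_first_zero hp hpos hq hG hGneg
      (hZ0 _) ((hW0 (r n)).symm ▸ hIpos _ (hrI n)) (by positivity : (0:ℝ) < n + 2) (hr n).le
    obtain rfl : T = n + 2 := hT.eq_or_lt.resolve_right fun h => (hzneg _ h).ne (hr n)
    have hnn : ∀ t ∈ Icc (0:ℝ) (n + 2), 0 ≤ Z (r n) t := by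
      intro t ht
      rcases ht.1.eq_or_lt with rfl | h0
      · exact (hZ0 _).ge
      rcases ht.2.eq_or_lt with rfl | h1
      · exact hzT.ge
      exact (hzpos t ⟨h0, h1⟩).le
    exact ⟨hnn, fun t ht => (hZ (r n)).mul_le_barrier hpos hG hGmono hG0 hB.le hqB hY
      (fun s hs => hnn s ⟨zero_le_one.trans hs.1, hs.2⟩) hzT hwT.le ht⟩
  obtain ⟨r₀, hr₀, φ, hφ, hlim⟩ := isCompact_uIcc.tendsto_subseq hrI
  have hZlim : ∀ T, 0 ≤ T → Tendsto (fun n => Z (r (φ n)) T) atTop (𝓝 (Z r₀ T)) :=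
    fun T hT => ((hcont T hT).tendsto r₀).comp hlim
  have hlate : ∀ t : ℝ, ∀ᶠ n in atTop, t ≤ (φ n : ℝ) + 2 := fun t =>
    ((tendsto_natCast_atTop_atTop.comp hφ.tendsto_atTop).eventually_ge_atTop t).mono
      fun n hn => by simp only [Function.comp_apply] at hn; linarith
  have hnn : ∀ t, 0 ≤ t → 0 ≤ Z r₀ t := fun t ht =>
    ge_of_tendsto (hZlim t ht) ((hlate t).mono fun n hn => (hbound _).1 t ⟨ht, hn⟩)
  have hle : ∀ t, 1 ≤ t → Z r₀ t ≤ Z r₀ 1 * Y t / Y 1 := fun t ht =>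
    le_of_tendsto_of_tendsto (hZlim t (zero_le_one.trans ht))
      (((hZlim 1 zero_le_one).mul_const (Y t)).div_const (Y 1))
      ((hlate t).mono fun n hn => (hbound _).2 t ⟨ht, hn⟩)
  refine ⟨Z r₀, W r₀, hZ r₀, hZ0 _, fun t ht => ?_, ?_⟩
  · by_contra! hcon
    obtain ⟨T, hT0, -, -, -, -, hneg⟩ := (hZ r₀).exists_first_zero hp hpos hq hG hGneg
      (hZ0 _) ((hW0 r₀).symm ▸ hIpos _ hr₀) ht hcon
    exact (hneg (T + 1) (lt_add_one T)).not_ge (hnn _ (by linarith))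
  · have hYlim := (hY.tendsto.const_mul (Z r₀ 1)).div_const (Y 1)
    rw [mul_zero, zero_div] at hYlim
    exact squeeze_zero' ((eventually_ge_atTop 0).mono hnn) ((eventually_ge_atTop 1).mono hle) hYlim

lemma exists_decaying_of_limits (hp : Continuous p) (hpos : ∀ t, 0 < p t) (hq : Continuous q)
    (hG : LipschitzWith 1 G) (hGmono : Monotone G) (hGneg : ∀ u ≤ 0, G u = 0) {B : ℝ}
    (hq01 : ∀ t ∈ Icc (0:ℝ) 1, 0 ≤ q t)
    (hB : 0 < B) (hqB : ∀ t, 1 ≤ t → q t ≤ B) (hdisc : Disconjugate2 (fun t => B * p t) (Ici 1))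
    {L₁ L₂ : Filter ℝ} [L₁.NeBot] [L₂.NeBot] (hL₁ : DilationStable L₁) (hL₂ : DilationStable L₂)
    (hpos₁ : ∀ᶠ r in L₁, 0 < r) (hpos₂ : ∀ᶠ r in L₂, 0 < r) {k₁ k₂ : ℝ}
    (hk₁ : Tendsto (fun u => G u / u) L₁ (𝓝 k₁)) (hk₂ : Tendsto (fun u => G u / u) L₂ (𝓝 k₂))
    (hlt₁ : k₁ * timeChange p 1 * timeChange q 1 < 1) {t₁ t₂ : ℝ} (ht₁ : 0 < t₁) (ht₁₂ : t₁ < t₂)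
    (ht₂ : t₂ < 1)
    (hlt₂ : timeChange p 1 < k₂ * (timeChange q t₂ - timeChange q t₁) *
      (timeChange p t₁ * (timeChange p 1 - timeChange p t₂))) :
    ∃ z w, IsTraj p q G z w ∧ z 0 = 0 ∧ (∀ t, 0 < t → 0 < z t) ∧ Tendsto z atTop (𝓝 0) := by
  obtain ⟨r₁, h₁, hr₁⟩ := ((eventually_slope_pos hp hpos hq hG hGmono hGneg hq01 hL₁ hpos₁ hk₁
    hlt₁).and hpos₁).exists
  obtain ⟨r₂, h₂, hr₂⟩ := ((eventually_nonpos_at_one hp hpos hq hG hGmono hGneg hq01 hL₂ hpos₂ hk₂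
    ht₁ ht₁₂ ht₂ hlt₂).and hpos₂).exists
  exact exists_decaying_of_shooting hp hpos hq hG hGmono hGneg hB hqB hdisc hr₁ hr₂ h₁ h₂

end Shooting

/-- A function with one-sided derivative in `[0, 1]` on the half-line, frozen to the left of zero,
is `1`-Lipschitz. -/
lemma lipschitzWith_one_comp_max {F F' : ℝ → ℝ}
    (hF : ∀ u ∈ Ici (0:ℝ), HasDerivWithinAt F (F' u) (Ici 0) u)
    (hF' : ∀ u ∈ Ici (0:ℝ), 0 ≤ F' u ∧ F' u ≤ 1) : LipschitzWith 1 fun u => F (max u 0) := by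
  have h1 : LipschitzOnWith 1 F (Ici 0) :=
    (convex_Ici 0).lipschitzOnWith_of_nnnorm_hasDerivWithin_le hF fun u hu => by
      rw [← NNReal.coe_le_coe, coe_nnnorm, Real.norm_eq_abs, abs_of_nonneg (hF' u hu).1]
      exact (hF' u hu).2
  refine LipschitzWith.of_dist_le_mul fun u v => ?_
  refine (h1.dist_le_mul _ (le_max_right u 0) _ (le_max_right v 0)).trans ?_
  simpa using (LipschitzWith.id.max_const (0:ℝ)).dist_le_mul u v

lemma monotone_comp_max {F F' : ℝ → ℝ}
    (hF : ∀ u ∈ Ici (0:ℝ), HasDerivWithinAt F (F' u) (Ici 0) u)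
    (hF' : ∀ u ∈ Ici (0:ℝ), 0 ≤ F' u ∧ F' u ≤ 1) : Monotone fun u => F (max u 0) := by
  have h1 : MonotoneOn F (Ici 0) :=
    monotoneOn_of_hasDerivWithinAt_nonneg (convex_Ici 0) (fun u hu => (hF u hu).continuousWithinAt)
      (fun u hu => (hF u (interior_subset hu)).mono interior_subset)
      fun u hu => (hF' u (interior_subset hu)).1
  exact fun u v huv => h1 (le_max_right u 0) (le_max_right v 0) (max_le_max_right 0 huv)

lemma eq_zero_of_mul_self_pos {F : ℝ → ℝ} (hF : Continuous F)
    (hsign : ∀ u : ℝ, u ≠ 0 → 0 < F u * u) : F 0 = 0 := by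
  refine le_antisymm ?_ ?_
  · refine le_of_tendsto (hF.continuousWithinAt (s := Iio 0) (x := 0)) ?_
    filter_upwards [self_mem_nhdsWithin] with u (hu : u < 0)
    exact (neg_of_mul_pos_left (hsign u hu.ne) hu.le).le
  · refine ge_of_tendsto (hF.continuousWithinAt (s := Ioi 0) (x := 0)) ?_
    filter_upwards [self_mem_nhdsWithin] with u (hu : 0 < u)
    exact (pos_of_mul_pos_left (hsign u hu.ne') hu.le).le

lemma intervalIntegral_comp_max {f : ℝ → ℝ} {x y : ℝ} (hx : 0 ≤ x) (hy : 0 ≤ y) :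
    ∫ t in x..y, f (max t 0) = ∫ t in x..y, f t :=
  intervalIntegral.integral_congr fun t ht => by
    simp only [max_eq_left ((le_min hx hy).trans ht.1)]

lemma ContinuousOn.comp_max_zero {f : ℝ → ℝ} (hf : ContinuousOn f (Ici 0)) :
    Continuous fun t => f (max t 0) :=
  hf.comp_continuous (by fun_prop) fun t => le_max_right t 0

/-- Corollary 2: under the assumptions of the main theorem, the perturbed equation
`(a z')' + (b + b₁) F(z) = 0`, where `b₁ ≡ 0` on `[0,1]` and `b₁ ≤ 0` for `t > 1`,
has a solution satisfying the Dirichlet conditions on the half-line. -/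
theorem dirichlet_halfline_perturbed
    (a b F : ℝ → ℝ) (B k₀ kinf : ℝ)
    (ha_cont : ContinuousOn a (Ici 0)) (ha_pos : ∀ t ∈ Ici (0:ℝ), 0 < a t)
    (ha_int : IntegrableOn (fun t => 1 / a t) (Ici 0))
    (hb_cont : ContinuousOn b (Ici 0))
    (hb_nonneg : ∀ t ∈ Icc (0:ℝ) 1, 0 ≤ b t)
    (hb_ne : ∃ t ∈ Icc (0:ℝ) 1, b t ≠ 0)
    (hB : 0 < B) (hbB : ∀ t ∈ Ici (1:ℝ), b t ≤ B)
    (hF_cont : Continuous F) (hF_sign : ∀ u : ℝ, u ≠ 0 → 0 < F u * u)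
    (F' : ℝ → ℝ) (hF_deriv : ∀ u ∈ Ici (0:ℝ), HasDerivWithinAt F (F' u) (Ici 0) u)
    (hF'_bd : ∀ u ∈ Ici (0:ℝ), 0 ≤ F' u ∧ F' u ≤ 1)
    (hk₀ : Tendsto (fun u => F u / u) (𝓝[>] (0:ℝ)) (𝓝 k₀))
    (hkinf : Tendsto (fun u => F u / u) atTop (𝓝 kinf))
    (hk₀_nonneg : 0 ≤ k₀) (hk_ne : k₀ ≠ kinf)
    (hdisc : Disconjugate2 (fun t => B / a t) (Ici 1))
    (t₁ t₂ : ℝ) (ht₁ : t₁ ∈ Ioo (0:ℝ) 1) (ht₂ : t₂ ∈ Ioo (0:ℝ) 1) (ht₁₂ : t₁ < t₂)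
    (hb_int_pos : 0 < ∫ t in t₁..t₂, b t)
    (hA1 : min k₀ kinf * (∫ s in (0:ℝ)..1, 1 / a s) * (∫ t in (0:ℝ)..1, |b t|) < 1)
    (hA2 : max k₀ kinf * (∫ t in t₁..t₂, b t) >
      (∫ s in (0:ℝ)..1, 1 / a s) /
        ((∫ s in (0:ℝ)..t₁, 1 / a s) *
          ((∫ s in (0:ℝ)..1, 1 / a s) - ∫ s in (0:ℝ)..t₂, 1 / a s)))
    (b₁ : ℝ → ℝ) (hb₁_cont : ContinuousOn b₁ (Ici 0))
    (hb₁_zero : ∀ t ∈ Icc (0:ℝ) 1, b₁ t = 0)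
    (hb₁_nonpos : ∀ t ∈ Ioi (1:ℝ), b₁ t ≤ 0) :
    ∃ z z' : ℝ → ℝ, SolODE a (fun t => b t + b₁ t) F (Ici 0) z z' ∧
      z 0 = 0 ∧ (∀ t, 0 < t → 0 < z t) ∧ Tendsto z atTop (𝓝 0) := by
  set p : ℝ → ℝ := fun t => 1 / a (max t 0) with hpdef
  set q : ℝ → ℝ := fun t => b (max t 0) + b₁ (max t 0) with hqdef
  set G : ℝ → ℝ := fun u => F (max u 0) with hGdef
  have hpos : ∀ t, 0 < p t := fun t => one_div_pos.2 (ha_pos _ (le_max_right t 0))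
  have hp : Continuous p :=
    continuous_const.div ha_cont.comp_max_zero fun t => (ha_pos _ (le_max_right t 0)).ne'
  have hq : Continuous q := hb_cont.comp_max_zero.add hb₁_cont.comp_max_zero
  have hG : LipschitzWith 1 G := lipschitzWith_one_comp_max hF_deriv hF'_bd
  have hGmono : Monotone G := monotone_comp_max hF_deriv hF'_bd
  have hF0 := eq_zero_of_mul_self_pos hF_cont hF_sign
  have hGneg : ∀ u ≤ 0, G u = 0 := fun u hu => by simp only [hGdef, max_eq_right hu, hF0]
  have hGF : ∀ u, 0 ≤ u → G u = F u := fun u hu => by simp only [hGdef, max_eq_left hu]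
  have hpa : ∀ t, 0 ≤ t → p t = 1 / a t := fun t ht => by simp only [hpdef, max_eq_left ht]
  have hqb : ∀ t, 0 ≤ t → q t = b t + b₁ t := fun t ht => by simp only [hqdef, max_eq_left ht]
  have hqb01 : ∀ t ∈ Icc (0:ℝ) 1, q t = b t := fun t ht => by
    rw [hqb t ht.1, hb₁_zero t ht, add_zero]
  have hq01 : ∀ t ∈ Icc (0:ℝ) 1, 0 ≤ q t := fun t ht => hqb01 t ht ▸ hb_nonneg t ht
  have hqB : ∀ t, 1 ≤ t → q t ≤ B := by
    intro t ht
    rw [hqb t (zero_le_one.trans ht)]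
    rcases ht.eq_or_lt with rfl | h
    · rw [hb₁_zero 1 ⟨zero_le_one, le_rfl⟩, add_zero]
      exact hbB 1 ht
    · exact (add_le_of_nonpos_right (hb₁_nonpos t h)).trans (hbB t ht)
  have hdisc' : Disconjugate2 (fun t => B * p t) (Ici 1) := by
    intro v v' v'' hv
    refine hdisc v v' v'' ⟨hv.1, hv.2.1, hv.2.2.1, fun t ht => ?_⟩
    have h := hv.2.2.2 t ht
    beta_reduce at h ⊢
    rwa [hpa t (zero_le_one.trans ht), mul_one_div] at h
  have hAint : ∀ t, 0 ≤ t → ∫ s in (0:ℝ)..t, 1 / a s = timeChange p t := fun t ht =>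
    (intervalIntegral_comp_max (f := fun t => 1 / a t) le_rfl ht).symm
  have hQ1 : ∫ t in (0:ℝ)..1, |b t| = timeChange q 1 :=
    intervalIntegral.integral_congr fun t ht => by
      rw [uIcc_of_le zero_le_one] at ht
      simp only [hqb01 t ht, abs_of_nonneg (hb_nonneg t ht)]
  have hQ12 : ∫ t in t₁..t₂, b t = timeChange q t₂ - timeChange q t₁ := by
    rw [timeChange, timeChange, intervalIntegral.integral_interval_sub_left
      (hq.intervalIntegrable _ _) (hq.intervalIntegrable _ _)]
    refine intervalIntegral.integral_congr fun t ht => ?_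
    rw [uIcc_of_le ht₁₂.le] at ht
    exact (hqb01 t ⟨ht₁.1.le.trans ht.1, ht.2.trans ht₂.2.le⟩).symm
  rw [hAint 1 zero_le_one, hQ1] at hA1
  have hA := strictMono_timeChange hp hpos
  have hden : 0 < timeChange p t₁ * (timeChange p 1 - timeChange p t₂) :=
    mul_pos (timeChange_zero (p := p) ▸ hA ht₁.1) (sub_pos.2 (hA ht₂.2))
  rw [hAint 1 zero_le_one, hAint t₁ ht₁.1.le, hAint t₂ ht₂.1.le, hQ12, gt_iff_lt,
    div_lt_iff₀ hden] at hA2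
  have hG₀ : Tendsto (fun u => G u / u) (𝓝[>] (0:ℝ)) (𝓝 k₀) :=
    hk₀.congr' (eventually_mem_nhdsWithin.mono fun u hu => by
      beta_reduce
      rw [hGF u (le_of_lt hu)])
  have hGinf : Tendsto (fun u => G u / u) atTop (𝓝 kinf) :=
    hkinf.congr' ((eventually_ge_atTop 0).mono fun u hu => by
      beta_reduce
      rw [hGF u hu])
  have hpos₀ : ∀ᶠ r in 𝓝[>] (0:ℝ), 0 < r := eventually_mem_nhdsWithin
  obtain ⟨z, w, h, hz0, hzpos, hzlim⟩ : ∃ z w, IsTraj p q G z w ∧ z 0 = 0 ∧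
      (∀ t, 0 < t → 0 < z t) ∧ Tendsto z atTop (𝓝 0) := by
    rcases le_total k₀ kinf with hk | hk
    · rw [min_eq_left hk] at hA1
      rw [max_eq_right hk] at hA2
      exact exists_decaying_of_limits hp hpos hq hG hGmono hGneg hq01 hB hqB hdisc'
        dilationStable_nhdsGT_zero dilationStable_atTop hpos₀ (eventually_gt_atTop 0) hG₀ hGinf
        hA1 ht₁.1 ht₁₂ ht₂.2 hA2
    · rw [min_eq_right hk] at hA1
      rw [max_eq_left hk] at hA2
      exact exists_decaying_of_limits hp hpos hq hG hGmono hGneg hq01 hB hqB hdisc'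
        dilationStable_atTop dilationStable_nhdsGT_zero (eventually_gt_atTop 0) hpos₀ hGinf hG₀
        hA1 ht₁.1 ht₁₂ ht₂.2 hA2
  have hznn : ∀ t, 0 ≤ t → 0 ≤ z t := fun t ht =>
    ht.eq_or_lt.elim (fun e => e ▸ hz0.ge) fun h0 => (hzpos t h0).le
  have haw : ∀ t ∈ Ici (0:ℝ), a t * (p t * w t) = w t := fun t ht => by
    rw [hpa t ht, ← mul_assoc, mul_one_div_cancel (ha_pos t ht).ne', one_mul]
  refine ⟨z, fun t => p t * w t, ⟨fun t _ => (h.fst t).hasDerivWithinAt,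
    (hp.mul h.continuous_snd).continuousOn, fun t => -(q t * G (z t)), fun t ht =>
      (h.snd t).hasDerivWithinAt.congr haw (haw t ht),
    (hq.mul (hG.continuous.comp h.continuous_fst)).neg.continuousOn, fun t ht => ?_⟩,
    hz0, hzpos, hzlim⟩
  beta_reduce
  rw [hqb t ht, hGF _ (hznn t ht), neg_add_cancel]
end
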